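/- arXiv:2411.14965 — 13 statements merged into one kernel-verified Lean document; each statement's English description precedes it below -/
import Mathlib

section
/- Let f : ℝ → ℂ be continuous and 1-periodic, and suppose that every Fourier coefficient f̂(k) (k ∈ ℤ) is a nonnegative real number. Then the family (f̂(k))_{k∈ℤ} is summable, and moreover every symmetric partial sum satisfies ∑_{|k| ≤ m} f̂(k) ≤ f(0) for all m ∈ ℕ. -/
/-- The Fourier coefficient `∫₀¹ f(θ) e^{−2πikθ} dθ` of a complex-valued function. -/
noncomputable def fourierCoeffOn01C (f : ℝ → ℂ) (k : ℤ) : ℂ :=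
  ∫ θ in (0:ℝ)..1, f θ * Complex.exp (-2 * Real.pi * Complex.I * k * θ)

open AddCircle in
/-- Pairing with the (unnormalized) Fejér kernel. -/
theorem sum_fourierCoeff_sub_eq_integral {T : ℝ} [Fact (0 < T)] (F : C(AddCircle T, ℂ)) (N : ℕ) :
    ∑ i ∈ Finset.range N, ∑ j ∈ Finset.range N, fourierCoeff F ((i : ℤ) - j) =
      ∫ t, ((‖∑ j ∈ Finset.range N, fourier (j : ℤ) t‖ ^ 2 : ℝ) : ℂ) * F t ∂haarAddCircle := by
  have hmul (n : ℤ) : MeasureTheory.Integrable (fun t => fourier n t * F t)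
      (haarAddCircle : MeasureTheory.Measure (AddCircle T)) :=
    Continuous.integrable_of_hasCompactSupport (by fun_prop)
      (HasCompactSupport.of_compactSpace _)
  simp only [fourierCoeff, smul_eq_mul]
  simp_rw [← MeasureTheory.integral_finsetSum _ fun (j : ℕ) _ => hmul _]
  rw [← MeasureTheory.integral_finsetSum _ fun (i : ℕ) _ =>
    MeasureTheory.integrable_finsetSum _ fun (j : ℕ) _ => hmul _]
  congr 1 with t
  simp_rw [← Finset.sum_mul]
  congr 1
  rw [Complex.ofReal_pow, ← Complex.conj_mul', map_sum, Finset.sum_mul_sum]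
  simp_rw [neg_sub, sub_eq_neg_add, fourier_add, fourier_neg]

open AddCircle in
theorem norm_sum_fourierCoeff_sub_le {T : ℝ} [Fact (0 < T)] (F : C(AddCircle T, ℂ)) (N : ℕ) :
    ‖∑ i ∈ Finset.range N, ∑ j ∈ Finset.range N, fourierCoeff F ((i : ℤ) - j)‖ ≤ N * ‖F‖ := by
  have hN : ∫ t : AddCircle T, ‖∑ j ∈ Finset.range N, fourier (j : ℤ) t‖ ^ 2 ∂haarAddCircle
      = (N : ℝ) := by
    have h := sum_fourierCoeff_sub_eq_integral (fourier 0 : C(AddCircle T, ℂ)) N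
    simp only [fourierCoeff_fourier, fourier_zero, mul_one, integral_complex_ofReal] at h
    rw [← Complex.ofReal_inj, ← h]
    simp only [Pi.single_apply, sub_eq_zero, Nat.cast_inj, Finset.sum_ite_eq]
    rw [Finset.sum_congr rfl fun i hi => if_pos hi]
    simp
  rw [sum_fourierCoeff_sub_eq_integral, ← hN, ← MeasureTheory.integral_mul_const]
  refine MeasureTheory.norm_integral_le_of_norm_le ?_ (.of_forall fun t => ?_)
  · exact Continuous.integrable_of_hasCompactSupport (by fun_prop)
      (HasCompactSupport.of_compactSpace _)
  · rw [norm_mul, Complex.norm_real, Real.norm_of_nonneg (by positivity)]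
    gcongr
    exact F.norm_coe_le_norm t

theorem sum_Icc_fourierCoeff_re_le {T : ℝ} [Fact (0 < T)] (F : C(AddCircle T, ℂ))
    (hF : ∀ k, 0 ≤ (fourierCoeff F k).re) (m : ℕ) :
    ∑ k ∈ Finset.Icc (-(m : ℤ)) m, (fourierCoeff F k).re ≤ 2 * ‖F‖ := by
  set c : ℤ → ℝ := fun k => (fourierCoeff F k).re with hc
  set S := ∑ k ∈ Finset.Icc (-(m : ℤ)) m, c k with hS
  have hrow (i : ℕ) (hi : i ∈ Finset.Ico m (3 * m + 1)) :
      S ≤ ∑ j ∈ Finset.range (4 * m + 1), c ((i : ℤ) - j) := by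
    rw [Finset.mem_Ico] at hi
    have hinj : Set.InjOn (fun j : ℕ => (i : ℤ) - j) (Finset.range (4 * m + 1)) := by
      intro a _ b _ h
      simpa using h
    rw [← Finset.sum_image (f := c) hinj]
    refine Finset.sum_le_sum_of_subset_of_nonneg (fun k hk => ?_) fun k _ _ => hF k
    rw [Finset.mem_Icc] at hk
    exact Finset.mem_image.2 ⟨(i - k).toNat, by rw [Finset.mem_range]; omega, by omega⟩
  have hlow : (2 * m + 1 : ℝ) * S ≤
      ∑ i ∈ Finset.range (4 * m + 1), ∑ j ∈ Finset.range (4 * m + 1), c ((i : ℤ) - j) := by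
    calc (2 * m + 1 : ℝ) * S = ∑ i ∈ Finset.Ico m (3 * m + 1), S := by
          rw [Finset.sum_const, Nat.card_Ico, nsmul_eq_mul,
            show 3 * m + 1 - m = 2 * m + 1 by omega]
          push_cast
          ring
      _ ≤ ∑ i ∈ Finset.Ico m (3 * m + 1), ∑ j ∈ Finset.range (4 * m + 1), c ((i : ℤ) - j) :=
          Finset.sum_le_sum hrow
      _ ≤ _ := Finset.sum_le_sum_of_subset_of_nonneg
          (fun i hi => by rw [Finset.mem_Ico] at hi; rw [Finset.mem_range]; omega)
          fun i _ _ => Finset.sum_nonneg fun j _ => hF _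
  have hup := (Complex.re_le_norm _).trans (norm_sum_fourierCoeff_sub_le F (4 * m + 1))
  simp only [Complex.re_sum] at hup
  have h := hlow.trans hup
  push_cast at h
  have hm : (0 : ℝ) < 2 * m + 1 := by positivity
  refine le_of_mul_le_mul_left (h.trans ?_) hm
  nlinarith [norm_nonneg F]

theorem summable_fourierCoeff_of_nonneg {T : ℝ} [Fact (0 < T)] (F : C(AddCircle T, ℂ))
    (him : ∀ k, (fourierCoeff F k).im = 0) (hre : ∀ k, 0 ≤ (fourierCoeff F k).re) :
    Summable (fourierCoeff F) := by
  have hsum : Summable fun k => (fourierCoeff F k).re := by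
    refine summable_of_sum_le hre (c := 2 * ‖F‖) fun u => ?_
    refine le_trans ?_ (sum_Icc_fourierCoeff_re_le F hre (u.sup Int.natAbs))
    refine Finset.sum_le_sum_of_subset_of_nonneg (fun k hk => ?_) fun k _ _ => hre k
    have := Finset.le_sup (f := Int.natAbs) hk
    rw [Finset.mem_Icc]
    omega
  convert Complex.ofRealCLM.summable hsum using 2 with k
  exact Complex.ext rfl (by simpa using him k)

/-- If `f : ℝ → ℂ` is continuous, `1`-periodic and all its Fourier coefficients are
nonnegative reals, then the family of Fourier coefficients is summable and every symmetric
partial sum is bounded by `f(0)`. -/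
theorem stmt1 (f : ℝ → ℂ) (hcont : Continuous f) (hper : Function.Periodic f 1)
    (hnn : ∀ k : ℤ, (fourierCoeffOn01C f k).im = 0 ∧ 0 ≤ (fourierCoeffOn01C f k).re) :
    Summable (fun k : ℤ => fourierCoeffOn01C f k) ∧
    ∀ m : ℕ, (∑ k ∈ Finset.Icc (-(m:ℤ)) (m:ℤ), (fourierCoeffOn01C f k).re) ≤ (f 0).re := by
  let F : C(AddCircle (1 : ℝ), ℂ) := ⟨hper.lift, continuous_coinduced_dom.mpr hcont⟩
  have hcoeff : fourierCoeffOn01C f = fourierCoeff F := by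
    funext k
    rw [fourierCoeff_eq_intervalIntegral _ _ 0, fourierCoeffOn01C]
    simp only [zero_add, div_one, one_smul]
    congr 1 with θ
    rw [fourier_coe_apply, smul_eq_mul, mul_comm]
    congr 2
    push_cast
    ring
  rw [hcoeff] at hnn ⊢
  have hsum := summable_fourierCoeff_of_nonneg F (fun k => (hnn k).1) fun k => (hnn k).2
  refine ⟨hsum, fun m => ?_⟩
  have h0 := has_pointwise_sum_fourier_series_of_summable hsum 0
  simp only [fourier_eval_zero, smul_eq_mul, mul_one] at h0
  exact sum_le_hasSum _ (fun k _ => (hnn k).2) (Complex.hasSum_re h0)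
end

section
/- The function h : ℝ → ℝ defined by h(θ) = ∑_{n=1}^∞ 2^{−n} cos(2^n π θ) is continuous on ℝ but is differentiable at no point of ℝ. (This function is the Floquet eigenvalue function of the adjacency operator of the ℤ-periodic graph with one-element fundamental cell and weights w(k) = 1/(4k) if |k| = 2^{n−1} for some n ≥ 1 and w(k) = 0 otherwise.) -/
/-- The Weierstraß-type function `h(θ) = ∑_{n=1}^∞ 2^{−n} cos(2^n π θ)`. -/
noncomputable def weierstrassH (θ : ℝ) : ℝ :=
  ∑' n : ℕ, (1/2 : ℝ)^(n+1) * Real.cos (2^(n+1) * Real.pi * θ)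

theorem norm_weierstrassH_term_le (n : ℕ) (θ : ℝ) :
    ‖(1/2 : ℝ)^(n+1) * Real.cos (2^(n+1) * Real.pi * θ)‖ ≤ (1/2 : ℝ)^(n+1) := by
  rw [norm_mul, Real.norm_eq_abs, Real.norm_eq_abs, abs_of_nonneg (by positivity)]
  exact mul_le_of_le_one_right (by positivity) (Real.abs_cos_le_one _)

theorem summable_half_pow_succ : Summable fun n : ℕ => (1/2 : ℝ)^(n+1) :=
  (summable_nat_add_iff 1).2 summable_geometric_two

theorem continuous_weierstrassH : Continuous weierstrassH :=
  continuous_tsum (fun _ => by fun_prop) summable_half_pow_succ norm_weierstrassH_term_le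

theorem weierstrassH_half (x : ℝ) :
    weierstrassH (x / 2) = (Real.cos (Real.pi * x) + weierstrassH x) / 2 := by
  have hs : Summable fun n : ℕ => (1/2 : ℝ)^(n+1) * Real.cos (2^(n+1) * Real.pi * (x / 2)) :=
    summable_half_pow_succ.of_norm_bounded fun n => norm_weierstrassH_term_le n _
  unfold weierstrassH
  rw [hs.tsum_eq_zero_add, add_div, ← tsum_div_const]
  congr 1
  · rw [show (2 : ℝ)^(0+1) * Real.pi * (x / 2) = Real.pi * x by ring]
    ring
  · refine tsum_congr fun n => ?_
    rw [show (2 : ℝ)^(n+1+1) * Real.pi * (x / 2) = 2^(n+1) * Real.pi * x by ring]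
    ring

theorem weierstrassH_intCast (j : ℤ) : weierstrassH j = weierstrassH 0 := by
  unfold weierstrassH
  refine tsum_congr fun n => ?_
  have h := Real.cos_int_mul_two_pi (2^n * j)
  push_cast at h
  rw [show (2 : ℝ)^(n+1) * Real.pi * j = 2^n * j * (2 * Real.pi) by ring, h]
  simp

/-- The central fourth difference of `f` at `x` with step `d`. -/
def fourthDiff (f : ℝ → ℝ) (x d : ℝ) : ℝ :=
  f (x + 2 * d) - 4 * f (x + d) + 6 * f x - 4 * f (x - d) + f (x - 2 * d)

theorem fourthDiff_cos (a b : ℝ) :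
    fourthDiff Real.cos a b = Real.cos a * (2 - 2 * Real.cos b)^2 := by
  simp only [fourthDiff, Real.cos_add, Real.cos_sub, Real.cos_two_mul]
  ring

theorem fourthDiff_weierstrassH_half (x d : ℝ) :
    fourthDiff weierstrassH (x / 2) (d / 2) =
      (Real.cos (Real.pi * x) * (2 - 2 * Real.cos (Real.pi * d))^2
        + fourthDiff weierstrassH x d) / 2 := by
  rw [← fourthDiff_cos]
  simp only [fourthDiff]
  rw [show x / 2 + 2 * (d / 2) = (x + 2 * d) / 2 by ring, ← add_div, ← sub_div,
    show x / 2 - 2 * (d / 2) = (x - 2 * d) / 2 by ring]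
  simp only [weierstrassH_half]
  ring_nf

theorem two_sub_two_mul_cos_sq_le (a : ℝ) : (2 - 2 * Real.cos a)^2 ≤ a^4 := by
  have h1 := Real.one_sub_sq_div_two_le_cos (x := a)
  have h2 := Real.cos_le_one a
  calc (2 - 2 * Real.cos a)^2 ≤ (a^2)^2 := by gcongr <;> linarith
    _ = a^4 := by ring

theorem fourthDiff_weierstrassH_intCast (j : ℤ) : fourthDiff weierstrassH j 1 = 0 := by
  have h1 := weierstrassH_intCast (j + 2)
  have h2 := weierstrassH_intCast (j + 1)
  have h3 := weierstrassH_intCast (j - 1)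
  have h4 := weierstrassH_intCast (j - 2)
  push_cast at h1 h2 h3 h4
  simp only [fourthDiff, mul_one, h1, h2, h3, h4, weierstrassH_intCast]
  ring

theorem le_abs_fourthDiff_weierstrassH (j : ℤ) (k : ℕ) :
    6 + 2 / 8^k ≤
      2^(k+2) * |fourthDiff weierstrassH (j / 2^(k+2)) (1 / 2^(k+2))| := by
  induction k with
  | zero =>
    have h1 : fourthDiff weierstrassH (j / 2) (1 / 2) = 8 * Real.cos (Real.pi * j) := by
      rw [fourthDiff_weierstrassH_half, fourthDiff_weierstrassH_intCast, mul_one, Real.cos_pi]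
      ring
    have h2 : fourthDiff weierstrassH (j / 2 / 2) (1 / 2 / 2) =
        2 * Real.cos (Real.pi * (j / 2)) + 4 * Real.cos (Real.pi * j) := by
      rw [fourthDiff_weierstrassH_half, h1, mul_one_div, Real.cos_pi_div_two]
      ring
    have h3 : |Real.cos (Real.pi * j)| = 1 := by
      rw [mul_comm, Real.abs_cos_int_mul_pi]
    have h4 := Real.abs_cos_le_one (Real.pi * (j / 2))
    rw [show (j : ℝ) / 2^(0+2) = j / 2 / 2 by ring,
      show (1 : ℝ) / 2^(0+2) = 1 / 2 / 2 by ring, h2]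
    have h5 := abs_sub_abs_le_abs_sub (4 * Real.cos (Real.pi * j))
      (-(2 * Real.cos (Real.pi * (j / 2))))
    rw [abs_neg, abs_mul, abs_mul, h3, sub_neg_eq_add, add_comm (4 * _)] at h5
    norm_num at h5 ⊢
    linarith
  | succ k ih =>
    set x : ℝ := j / 2^(k+2) with hx
    set d : ℝ := 1 / 2^(k+2) with hd
    rw [show (j : ℝ) / 2^(k+1+2) = x / 2 by rw [hx]; ring,
      show (1 : ℝ) / 2^(k+1+2) = d / 2 by rw [hd]; ring, fourthDiff_weierstrassH_half]
    set e := Real.cos (Real.pi * x) * (2 - 2 * Real.cos (Real.pi * d))^2 with he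
    set g := fourthDiff weierstrassH x d
    have hpi : Real.pi^4 ≤ 100 := by
      have h1 : Real.pi^2 ≤ 10 := by nlinarith [Real.pi_lt_d2, Real.pi_pos]
      nlinarith [sq_nonneg Real.pi]
    have hbound : |e| ≤ 100 * d^4 := by
      rw [he, abs_mul, abs_of_nonneg (sq_nonneg (2 - 2 * Real.cos (Real.pi * d)))]
      calc _ ≤ 1 * (Real.pi * d)^4 := by
            gcongr
            · exact Real.abs_cos_le_one _
            · exact two_sub_two_mul_cos_sq_le _
        _ = Real.pi^4 * d^4 := by ring
        _ ≤ 100 * d^4 := by gcongr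
    have hscale : (2 : ℝ)^(k+2) * (100 * d^4) = 100 / 64 / 8^k := by
      rw [hd, show (8 : ℝ) = 2^3 by norm_num, ← pow_mul]
      field_simp
      ring
    have htri : |g| - |e| ≤ |e + g| := by
      simpa [add_comm] using abs_sub_abs_le_abs_sub g (-e)
    have hmul : (2 : ℝ)^(k+2) * (|g| - 100 * d^4) ≤ 2^(k+2) * |e + g| := by
      gcongr
      linarith
    have hpos : (0 : ℝ) < 1 / 8^k := by positivity
    rw [abs_div, abs_two, show (2 : ℝ)^(k+1+2) * (|e + g| / 2) = 2^(k+2) * |e + g| by ring,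
      show (2 : ℝ) / 8^(k+1) = 1 / 4 * (1 / 8^k) by rw [pow_succ]; field_simp; norm_num]
    rw [mul_sub, hscale] at hmul
    rw [show (2 : ℝ) / 8^k = 2 * (1 / 8^k) by ring] at ih
    rw [show (100 : ℝ) / 64 / 8^k = 100 / 64 * (1 / 8^k) by ring] at hmul
    linarith

/-- Near a point of differentiability, fourth differences are small compared with the step. -/
theorem HasDerivAt.exists_abs_fourthDiff_le {f : ℝ → ℝ} {f' θ : ℝ} (hf : HasDerivAt f f' θ) :
    ∃ δ > 0, ∀ x d, 0 ≤ d → d < δ → |x - θ| ≤ d → |fourthDiff f x d| ≤ 3 * d := by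
  have h := (hasDerivAt_iff_isLittleO.1 hf).bound (show (0 : ℝ) < 1 / 16 by norm_num)
  obtain ⟨δ, hδ, hball⟩ := Metric.eventually_nhds_iff.1 h
  refine ⟨δ / 3, by positivity, fun x d hd0 hd hx => ?_⟩
  have key : ∀ y, |y - θ| ≤ 3 * d → |f y - f θ - (y - θ) * f'| ≤ 3 / 16 * d := fun y hy => by
    have := hball (y := y) (by rw [Real.dist_eq]; linarith)
    simp only [Real.norm_eq_abs, smul_eq_mul] at this
    linarith
  rw [abs_le] at hx
  have h1 := abs_le.1 (key (x + 2 * d) (abs_le.2 ⟨by linarith, by linarith⟩))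
  have h2 := abs_le.1 (key (x + d) (abs_le.2 ⟨by linarith, by linarith⟩))
  have h3 := abs_le.1 (key x (abs_le.2 ⟨by linarith, by linarith⟩))
  have h4 := abs_le.1 (key (x - d) (abs_le.2 ⟨by linarith, by linarith⟩))
  have h5 := abs_le.1 (key (x - 2 * d) (abs_le.2 ⟨by linarith, by linarith⟩))
  rw [fourthDiff, abs_le]
  constructor <;> linarith

theorem not_differentiableAt_weierstrassH (θ : ℝ) : ¬ DifferentiableAt ℝ weierstrassH θ := by
  intro hdiff
  obtain ⟨δ, hδ, hsmall⟩ := hdiff.hasDerivAt.exists_abs_fourthDiff_le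
  obtain ⟨k, hk⟩ := exists_pow_lt_of_lt_one hδ (show (1/2 : ℝ) < 1 by norm_num)
  have hp : (0 : ℝ) < 2^(k+2) := by positivity
  have hlarge := le_abs_fourthDiff_weierstrassH ⌊θ * 2^(k+2)⌋ k
  have hd : (1 : ℝ) / 2^(k+2) < δ := by
    refine lt_of_le_of_lt ?_ hk
    rw [one_div_pow]
    gcongr
    · norm_num
    · omega
  have hx : |(⌊θ * 2^(k+2)⌋ : ℝ) / 2^(k+2) - θ| ≤ 1 / 2^(k+2) := by
    rw [div_sub' hp.ne', abs_div, abs_of_pos hp]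
    gcongr
    rw [abs_le]
    constructor <;> linarith [Int.floor_le (θ * 2^(k+2)), Int.lt_floor_add_one (θ * 2^(k+2))]
  have hupper := mul_le_mul_of_nonneg_left (hsmall _ _ (by positivity) hd hx) hp.le
  rw [show (2 : ℝ)^(k+2) * (3 * (1 / 2^(k+2))) = 3 by field_simp] at hupper
  have hpos : (0 : ℝ) < 2 / 8^k := by positivity
  linarith

/-- `h` is continuous on `ℝ` but differentiable at no point. -/
theorem stmt4 : Continuous weierstrassH ∧ ∀ θ : ℝ, ¬ DifferentiableAt ℝ weierstrassH θ :=
  ⟨continuous_weierstrassH, not_differentiableAt_weierstrassH⟩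
end

section
/- Let d, ν ≥ 1 and let H : [0,1]^d → Matrix (Fin ν) (Fin ν) ℂ be measurable with essentially bounded entries and with H(θ) Hermitian for almost every θ. Let M_H be the bounded multiplication operator on L²([0,1]^d; ℂ^ν) given by (M_H f)(θ) = H(θ) f(θ). Then a real number λ is an eigenvalue of M_H if and only if the set {θ ∈ [0,1]^d : det(H(θ) − λ·I) = 0} has positive Lebesgue measure; and in that case the eigenspace ker(M_H − λ) is infinite-dimensional. -/
open MeasureTheory

/-- Lebesgue measure restricted to the unit box `[0,1]^d`. -/
noncomputable def boxMeasure (d : ℕ) : Measure (Fin d → ℝ) :=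
  volume.restrict (Set.Icc 0 1)

theorem Measurable.continuous_comp_matrix {n Ω E : Type*} [Fintype n] [MeasurableSpace Ω]
    [TopologicalSpace E] [MeasurableSpace E] [BorelSpace E] {A : Ω → Matrix n n ℂ}
    (hA : ∀ i j, Measurable fun ω => A ω i j) {g : Matrix n n ℂ → E} (hg : Continuous g) :
    Measurable fun ω => g (A ω) := by
  have hg' : Continuous fun B : n → n → ℂ => g (Matrix.of B) := hg
  exact hg'.measurable.comp (measurable_pi_iff.mpr fun i => measurable_pi_iff.mpr fun j => hA i j)

section KernelSelection

open Polynomial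

variable {n : Type*} [Fintype n] [DecidableEq n]

theorem aeval_iterate_divX_charpoly (A : Matrix n n ℂ) (m : ℕ) :
    aeval A (divX^[m] A.charpoly) =
      ∑ i ∈ Finset.range (Fintype.card n + 1), A.charpoly.coeff (i + m) • A ^ i := by
  have hcoeff : ∀ (m i : ℕ) (p : ℂ[X]), (divX^[m] p).coeff i = p.coeff (i + m) := by
    intro m
    induction m with
    | zero => simp
    | succ m ih =>
      intro i p
      rw [Function.iterate_succ_apply, ih, coeff_divX, add_assoc]
  rw [aeval_eq_sum_range' (n := Fintype.card n + 1)]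
  · simp only [hcoeff]
  · rw [Nat.lt_succ_iff, natDegree_le_iff_coeff_eq_zero]
    intro N hN
    rw [hcoeff]
    apply coeff_eq_zero_of_natDegree_lt
    rw [Matrix.charpoly_natDegree_eq_dim]
    omega

/-- A singular matrix annihilates some nonzero matrix among the values at it of the successive
truncations of its characteristic polynomial. -/
theorem exists_mul_aeval_iterate_divX_charpoly_eq_zero (A : Matrix n n ℂ) (hA : A.det = 0) :
    ∃ m : ℕ, aeval A (divX^[m] A.charpoly) ≠ 0 ∧ A * aeval A (divX^[m] A.charpoly) = 0 := by
  classical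
  have hne : Nonempty n := by
    by_contra h
    rw [not_nonempty_iff] at h
    simp at hA
  have hex : ∃ m : ℕ, aeval A (divX^[m] A.charpoly) ≠ 0 := by
    refine ⟨Fintype.card n, ?_⟩
    rw [aeval_iterate_divX_charpoly, Finset.sum_eq_single 0]
    · have h1 : A.charpoly.coeff (Fintype.card n) = 1 := by
        have := A.charpoly_monic
        rwa [Monic, leadingCoeff, Matrix.charpoly_natDegree_eq_dim] at this
      simp [h1]
    · intro i _ hi
      rw [coeff_eq_zero_of_natDegree_lt, zero_smul]
      rw [Matrix.charpoly_natDegree_eq_dim]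
      omega
    · simp
  obtain ⟨k, hk⟩ : ∃ k, Nat.find hex = k + 1 := by
    refine Nat.exists_eq_succ_of_ne_zero fun h => ?_
    have := Nat.find_spec hex
    rw [h] at this
    exact this (by simpa using Matrix.aeval_self_charpoly A)
  have hspec := Nat.find_spec hex
  rw [hk] at hspec
  refine ⟨k + 1, hspec, ?_⟩
  have hmin : aeval A (divX^[k] A.charpoly) = 0 := by
    by_contra h
    exact Nat.find_min hex (by omega) h
  have hrec := congrArg (aeval A) (X_mul_divX_add (divX^[k] A.charpoly))
  rw [map_add, map_mul, aeval_X, aeval_C, hmin, ← Function.iterate_succ_apply' divX] at hrec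
  obtain ⟨x, hx, hAx⟩ := Matrix.exists_mulVec_eq_zero_iff.mpr hA
  set c := (divX^[k] A.charpoly).coeff 0
  set W := aeval A (divX^[k + 1] A.charpoly)
  have hcomm : A * W = W * A := by
    have := congrArg (aeval A) (X_mul (p := divX^[k + 1] A.charpoly))
    simpa only [map_mul, aeval_X] using this
  have hc : c = 0 := by
    have h := congrArg (fun B : Matrix n n ℂ => B.mulVec x) hrec
    simp only [Matrix.add_mulVec, hcomm, ← Matrix.mulVec_mulVec, hAx, Matrix.mulVec_zero,
      Matrix.zero_mulVec, zero_add, Algebra.algebraMap_eq_smul_one, Matrix.smul_mulVec,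
      Matrix.one_mulVec] at h
    exact (smul_eq_zero.mp h).resolve_right hx
  simpa [hc] using hrec

theorem continuous_charpoly_coeff (i : ℕ) :
    Continuous fun A : Matrix n n ℂ => A.charpoly.coeff i := by
  have h : (fun A : Matrix n n ℂ => A.charpoly.coeff i) = fun A : Matrix n n ℂ =>
      MvPolynomial.eval (fun p : n × n => A p.1 p.2) ((Matrix.charpoly.univ ℂ n).coeff i) := by
    funext A
    exact (Matrix.charpoly.univ_coeff_eval₂Hom n (RingHom.id ℂ) (fun p => A p.1 p.2) i).symm
  rw [h]
  exact (MvPolynomial.continuous_eval _).comp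
    (continuous_pi fun p => continuous_id.matrix_elem p.1 p.2)

theorem continuous_aeval_iterate_divX_charpoly (m : ℕ) :
    Continuous fun A : Matrix n n ℂ => aeval A (divX^[m] A.charpoly) := by
  simp only [aeval_iterate_divX_charpoly]
  exact continuous_finsetSum _ fun i _ => (continuous_charpoly_coeff _).smul (continuous_pow i)

/-- A measurable field of matrices that is singular on a set of positive measure admits a bounded
measurable field of kernel vectors that is nonzero on a set of positive measure. -/
theorem exists_bounded_measurable_kernel_field {Ω : Type*} [MeasurableSpace Ω] {μ : Measure Ω}
    {A : Ω → Matrix n n ℂ} (hA : ∀ i j, Measurable fun ω => A ω i j)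
    (hpos : 0 < μ {ω | (A ω).det = 0}) :
    ∃ v : Ω → n → ℂ, Measurable v ∧ (∀ ω, ‖v ω‖ ≤ 1) ∧ (∀ ω, (A ω).mulVec (v ω) = 0) ∧
      0 < μ {ω | v ω ≠ 0} := by
  classical
  let w : ℕ × n → Ω → n → ℂ := fun p ω =>
    (aeval (A ω) (divX^[p.1] (A ω).charpoly)).col p.2
  have hw : ∀ p, Measurable (w p) := fun p => by
    refine Measurable.continuous_comp_matrix hA
      (g := fun B => (aeval B (divX^[p.1] B.charpoly)).col p.2) ?_
    exact continuous_pi fun i => (continuous_aeval_iterate_divX_charpoly p.1).matrix_elem i p.2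
  have hAw : ∀ p, Measurable fun ω => (A ω).mulVec (w p ω) := fun p => by
    refine Measurable.continuous_comp_matrix hA
      (g := fun B => B.mulVec ((aeval B (divX^[p.1] B.charpoly)).col p.2)) ?_
    exact continuous_id.matrix_mulVec
      (continuous_pi fun i => (continuous_aeval_iterate_divX_charpoly p.1).matrix_elem i p.2)
  have hcover : {ω | (A ω).det = 0} ⊆ ⋃ p, {ω | w p ω ≠ 0 ∧ (A ω).mulVec (w p ω) = 0} := by
    intro ω hω
    obtain ⟨m, hm, hm'⟩ := exists_mul_aeval_iterate_divX_charpoly_eq_zero (A ω) hω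
    obtain ⟨l, hl⟩ : ∃ l, w (m, l) ω ≠ 0 := by
      by_contra! h
      exact hm (Matrix.ext fun i l => congrFun (h l) i)
    refine Set.mem_iUnion.mpr ⟨(m, l), hl, ?_⟩
    funext i
    exact congrFun (congrFun hm' i) l
  obtain ⟨p, hp⟩ := exists_measure_pos_of_not_measure_iUnion_null
    (hpos.trans_le (measure_mono hcover)).ne'
  have hS : MeasurableSet {ω | (A ω).mulVec (w p ω) = 0} := hAw p (measurableSet_singleton 0)
  refine ⟨{ω | (A ω).mulVec (w p ω) = 0}.indicator
    fun ω => (((1 + ‖w p ω‖)⁻¹ : ℝ) : ℂ) • w p ω, ?_, ?_, ?_, ?_⟩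
  · have hc : Measurable fun ω => (((1 + ‖w p ω‖)⁻¹ : ℝ) : ℂ) :=
      Complex.measurable_ofReal.comp ((measurable_const.add (hw p).norm).inv)
    exact Measurable.indicator (hc.smul (hw p)) hS
  · intro ω
    refine (norm_indicator_le_norm_self _ _).trans ?_
    have h0 := norm_nonneg (w p ω)
    rw [norm_smul, Complex.norm_real, norm_inv, Real.norm_of_nonneg (by positivity),
      inv_mul_le_iff₀ (by positivity)]
    linarith
  · intro ω
    by_cases h : (A ω).mulVec (w p ω) = 0
    · rw [Set.indicator_of_mem (by exact h), Matrix.mulVec_smul, h, smul_zero]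
    · rw [Set.indicator_of_notMem (by exact h), Matrix.mulVec_zero]
  · refine hp.trans_le (measure_mono ?_)
    rintro ω ⟨h1, h2⟩
    have h0 : (1 + ‖w p ω‖)⁻¹ ≠ 0 := by positivity
    rw [Set.mem_ofPred_eq, Set.indicator_of_mem (by exact h2)]
    exact smul_ne_zero (Complex.ofReal_ne_zero.mpr h0) h1

end KernelSelection

instance isFiniteMeasure_boxMeasure (d : ℕ) : IsFiniteMeasure (boxMeasure d) :=
  ⟨by simpa [boxMeasure] using (isCompact_Icc (a := (0 : Fin d → ℝ)) (b := 1)).measure_lt_top⟩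

theorem boxMeasure_eval_coordinate_eq_zero {d : ℕ} (i : Fin d) {p : Polynomial ℂ} (hp : p ≠ 0) :
    boxMeasure d {θ | p.eval (θ i : ℂ) = 0} = 0 := by
  refine Measure.absolutelyContinuous_of_le Measure.restrict_le_self ?_
  have hsub : {θ : Fin d → ℝ | p.eval (θ i : ℂ) = 0} ⊆
      ⋃ z ∈ p.roots.toFinset, {θ : Fin d → ℝ | θ i = z.re} := by
    intro θ hθ
    simp only [Set.mem_iUnion]
    exact ⟨(θ i : ℂ), by simpa [hp] using hθ, by simp⟩
  refine measure_mono_null hsub ((measure_biUnion_null_iff (Finset.countable_toSet _)).mpr ?_)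
  intro z _
  rw [volume_pi]
  exact Measure.pi_hyperplane (α := fun _ => ℝ) (fun _ => volume) i z.re

theorem memLp_eval_smul {d : ℕ} {E : Type*} [NormedAddCommGroup E] [NormedSpace ℂ E]
    [MeasurableSpace E] [BorelSpace E] [SecondCountableTopology E] (i : Fin d)
    {v : (Fin d → ℝ) → E} (hv : Measurable v) (hv1 : ∀ θ, ‖v θ‖ ≤ 1) (p : Polynomial ℂ) :
    MemLp (fun θ => p.eval (θ i : ℂ) • v θ) 2 (boxMeasure d) := by
  have hcont : Continuous fun θ : Fin d → ℝ => p.eval (θ i : ℂ) :=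
    p.continuous.comp (Complex.continuous_ofReal.comp (continuous_apply i))
  obtain ⟨C, hC⟩ := (isCompact_Icc (a := (0 : Fin d → ℝ)) (b := 1)).exists_bound_of_continuousOn
    hcont.continuousOn
  refine MemLp.of_bound (hcont.measurable.smul hv).aestronglyMeasurable C ?_
  filter_upwards [ae_restrict_mem measurableSet_Icc] with θ hθ
  rw [norm_smul]
  calc _ ≤ ‖p.eval (θ i : ℂ)‖ * 1 := by gcongr; exact hv1 θ
    _ ≤ C := by simpa using hC θ hθ

/-- Multiples of a fixed bounded field by polynomials in one coordinate, as elements of `L²`. -/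
noncomputable def polynomialMultiples {d : ℕ} {E : Type*} [NormedAddCommGroup E] [NormedSpace ℂ E]
    [MeasurableSpace E] [BorelSpace E] [SecondCountableTopology E] (i : Fin d)
    {v : (Fin d → ℝ) → E} (hv : Measurable v) (hv1 : ∀ θ, ‖v θ‖ ≤ 1) :
    Polynomial ℂ →ₗ[ℂ] Lp E 2 (boxMeasure d) where
  toFun p := (memLp_eval_smul i hv hv1 p).toLp _
  map_add' p q := by
    rw [← MemLp.toLp_add]
    exact MemLp.toLp_congr _ _ (.of_forall fun θ => by simp [add_smul])
  map_smul' c p := by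
    rw [RingHom.id_apply, ← MemLp.toLp_const_smul]
    exact MemLp.toLp_congr _ _ (.of_forall fun θ => by simp [mul_smul])

theorem polynomialMultiples_injective {d : ℕ} {E : Type*} [NormedAddCommGroup E]
    [NormedSpace ℂ E] [MeasurableSpace E] [BorelSpace E] [SecondCountableTopology E] (i : Fin d)
    {v : (Fin d → ℝ) → E} (hv : Measurable v) (hv1 : ∀ θ, ‖v θ‖ ≤ 1)
    (hpos : 0 < boxMeasure d {θ | v θ ≠ 0}) :
    Function.Injective (polynomialMultiples i hv hv1) := by
  rw [injective_iff_map_eq_zero]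
  intro p hp
  by_contra hp0
  have h0 : (fun θ => p.eval (θ i : ℂ) • v θ) =ᵐ[boxMeasure d] 0 :=
    (MemLp.coeFn_toLp (memLp_eval_smul i hv hv1 p)).symm.trans
      ((Lp.ext_iff.mp hp).trans (Lp.coeFn_zero _ _ _))
  have h1 : ∀ᵐ θ ∂(boxMeasure d), p.eval (θ i : ℂ) ≠ 0 := by
    rw [ae_iff]
    simpa using boxMeasure_eval_coordinate_eq_zero i hp0
  have h2 : ∀ᵐ θ ∂(boxMeasure d), v θ = 0 := by
    filter_upwards [h0, h1] with θ hθ hθ'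
    exact (smul_eq_zero.mp hθ).resolve_left hθ'
  exact hpos.ne' (ae_iff.mp h2)

/-- A real `λ` is an eigenvalue of the multiplication operator `M_H` on `L²([0,1]^d; ℂ^ν)`
iff `{θ : det(H(θ) − λ) = 0}` has positive measure, and then the eigenspace is
infinite-dimensional. -/
theorem stmt6 (d ν : ℕ) (hd : 0 < d) (hν : 0 < ν)
    (H : (Fin d → ℝ) → Matrix (Fin ν) (Fin ν) ℂ)
    (hmeas : ∀ i j : Fin ν, Measurable fun θ => H θ i j)
    (hbdd : ∃ C : ℝ, ∀ i j : Fin ν, ∀ᵐ θ ∂(boxMeasure d), ‖H θ i j‖ ≤ C)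
    (hherm : ∀ᵐ θ ∂(boxMeasure d), (H θ).IsHermitian)
    (M : Lp (α := Fin d → ℝ) (Fin ν → ℂ) 2 (boxMeasure d) →L[ℂ]
         Lp (α := Fin d → ℝ) (Fin ν → ℂ) 2 (boxMeasure d))
    (hM : ∀ f : Lp (α := Fin d → ℝ) (Fin ν → ℂ) 2 (boxMeasure d),
      ∀ᵐ θ ∂(boxMeasure d), (M f : (Fin d → ℝ) → (Fin ν → ℂ)) θ = (H θ).mulVec (f θ)) :
    ∀ lam : ℝ,
      ((∃ f : Lp (α := Fin d → ℝ) (Fin ν → ℂ) 2 (boxMeasure d),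
          f ≠ 0 ∧ M f = (lam : ℂ) • f) ↔
        0 < boxMeasure d {θ | ((H θ) - (lam : ℂ) • (1 : Matrix (Fin ν) (Fin ν) ℂ)).det = 0}) ∧
      (0 < boxMeasure d {θ | ((H θ) - (lam : ℂ) • (1 : Matrix (Fin ν) (Fin ν) ℂ)).det = 0} →
        ¬ FiniteDimensional ℂ
          (LinearMap.ker
            ((M : Lp (α := Fin d → ℝ) (Fin ν → ℂ) 2 (boxMeasure d) →ₗ[ℂ]
                  Lp (α := Fin d → ℝ) (Fin ν → ℂ) 2 (boxMeasure d))
              - (lam : ℂ) • LinearMap.id))) := by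
  intro lam
  have hsub : ∀ θ (x : Fin ν → ℂ),
      (H θ - (lam : ℂ) • (1 : Matrix (Fin ν) (Fin ν) ℂ)).mulVec x =
        (H θ).mulVec x - (lam : ℂ) • x := fun θ x => by
    rw [Matrix.sub_mulVec, Matrix.smul_mulVec, Matrix.one_mulVec]
  have hker : 0 < boxMeasure d
      {θ | ((H θ) - (lam : ℂ) • (1 : Matrix (Fin ν) (Fin ν) ℂ)).det = 0} →
      ∃ T : Polynomial ℂ →ₗ[ℂ] Lp (α := Fin d → ℝ) (Fin ν → ℂ) 2 (boxMeasure d),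
        Function.Injective T ∧ ∀ p, M (T p) = (lam : ℂ) • T p := by
    intro hpos
    obtain ⟨v, hv, hv1, hAv, hvpos⟩ := exists_bounded_measurable_kernel_field
      (A := fun θ => H θ - (lam : ℂ) • (1 : Matrix (Fin ν) (Fin ν) ℂ))
      (fun i j => (hmeas i j).sub measurable_const) hpos
    refine ⟨polynomialMultiples ⟨0, hd⟩ hv hv1,
      polynomialMultiples_injective ⟨0, hd⟩ hv hv1 hvpos, fun p => Lp.ext ?_⟩
    filter_upwards [hM (polynomialMultiples ⟨0, hd⟩ hv hv1 p),
      Lp.coeFn_smul (lam : ℂ) (polynomialMultiples ⟨0, hd⟩ hv hv1 p),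
      MemLp.coeFn_toLp (memLp_eval_smul ⟨0, hd⟩ hv hv1 p)] with θ h1 h2 h3
    have h4 : polynomialMultiples ⟨0, hd⟩ hv hv1 p θ = p.eval (θ ⟨0, hd⟩ : ℂ) • v θ := h3
    rw [h1, h2, Pi.smul_apply, ← sub_eq_zero, ← hsub, h4, Matrix.mulVec_smul, hAv, smul_zero]
  refine ⟨⟨?_, fun hpos => ?_⟩, fun hpos hfin => ?_⟩
  · rintro ⟨f, hf, hMf⟩
    by_contra hzero
    have hdet : ∀ᵐ θ ∂(boxMeasure d),
        (H θ - (lam : ℂ) • (1 : Matrix (Fin ν) (Fin ν) ℂ)).det ≠ 0 := by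
      rw [ae_iff]
      simpa using hzero
    have hMf' := hM f
    rw [hMf] at hMf'
    refine hf (Lp.ext ?_)
    filter_upwards [hdet, hMf', Lp.coeFn_smul (lam : ℂ) f,
      Lp.coeFn_zero (Fin ν → ℂ) 2 (boxMeasure d)] with θ h1 h2 h3 h4
    rw [h4]
    by_contra hfθ
    refine h1 (Matrix.exists_mulVec_eq_zero_iff.mp ⟨f θ, hfθ, ?_⟩)
    rw [hsub, ← h2, h3, Pi.smul_apply, sub_self]
  · obtain ⟨T, hT, hMT⟩ := hker hpos
    exact ⟨T 1, (map_ne_zero_iff T hT).mpr one_ne_zero, hMT 1⟩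
  · obtain ⟨T, hT, hMT⟩ := hker hpos
    have hmem : ∀ p, T p ∈ LinearMap.ker
        ((M : Lp (α := Fin d → ℝ) (Fin ν → ℂ) 2 (boxMeasure d) →ₗ[ℂ]
              Lp (α := Fin d → ℝ) (Fin ν → ℂ) 2 (boxMeasure d))
          - (lam : ℂ) • LinearMap.id) := fun p =>
      LinearMap.mem_ker.mpr (sub_eq_zero.mpr (hMT p))
    exact Polynomial.not_finite (R := ℂ) (Module.Finite.of_injective (T.codRestrict _ hmem)
      fun p q hpq => hT (congrArg Subtype.val hpq))
end

section
/- Define w : ℤ → ℝ by w(0) = 1/16, w(k) = 1/(2π²k²) for odd k, and w(k) = (1 − (−1)^{k/2})/(2π²k²) for even k ≠ 0 (these are the Fourier coefficients of the tent-gap function c). Let H be the bounded self-adjoint operator on ℓ²(ℤ, ℂ) given by (Hψ)(n) = ∑_{k∈ℤ} w(k) ψ(n+k) (the sum converges absolutely since w is summable). Then: (i) the spectrum of H equals [0, 1/4]; (ii) 0 is an eigenvalue of H whose eigenspace is infinite-dimensional; (iii) there is no eigenvector of finite support for the eigenvalue 0, i.e. every ψ ∈ ℓ²(ℤ) with finite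 support and Hψ = 0 is identically zero. -/
/-- The Fourier coefficients of the tent-gap function `c`:
`w(0) = 1/16`, `w(k) = 1/(2π²k²)` for odd `k`, and
`w(k) = (1 − (−1)^{k/2})/(2π²k²)` for even `k ≠ 0`. -/
noncomputable def w7 (k : ℤ) : ℝ :=
  if k = 0 then 1/16
  else if k % 2 = 0 then (1 - (-1:ℝ)^(k/2))/(2*Real.pi^2*(k:ℝ)^2)
  else 1/(2*Real.pi^2*(k:ℝ)^2)

section

open MeasureTheory Set
open scoped ENNReal

section Multiplication

variable {X : Type*} [TopologicalSpace X] [MeasurableSpace X] [BorelSpace X]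
  (μ : Measure X) [IsFiniteMeasure μ]

lemma indicatorConstLp_ne_zero_of_isOpen [μ.IsOpenPosMeasure] {U : Set X} (hU : IsOpen U)
    (hne : U.Nonempty) :
    indicatorConstLp 2 hU.measurableSet (measure_ne_top μ U) (1 : ℂ) ≠ 0 := by
  rw [← norm_ne_zero_iff, norm_indicatorConstLp (by norm_num) (by norm_num)]
  have : 0 < μ.real U :=
    ENNReal.toReal_pos (hU.measure_pos μ hne).ne' (measure_ne_top μ U)
  simp only [norm_one, one_mul]
  positivity

variable [CompactSpace X]

/-- Multiplication by a continuous function, as a bounded operator on `L²`. -/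
noncomputable def mulL2 (g : C(X, ℂ)) : Lp ℂ 2 μ →L[ℂ] Lp ℂ 2 μ :=
  (ContinuousLinearMap.mul ℂ ℂ).holderL μ ∞ 2 2 (ContinuousMap.toLp ∞ μ ℂ g)

lemma coeFn_mulL2 (g : C(X, ℂ)) (f : Lp ℂ 2 μ) : mulL2 μ g f =ᵐ[μ] fun x => g x * f x := by
  refine ((ContinuousLinearMap.mul ℂ ℂ).coeFn_holder (r := 2)
    (ContinuousMap.toLp ∞ μ ℂ g) f).trans ?_
  filter_upwards [ContinuousMap.coeFn_toLp (p := ∞) (𝕜 := ℂ) μ g] with x hx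
  rw [ContinuousLinearMap.mul_apply', hx]

/-- Multiplication operators, as a homomorphism from the algebra of continuous functions. -/
noncomputable def mulL2Hom : C(X, ℂ) →ₐ[ℂ] (Lp ℂ 2 μ →L[ℂ] Lp ℂ 2 μ) :=
  AlgHom.ofLinearMap
    (((ContinuousLinearMap.mul ℂ ℂ).holderL μ ∞ 2 2 ∘L ContinuousMap.toLp ∞ μ ℂ).toLinearMap)
    (by
      ext1 f
      apply Lp.ext
      change mulL2 μ 1 f =ᵐ[μ] f
      filter_upwards [coeFn_mulL2 μ 1 f] with x hx
      rw [hx, ContinuousMap.one_apply, one_mul])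
    (fun g h => by
      ext1 f
      apply Lp.ext
      change mulL2 μ (g * h) f =ᵐ[μ] mulL2 μ g (mulL2 μ h f)
      filter_upwards [coeFn_mulL2 μ (g * h) f, coeFn_mulL2 μ g (mulL2 μ h f),
        coeFn_mulL2 μ h f] with x h1 h2 h3
      rw [h1, h2, h3, ContinuousMap.mul_apply, mul_assoc])

lemma mulL2Hom_apply (g : C(X, ℂ)) : mulL2Hom μ g = mulL2 μ g := rfl

lemma mulL2_toLp (g f : C(X, ℂ)) :
    mulL2 μ g (ContinuousMap.toLp 2 μ ℂ f) = ContinuousMap.toLp 2 μ ℂ (g * f) := by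
  apply Lp.ext
  filter_upwards [coeFn_mulL2 μ g (ContinuousMap.toLp 2 μ ℂ f),
    ContinuousMap.coeFn_toLp (p := 2) (𝕜 := ℂ) μ f,
    ContinuousMap.coeFn_toLp (p := 2) (𝕜 := ℂ) μ (g * f)] with x h1 h2 h3
  rw [h1, h2, h3, ContinuousMap.mul_apply]

lemma norm_mulL2_indicatorConstLp_le (h : C(X, ℂ)) {U : Set X} (hU : MeasurableSet U) {ε : ℝ}
    (hε : ∀ x ∈ U, ‖h x‖ ≤ ε) :
    ‖mulL2 μ h (indicatorConstLp 2 hU (measure_ne_top μ U) (1 : ℂ))‖ ≤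
      ε * ‖indicatorConstLp 2 hU (measure_ne_top μ U) (1 : ℂ)‖ := by
  apply Lp.norm_le_mul_norm_of_ae_le_mul
  filter_upwards [coeFn_mulL2 μ h (indicatorConstLp 2 hU (measure_ne_top μ U) (1 : ℂ)),
    indicatorConstLp_coeFn (p := 2) (hs := hU) (hμs := measure_ne_top μ U) (c := (1 : ℂ))]
    with x h1 h2
  rw [h1, h2, norm_mul]
  by_cases hx : x ∈ U
  · simpa [hx] using hε x hx
  · simp [hx]

/-- The spectrum of a multiplication operator is the range of the multiplier. -/
theorem spectrum_mulL2 [T2Space X] [μ.IsOpenPosMeasure] (g : C(X, ℂ)) :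
    spectrum ℂ (mulL2 μ g) = range g := by
  apply Subset.antisymm
  · rw [← mulL2Hom_apply, ← ContinuousMap.spectrum_eq_range]
    exact AlgHom.spectrum_apply_subset _ _
  · rintro _ ⟨x₀, rfl⟩ hunit
    set h : C(X, ℂ) := algebraMap ℂ C(X, ℂ) (g x₀) - g with hh
    have hT : algebraMap ℂ (Lp ℂ 2 μ →L[ℂ] Lp ℂ 2 μ) (g x₀) - mulL2 μ g = mulL2 μ h := by
      rw [← mulL2Hom_apply, ← mulL2Hom_apply, hh, map_sub, AlgHom.commutes]
    have hunit' : IsUnit (mulL2 μ h) := hT ▸ hunit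
    obtain ⟨S, hS⟩ := hunit'.exists_left_inv
    set ε : ℝ := (‖S‖ + 1)⁻¹ with hε
    have hεpos : 0 < ε := by positivity
    have hU : IsOpen {x | ‖h x‖ < ε} := isOpen_lt (by fun_prop) continuous_const
    set f := indicatorConstLp 2 hU.measurableSet (measure_ne_top μ _) (1 : ℂ) with hf
    have hf0 : 0 < ‖f‖ := norm_pos_iff.2 <|
      indicatorConstLp_ne_zero_of_isOpen μ hU ⟨x₀, by simpa [hh] using hεpos⟩
    have h1 : S (mulL2 μ h f) = f := by
      simpa using congrArg (fun A => A f) hS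
    have h2 : ‖mulL2 μ h f‖ ≤ ε * ‖f‖ :=
      norm_mulL2_indicatorConstLp_le μ h hU.measurableSet fun x hx => le_of_lt hx
    have h3 : ‖f‖ ≤ ‖S‖ * (ε * ‖f‖) := by
      calc ‖f‖ = ‖S (mulL2 μ h f)‖ := by rw [h1]
        _ ≤ ‖S‖ * ‖mulL2 μ h f‖ := S.le_opNorm _
        _ ≤ _ := by gcongr
    have h4 : ‖S‖ * ε < 1 := by
      rw [hε, ← div_eq_mul_inv, div_lt_one (by positivity)]
      linarith
    nlinarith

/-- A multiplier vanishing on infinitely many disjoint nonempty open sets has an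
infinite-dimensional kernel. -/
theorem not_finiteDimensional_ker_mulL2 [μ.IsOpenPosMeasure] (g : C(X, ℂ)) {U : ℕ → Set X}
    (hU : ∀ n, IsOpen (U n)) (hne : ∀ n, (U n).Nonempty) (hd : Pairwise (Function.onFun Disjoint U))
    (hg : ∀ n, ∀ x ∈ U n, g x = 0) :
    ¬ FiniteDimensional ℂ (mulL2 μ g).ker := by
  intro hfin
  let f : ℕ → Lp ℂ 2 μ := fun n =>
    indicatorConstLp 2 (hU n).measurableSet (measure_ne_top μ (U n)) (1 : ℂ)
  have hker : ∀ n, f n ∈ (mulL2 μ g).ker := fun n => by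
    have := norm_mulL2_indicatorConstLp_le μ g (hU n).measurableSet (ε := 0)
      fun x hx => by simp [hg n x hx]
    rw [zero_mul] at this
    exact norm_le_zero_iff.1 this
  have hli : LinearIndependent ℂ f := by
    refine linearIndependent_of_ne_zero_of_inner_eq_zero
      (fun n => indicatorConstLp_ne_zero_of_isOpen μ (hU n) (hne n)) fun m n hmn => ?_
    have : U m ∩ U n = ∅ := (hd hmn).inter_eq
    simp [f, L2.inner_indicatorConstLp_indicatorConstLp, this]
  have hli' : LinearIndependent ℂ (fun n => (⟨f n, hker n⟩ : (mulL2 μ g).ker)) :=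
    LinearIndependent.of_comp (mulL2 μ g).ker.subtype hli
  exact not_finite_iff_infinite.2 inferInstance hli'.finite

end Multiplication

section TentGap

lemma w7_eq_cos {k : ℤ} (hk : k ≠ 0) :
    w7 k = (1 - Real.cos (Real.pi * k / 2)) / (2 * Real.pi ^ 2 * (k : ℝ) ^ 2) := by
  rw [w7, if_neg hk]
  split_ifs with h
  · obtain ⟨j, rfl⟩ := Int.dvd_of_emod_eq_zero h
    rw [Int.mul_ediv_cancel_left _ two_ne_zero, ← Real.cos_int_mul_pi]
    push_cast
    ring_nf
  · obtain ⟨j, rfl⟩ : Odd k := Int.odd_iff.2 (by omega)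
    rw [Real.cos_eq_zero_iff.2 ⟨j, by push_cast; ring⟩, sub_zero]

lemma w7_neg (k : ℤ) : w7 (-k) = w7 k := by
  rcases eq_or_ne k 0 with rfl | hk
  · simp
  · rw [w7_eq_cos hk, w7_eq_cos (neg_ne_zero.2 hk), ← Real.cos_neg]
    push_cast
    ring_nf

/-- The tent-gap function on the circle. -/
noncomputable def tentGap : C(AddCircle (1 : ℝ), ℂ) :=
  ⟨fun x => ((max 0 (1 / 4 - ‖x‖) : ℝ) : ℂ), by fun_prop⟩

lemma tentGap_apply (x : AddCircle (1 : ℝ)) :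
    tentGap x = ((max 0 (1 / 4 - ‖x‖) : ℝ) : ℂ) := rfl

lemma norm_coe_unitAddCircle {x : ℝ} (hx : |x| ≤ 1 / 2) : ‖(x : AddCircle (1 : ℝ))‖ = |x| :=
  (AddCircle.norm_coe_eq_abs_iff _ one_ne_zero).2 (by simpa using hx)

lemma range_tentGap : range tentGap = (fun r : ℝ => (r : ℂ)) '' Icc 0 (1 / 4) := by
  ext z
  constructor
  · rintro ⟨x, rfl⟩
    refine ⟨_, ⟨le_max_left _ _, max_le (by norm_num) ?_⟩, rfl⟩
    linarith [norm_nonneg x]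
  · rintro ⟨r, ⟨h0, h1⟩, rfl⟩
    refine ⟨((1 / 4 - r : ℝ) : AddCircle (1 : ℝ)), ?_⟩
    have h : |1 / 4 - r| = 1 / 4 - r := abs_of_nonneg (by linarith)
    rw [tentGap_apply, norm_coe_unitAddCircle (by rw [h]; linarith), h]
    simp [h0]

lemma integral_affine_mul_exp {c : ℂ} (hc : c ≠ 0) (α β : ℂ) (a b : ℝ) :
    ∫ x in a..b, Complex.exp (c * x) * (α + β * x) =
      ((α + β * b) / c - β / c ^ 2) * Complex.exp (c * b) -
        ((α + β * a) / c - β / c ^ 2) * Complex.exp (c * a) := by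
  have key (x : ℝ) : HasDerivAt
      (fun y : ℝ => ((α + β * y) / c - β / c ^ 2) * Complex.exp (c * y))
      (Complex.exp (c * x) * (α + β * x)) x := by
    have h1 : HasDerivAt (fun y : ℝ => (y : ℂ)) 1 x := Complex.ofRealCLM.hasDerivAt
    convert! ((((h1.const_mul β).const_add α).div_const c).sub_const (β / c ^ 2)).mul
      (h1.const_mul c).cexp using 1
    field_simp
    ring
  exact intervalIntegral.integral_eq_sub_of_hasDerivAt (fun x _ => key x)
    (Continuous.intervalIntegrable (by fun_prop) _ _)

lemma integral_affine (α β : ℂ) (a b : ℝ) :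
    ∫ x in a..b, (α + β * x) = α * b + β * b ^ 2 / 2 - (α * a + β * a ^ 2 / 2) := by
  have key (x : ℝ) : HasDerivAt (fun y : ℝ => α * y + β * (y : ℂ) ^ 2 / 2) (α + β * x) x := by
    have h1 : HasDerivAt (fun y : ℝ => (y : ℂ)) 1 x := Complex.ofRealCLM.hasDerivAt
    convert! (h1.const_mul α).add (((h1.pow 2).const_mul β).div_const 2) using 1
    push_cast
    ring
  exact intervalIntegral.integral_eq_sub_of_hasDerivAt (fun x _ => key x)
    (Continuous.intervalIntegrable (by fun_prop) _ _)

lemma fourierCoeff_tentGap_eq_integral (k : ℤ) :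
    fourierCoeff tentGap k =
      (∫ x in (-(1 / 4) : ℝ)..0,
        Complex.exp (-(2 * Real.pi * Complex.I * k) * x) * (1 / 4 + 1 * x)) +
      ∫ x in (0 : ℝ)..(1 / 4),
        Complex.exp (-(2 * Real.pi * Complex.I * k) * x) * (1 / 4 + (-1) * x) := by
  rw [fourierCoeff_eq_intervalIntegral _ _ (-(1 / 2)), one_div_one, one_smul]
  set F : ℝ → ℂ := fun x => fourier (-k) (x : AddCircle (1 : ℝ)) • tentGap x with hF
  have hcont : Continuous F := by
    have hq : Continuous (fun x : ℝ => (x : AddCircle (1 : ℝ))) := AddCircle.continuous_mk' _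
    exact ((fourier (-k)).continuous.comp hq).smul (tentGap.continuous.comp hq)
  have hint (a b : ℝ) : IntervalIntegrable F volume a b := hcont.intervalIntegrable a b
  have hval {x : ℝ} (hx : |x| ≤ 1 / 2) :
      F x = Complex.exp (-(2 * Real.pi * Complex.I * k) * x) * ((max 0 (1 / 4 - |x|) : ℝ) : ℂ) := by
    simp only [hF]
    rw [tentGap_apply, norm_coe_unitAddCircle hx, fourier_coe_apply, smul_eq_mul]
    congr 2
    push_cast
    ring
  have hzero {x : ℝ} (hx : |x| ≤ 1 / 2) (hx' : 1 / 4 ≤ |x|) : F x = 0 := by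
    rw [hval hx, max_eq_left (by linarith)]
    simp
  rw [← intervalIntegral.integral_add_adjacent_intervals (hint _ (-(1 / 4))) (hint _ _),
    ← intervalIntegral.integral_add_adjacent_intervals (hint (-(1 / 4)) 0) (hint _ _),
    ← intervalIntegral.integral_add_adjacent_intervals (hint 0 (1 / 4)) (hint _ _)]
  have h1 : ∫ x in (-(1 / 2) : ℝ)..(-(1 / 4)), F x = 0 := by
    rw [intervalIntegral.integral_congr (g := fun _ => (0 : ℂ)), intervalIntegral.integral_zero]
    intro x hx
    rw [uIcc_of_le (by norm_num)] at hx
    have : |x| = -x := abs_of_nonpos (by linarith [hx.2])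
    exact hzero (by linarith [hx.1]) (by linarith [hx.2])
  have h4 : ∫ x in (1 / 4 : ℝ)..(-(1 / 2) + 1), F x = 0 := by
    rw [intervalIntegral.integral_congr (g := fun _ => (0 : ℂ)), intervalIntegral.integral_zero]
    intro x hx
    rw [uIcc_of_le (by norm_num)] at hx
    have : |x| = x := abs_of_nonneg (by linarith [hx.1])
    exact hzero (by linarith [hx.2]) (by linarith [hx.1])
  rw [h1, h4, zero_add, add_zero]
  congr 1
  · refine intervalIntegral.integral_congr fun x hx => ?_
    rw [uIcc_of_le (by norm_num)] at hx
    have : |x| = -x := abs_of_nonpos hx.2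
    rw [hval (by linarith [hx.1]), this, max_eq_right (by linarith [hx.1])]
    push_cast
    ring
  · refine intervalIntegral.integral_congr fun x hx => ?_
    rw [uIcc_of_le (by norm_num)] at hx
    have : |x| = x := abs_of_nonneg hx.1
    rw [hval (by linarith [hx.2]), this, max_eq_right (by linarith [hx.2])]
    push_cast
    ring

/-- The Fourier coefficients of the tent-gap function. -/
theorem fourierCoeff_tentGap (k : ℤ) : fourierCoeff tentGap k = w7 k := by
  rw [fourierCoeff_tentGap_eq_integral]
  rcases eq_or_ne k 0 with rfl | hk
  · simp only [Int.cast_zero, mul_zero, neg_zero, zero_mul, Complex.exp_zero, one_mul]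
    have h1 := integral_affine (1 / 4) 1 (-(1 / 4)) 0
    have h2 := integral_affine (1 / 4) (-1) 0 (1 / 4)
    simp only [one_mul] at h1
    rw [h1, h2, w7, if_pos rfl]
    push_cast
    norm_num
  · have hpi : (Real.pi : ℂ) ≠ 0 := Complex.ofReal_ne_zero.2 Real.pi_ne_zero
    have hk' : (k : ℂ) ≠ 0 := Int.cast_ne_zero.2 hk
    have hc : -(2 * Real.pi * Complex.I * k : ℂ) ≠ 0 := by simp [hpi, hk']
    rw [integral_affine_mul_exp hc, integral_affine_mul_exp hc, w7_eq_cos hk]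
    have e1 : -(2 * Real.pi * Complex.I * k : ℂ) * ((-(1 / 4) : ℝ) : ℂ) =
        Real.pi * k / 2 * Complex.I := by push_cast; ring
    have e2 : -(2 * Real.pi * Complex.I * k : ℂ) * ((1 / 4 : ℝ) : ℂ) =
        -(Real.pi * k / 2) * Complex.I := by push_cast; ring
    rw [e1, e2]
    push_cast
    simp only [mul_zero, Complex.exp_zero]
    have hcos : Complex.cos (Real.pi * k / 2 : ℂ) =
        (Complex.exp (Real.pi * k / 2 * Complex.I) +
          Complex.exp (-(Real.pi * k / 2) * Complex.I)) / 2 := rfl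
    rw [hcos]
    have hI : (-(2 * Real.pi * Complex.I * k : ℂ)) ^ 2 = -(4 * Real.pi ^ 2 * k ^ 2) := by
      ring_nf
      simp
    rw [hI]
    field_simp
    ring

open AddCircle in
/-- Conjugation by the Fourier transform turns multiplication by the tent-gap function into
convolution with `w7`. -/
theorem eq_conj_mulL2_tentGap (H : lp (fun _ : ℤ => ℂ) 2 →L[ℂ] lp (fun _ : ℤ => ℂ) 2)
    (hH : ∀ ψ : lp (fun _ : ℤ => ℂ) 2, ∀ n : ℤ,
      (H ψ : ∀ _ : ℤ, ℂ) n = ∑' k : ℤ, (w7 k : ℂ) * (ψ : ∀ _ : ℤ, ℂ) (n + k)) :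
    H = (fourierBasis (T := 1)).repr.toContinuousLinearEquiv.conjContinuousAlgEquiv
      (mulL2 haarAddCircle tentGap) := by
  set b := fourierBasis (T := 1) with hb
  suffices h : H ∘L (b.repr.toContinuousLinearEquiv : _ →L[ℂ] _) =
      (b.repr.toContinuousLinearEquiv : _ →L[ℂ] _) ∘L mulL2 haarAddCircle tentGap by
    ext1 ψ
    have := congrArg (fun A => A (b.repr.symm ψ)) h
    simpa using this
  refine ContinuousLinearMap.ext_on
    (Submodule.dense_iff_topologicalClosure_eq_top.2 b.dense_span) ?_
  rintro _ ⟨m, rfl⟩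
  apply lp.ext
  funext n
  change (H (b.repr (b m)) : ∀ _ : ℤ, ℂ) n = b.repr (mulL2 haarAddCircle tentGap (b m)) n
  have hbm : b m = ContinuousMap.toLp 2 haarAddCircle ℂ (fourier m) := by
    rw [hb, coe_fourierBasis]
  rw [b.repr_self, hH, hbm, mulL2_toLp, fourierBasis_repr, fourierCoeff_toLp,
    tsum_eq_single (m - n)]
  · rw [add_sub_cancel, lp.single_apply_self, mul_one, ← w7_neg, neg_sub, ← fourierCoeff_tentGap]
    refine integral_congr_ae (.of_forall fun x => ?_)
    simp only [smul_eq_mul, ContinuousMap.mul_apply]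
    rw [neg_sub, sub_eq_add_neg, fourier_add]
    ring
  · intro k hk
    rw [lp.single_apply_ne _ _ _ (by omega), mul_zero]

/-- The kernel of multiplication by the tent-gap function is infinite-dimensional. -/
theorem not_finiteDimensional_ker_mulL2_tentGap :
    ¬ FiniteDimensional ℂ (mulL2 AddCircle.haarAddCircle tentGap).ker := by
  let a : ℕ → ℝ := fun n => 1 / 2 - 1 / (n + 4)
  have ha : StrictMono a := strictMono_nat_of_lt_succ fun n => by
    simp only [a]
    push_cast
    gcongr
    linarith
  have ha0 (n : ℕ) : 1 / 4 ≤ a n := by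
    have := ha.monotone n.zero_le
    norm_num [a] at this ⊢
    linarith
  have ha1 (n : ℕ) : a n ≤ 1 / 2 := sub_le_self _ (by positivity)
  refine not_finiteDimensional_ker_mulL2 _ tentGap
    (U := fun n => (fun x => ‖x‖) ⁻¹' Ioo (a n) (a (n + 1)))
    (fun n => isOpen_Ioo.preimage continuous_norm) (fun n => ?_)
    (fun m n hmn => (ha.monotone.pairwise_disjoint_on_Ioo_succ hmn).preimage _) ?_
  · have h := ha n.lt_succ_self
    have h0 := ha0 n
    have h1 := ha1 (n + 1)
    have habs : |(a n + a (n + 1)) / 2| = (a n + a (n + 1)) / 2 :=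
      abs_of_nonneg (by linarith)
    refine ⟨((a n + a (n + 1)) / 2 : ℝ), ?_⟩
    rw [mem_preimage, norm_coe_unitAddCircle (by linarith), habs]
    exact ⟨by linarith, by linarith⟩
  · rintro n x ⟨hx, -⟩
    rw [tentGap_apply, max_eq_left (by linarith [ha0 n]), Complex.ofReal_zero]

/-- A trigonometric polynomial vanishing near `0` vanishes identically. -/
lemma trigPoly_eq_zero (s : Finset ℤ) (v : ℤ → ℂ)
    (h : ∀ x : AddCircle (1 : ℝ), ‖x‖ < 1 / 4 → (∑ n ∈ s, v n • fourier n) x = 0) :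
    (∑ n ∈ s, v n • fourier n : C(AddCircle (1 : ℝ), ℂ)) = 0 := by
  let F : ℝ → ℂ := fun x => ∑ n ∈ s, v n * Complex.exp (2 * Real.pi * Complex.I * n * x)
  have hF (x : ℝ) : (∑ n ∈ s, v n • fourier n : C(AddCircle (1 : ℝ), ℂ)) x = F x := by
    simp only [ContinuousMap.coe_sum, ContinuousMap.coe_smul, Finset.sum_apply, Pi.smul_apply,
      smul_eq_mul, F]
    refine Finset.sum_congr rfl fun n _ => ?_
    rw [fourier_coe_apply, Complex.ofReal_one, div_one]
  have hFan : AnalyticOnNhd ℝ F univ := fun x _ => by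
    refine Finset.analyticAt_fun_sum _ fun n _ => analyticAt_const.mul ?_
    exact analyticAt_cexp.restrictScalars.comp
      (analyticAt_const.mul (Complex.ofRealCLM.analyticAt x))
  have hF0 : F = 0 := by
    refine hFan.eq_of_eventuallyEq (z₀ := 0) analyticOnNhd_const ?_
    filter_upwards [Metric.ball_mem_nhds (0 : ℝ) (show (0 : ℝ) < 1 / 4 by norm_num)] with x hx
    rw [mem_ball_zero_iff, Real.norm_eq_abs] at hx
    rw [← hF, h x (by rwa [norm_coe_unitAddCircle (by linarith)])]
    rfl
  ext x
  obtain ⟨y, rfl⟩ := QuotientAddGroup.mk_surjective x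
  exact (hF y).trans (congrFun hF0 y)

/-- No nonzero function with finitely many Fourier modes is annihilated by multiplication by the
tent-gap function. -/
theorem eq_zero_of_finite_support_of_mulL2_tentGap {ψ : lp (fun _ : ℤ => ℂ) 2}
    (hfin : {n : ℤ | ψ n ≠ 0}.Finite)
    (h : mulL2 AddCircle.haarAddCircle tentGap ((fourierBasis (T := 1)).repr.symm ψ) = 0) :
    ψ = 0 := by
  set p : C(AddCircle (1 : ℝ), ℂ) := ∑ n ∈ hfin.toFinset, ψ n • fourier n with hp
  have hψ : (fourierBasis (T := 1)).repr.symm ψ =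
      ContinuousMap.toLp 2 AddCircle.haarAddCircle ℂ p := by
    refine (fourierBasis.hasSum_repr_symm ψ).unique ?_
    rw [hp, map_sum]
    simp only [map_smul, coe_fourierBasis]
    refine hasSum_sum_of_ne_finset_zero fun n hn => ?_
    have : ψ n = 0 := by simpa using hn
    rw [this, zero_smul]
  rw [hψ, mulL2_toLp] at h
  have hmul : tentGap * p = 0 :=
    ContinuousMap.toLp_injective AddCircle.haarAddCircle (h.trans (map_zero _).symm)
  have hp0 : p = 0 := trigPoly_eq_zero _ _ fun x hx => by
    have hx' := congrArg (fun f : C(AddCircle (1 : ℝ), ℂ) => f x) hmul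
    refine (mul_eq_zero.1 hx').resolve_left ?_
    rw [tentGap_apply, max_eq_right (by linarith)]
    exact Complex.ofReal_ne_zero.2 (by linarith)
  rwa [hp0, map_zero, LinearIsometryEquiv.map_eq_zero_iff] at hψ

end TentGap

end

/-- For the convolution operator `H` on `ℓ²(ℤ)` with kernel `w7`:
the spectrum is `[0,1/4]`, `0` is an eigenvalue with infinite-dimensional eigenspace,
and no nonzero eigenvector for `0` has finite support. -/
theorem stmt7 (H : lp (fun _ : ℤ => ℂ) 2 →L[ℂ] lp (fun _ : ℤ => ℂ) 2)
    (hH : ∀ ψ : lp (fun _ : ℤ => ℂ) 2, ∀ n : ℤ,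
      (H ψ : ∀ _ : ℤ, ℂ) n = ∑' k : ℤ, (w7 k : ℂ) * (ψ : ∀ _ : ℤ, ℂ) (n + k)) :
    spectrum ℂ H = (fun r : ℝ => (r : ℂ)) '' Set.Icc 0 (1/4) ∧
    (∃ ψ : lp (fun _ : ℤ => ℂ) 2, ψ ≠ 0 ∧ H ψ = 0) ∧
    ¬ FiniteDimensional ℂ
      (LinearMap.ker (H : lp (fun _ : ℤ => ℂ) 2 →ₗ[ℂ] lp (fun _ : ℤ => ℂ) 2)) ∧
    (∀ ψ : lp (fun _ : ℤ => ℂ) 2,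
      {n : ℤ | (ψ : ∀ _ : ℤ, ℂ) n ≠ 0}.Finite → H ψ = 0 → ψ = 0) := by
  set b := fourierBasis (T := 1)
  set M := mulL2 AddCircle.haarAddCircle tentGap with hM
  have hconj := eq_conj_mulL2_tentGap H hH
  have happ (f : MeasureTheory.Lp ℂ 2 AddCircle.haarAddCircle) : H (b.repr f) = b.repr (M f) := by
    rw [hconj]
    simp [b, hM]
  have hker : ¬ FiniteDimensional ℂ
      (LinearMap.ker (H : lp (fun _ : ℤ => ℂ) 2 →ₗ[ℂ] lp (fun _ : ℤ => ℂ) 2)) := by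
    intro hfin
    refine not_finiteDimensional_ker_mulL2_tentGap ?_
    let e : M.ker →ₗ[ℂ] LinearMap.ker (H : lp (fun _ : ℤ => ℂ) 2 →ₗ[ℂ] lp (fun _ : ℤ => ℂ) 2) :=
      b.repr.toLinearEquiv.toLinearMap.restrict fun f hf => by
        change H (b.repr f) = 0
        rw [happ, show M f = 0 from hf, map_zero]
    refine FiniteDimensional.of_injective e fun f g hfg => Subtype.ext (b.repr.injective ?_)
    exact congrArg Subtype.val hfg
  refine ⟨?_, ?_, hker, fun ψ hfin hψ => ?_⟩
  · rw [hconj, ← range_tentGap, ← spectrum_mulL2 AddCircle.haarAddCircle]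
    exact AlgEquiv.spectrum_eq b.repr.toContinuousLinearEquiv.conjContinuousAlgEquiv _
  · by_contra! hall
    refine hker ?_
    rw [show LinearMap.ker (H : lp (fun _ : ℤ => ℂ) 2 →ₗ[ℂ] lp (fun _ : ℤ => ℂ) 2) = ⊥ from
      (Submodule.eq_bot_iff _).2 fun ψ hψ => by_contra fun hne => hall ψ hne hψ]
    infer_instance
  · refine eq_zero_of_finite_support_of_mulL2_tentGap hfin (b.repr.injective ?_)
    rw [← happ, LinearIsometryEquiv.apply_symm_apply, hψ, map_zero]
end

section
/- Let w be a connected periodic edge weight on V = Fin ν × ℤ^d. Then the Laplacian L, defined on ℓ²(V, ℂ) by (Lψ)(v) = ∑_{v'∈V} w(v,v')·(ψ(v) − ψ(v')), is a well-defined bounded, self-adjoint, nonnegative operator, and 0 belongs to the spectrum of L. -/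
theorem lp.summable_norm_sq {V : Type*} (ψ : lp (fun _ : V => ℂ) 2) :
    Summable (fun v => ‖ψ v‖ ^ 2) := by
  simpa using (lp.memℓp ψ).summable (by simp)

theorem lp.norm_sq_eq_tsum {V : Type*} (ψ : lp (fun _ : V => ℂ) 2) :
    ‖ψ‖ ^ 2 = ∑' v, ‖ψ v‖ ^ 2 := by
  simpa using lp.norm_rpow_eq_tsum (p := 2) (by simp) ψ

section WeightedGraph

variable {V : Type*} {w : V → V → ℝ} {C : ℝ}

theorem summable_weight_mul_norm_sq (hnn : ∀ u v, 0 ≤ w u v)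
    (hsum : ∀ v, Summable (w v)) (hC : ∀ v, ∑' v', w v v' ≤ C)
    (ψ : lp (fun _ : V => ℂ) 2) :
    Summable (fun p : V × V => w p.1 p.2 * ‖ψ p.1‖ ^ 2) ∧
      ∑' p : V × V, w p.1 p.2 * ‖ψ p.1‖ ^ 2 ≤ C * ‖ψ‖ ^ 2 := by
  have hle : ∀ v, ∑' v', w v v' * ‖ψ v‖ ^ 2 ≤ C * ‖ψ v‖ ^ 2 := fun v => by
    rw [tsum_mul_right]
    exact mul_le_mul_of_nonneg_right (hC v) (sq_nonneg _)
  have hC' : Summable (fun v => C * ‖ψ v‖ ^ 2) := (lp.summable_norm_sq ψ).mul_left C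
  have hrow : Summable (fun v => ∑' v', w v v' * ‖ψ v‖ ^ 2) :=
    hC'.of_nonneg_of_le
      (fun v => tsum_nonneg fun v' => mul_nonneg (hnn v v') (sq_nonneg _)) hle
  have hpos : 0 ≤ fun p : V × V => w p.1 p.2 * ‖ψ p.1‖ ^ 2 := fun p =>
    mul_nonneg (hnn p.1 p.2) (sq_nonneg ‖ψ p.1‖)
  have hs : Summable (fun p : V × V => w p.1 p.2 * ‖ψ p.1‖ ^ 2) :=
    (summable_prod_of_nonneg hpos).2 ⟨fun v => (hsum v).mul_right (‖ψ v‖ ^ 2), hrow⟩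
  refine ⟨hs, ?_⟩
  rw [hs.tsum_prod, lp.norm_sq_eq_tsum, ← tsum_mul_left]
  exact hrow.tsum_le_tsum hle hC'

theorem summable_weight_mul_norm_sub_sq (hnn : ∀ u v, 0 ≤ w u v)
    (hsym : ∀ u v, w u v = w v u) (hsum : ∀ v, Summable (w v))
    (hC : ∀ v, ∑' v', w v v' ≤ C) (ψ : lp (fun _ : V => ℂ) 2) :
    Summable (fun p : V × V => w p.1 p.2 / 2 * ‖ψ p.1 - ψ p.2‖ ^ 2) ∧
      ∑' p : V × V, w p.1 p.2 / 2 * ‖ψ p.1 - ψ p.2‖ ^ 2 ≤ 2 * C * ‖ψ‖ ^ 2 := by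
  obtain ⟨hs, hb⟩ := summable_weight_mul_norm_sq hnn hsum hC ψ
  have hswap : (fun p : V × V => w p.1 p.2 * ‖ψ p.2‖ ^ 2) =
      (fun p : V × V => w p.1 p.2 * ‖ψ p.1‖ ^ 2) ∘ Equiv.prodComm V V := by
    ext p
    simp [hsym p.1 p.2]
  have hs' : Summable (fun p : V × V => w p.1 p.2 * ‖ψ p.2‖ ^ 2) := by
    rw [hswap]
    exact (Equiv.summable_iff _).2 hs
  have hb' : ∑' p : V × V, w p.1 p.2 * ‖ψ p.2‖ ^ 2 ≤ C * ‖ψ‖ ^ 2 := by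
    rw [hswap]
    exact ((Equiv.prodComm V V).tsum_eq _).trans_le hb
  have hle : ∀ p : V × V, w p.1 p.2 / 2 * ‖ψ p.1 - ψ p.2‖ ^ 2 ≤
      w p.1 p.2 * ‖ψ p.1‖ ^ 2 + w p.1 p.2 * ‖ψ p.2‖ ^ 2 := fun p => by
    have h : ‖ψ p.1 - ψ p.2‖ ^ 2 ≤ 2 * (‖ψ p.1‖ ^ 2 + ‖ψ p.2‖ ^ 2) :=
      (pow_le_pow_left₀ (norm_nonneg _) (norm_sub_le _ _) 2).trans
        (by nlinarith [sq_nonneg (‖ψ p.1‖ - ‖ψ p.2‖)])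
    nlinarith [hnn p.1 p.2]
  have hs'' := (hs.add hs').of_nonneg_of_le
    (fun p : V × V => mul_nonneg (div_nonneg (hnn _ _) two_pos.le) (sq_nonneg _)) hle
  refine ⟨hs'', (hs''.tsum_le_tsum hle (hs.add hs')).trans ?_⟩
  rw [hs.tsum_add hs']
  linarith

/-- The weighted gradient is a bounded operator from `ℓ²(V)` to `ℓ²(V × V)`. -/
theorem exists_weighted_gradient (hnn : ∀ u v, 0 ≤ w u v)
    (hsym : ∀ u v, w u v = w v u) (hsum : ∀ v, Summable (w v))
    (hC : ∀ v, ∑' v', w v v' ≤ C) :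
    ∃ T : lp (fun _ : V => ℂ) 2 →L[ℂ] lp (fun _ : V × V => ℂ) 2,
      ∀ ψ p, T ψ p = (√(w p.1 p.2 / 2) : ℂ) * (ψ p.1 - ψ p.2) := by
  have hsq : ∀ (ψ : lp (fun _ : V => ℂ) 2) (p : V × V),
      ‖(√(w p.1 p.2 / 2) : ℂ) * (ψ p.1 - ψ p.2)‖ ^ 2 =
        w p.1 p.2 / 2 * ‖ψ p.1 - ψ p.2‖ ^ 2 := fun ψ p => by
    rw [norm_mul, mul_pow, Complex.norm_real, Real.norm_eq_abs, sq_abs,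
      Real.sq_sqrt (div_nonneg (hnn _ _) two_pos.le)]
  have hmem : ∀ ψ : lp (fun _ : V => ℂ) 2,
      Memℓp (fun p : V × V => (√(w p.1 p.2 / 2) : ℂ) * (ψ p.1 - ψ p.2)) 2 := fun ψ => by
    refine memℓp_gen ?_
    simpa only [ENNReal.toReal_ofNat, Real.rpow_ofNat, hsq] using
      (summable_weight_mul_norm_sub_sq hnn hsym hsum hC ψ).1
  let T : lp (fun _ : V => ℂ) 2 →ₗ[ℂ] lp (fun _ : V × V => ℂ) 2 :=
    { toFun := fun ψ => ⟨_, hmem ψ⟩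
      map_add' := fun ψ φ => by
        ext p
        simp only [lp.coeFn_add, Pi.add_apply]
        ring
      map_smul' := fun c ψ => by
        ext p
        simp only [lp.coeFn_smul, Pi.smul_apply, smul_eq_mul, RingHom.id_apply]
        ring }
  refine ⟨T.mkContinuous √(2 * C) fun ψ => ?_, fun ψ p => rfl⟩
  have h : ‖T ψ‖ ^ 2 ≤ 2 * C * ‖ψ‖ ^ 2 := by
    rw [lp.norm_sq_eq_tsum]
    refine le_of_eq_of_le (tsum_congr (hsq ψ)) ?_
    exact (summable_weight_mul_norm_sub_sq hnn hsym hsum hC ψ).2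
  calc ‖T ψ‖ ≤ √(2 * C * ‖ψ‖ ^ 2) := Real.le_sqrt_of_sq_le h
    _ = √(2 * C) * ‖ψ‖ := by
      rw [Real.sqrt_mul' _ (sq_nonneg _), Real.sqrt_sq (norm_nonneg _)]

theorem summable_weight_mul_sub (hnn : ∀ u v, 0 ≤ w u v) (hsum : ∀ v, Summable (w v))
    (ψ : lp (fun _ : V => ℂ) 2) (v : V) :
    Summable (fun v' => (w v v' : ℂ) * (ψ v - ψ v')) := by
  refine Summable.of_norm_bounded ((hsum v).mul_right (2 * ‖ψ‖)) fun v' => ?_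
  rw [norm_mul, Complex.norm_real, Real.norm_of_nonneg (hnn _ _)]
  refine mul_le_mul_of_nonneg_left ((norm_sub_le _ _).trans ?_) (hnn _ _)
  linarith [lp.norm_apply_le_norm two_ne_zero ψ v, lp.norm_apply_le_norm two_ne_zero ψ v']

open Classical in
theorem adjoint_comp_weighted_gradient_apply (hnn : ∀ u v, 0 ≤ w u v)
    (hsym : ∀ u v, w u v = w v u) (hsum : ∀ v, Summable (w v))
    {T : lp (fun _ : V => ℂ) 2 →L[ℂ] lp (fun _ : V × V => ℂ) 2}
    (hT : ∀ ψ p, T ψ p = (√(w p.1 p.2 / 2) : ℂ) * (ψ p.1 - ψ p.2))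
    (ψ : lp (fun _ : V => ℂ) 2) (v : V) :
    (ContinuousLinearMap.adjoint T ∘L T) ψ v = ∑' v', (w v v' : ℂ) * (ψ v - ψ v') := by
  have h1 : (ContinuousLinearMap.adjoint T ∘L T) ψ v =
      inner ℂ (T (lp.single 2 v (1 : ℂ))) (T ψ) := by
    rw [← ContinuousLinearMap.adjoint_inner_right, lp.inner_single_left]
    simp
  have hs := (summable_weight_mul_sub hnn hsum ψ v).hasSum.div_const 2
  have hfst : HasSum (fun p : V × V =>
      if p.1 = v then (w p.1 p.2 : ℂ) * (ψ p.1 - ψ p.2) / 2 else 0)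
      ((∑' v', (w v v' : ℂ) * (ψ v - ψ v')) / 2) := by
    refine ((Prod.mk_right_injective v).hasSum_iff fun p hp => if_neg fun h => hp ?_).1 ?_
    · exact ⟨p.2, by rw [← h]⟩
    · simpa [Function.comp_def] using hs
  have hsnd : HasSum (fun p : V × V =>
      if p.2 = v then (w p.1 p.2 : ℂ) * (ψ p.2 - ψ p.1) / 2 else 0)
      ((∑' v', (w v v' : ℂ) * (ψ v - ψ v')) / 2) := by
    refine ((Prod.mk_left_injective v).hasSum_iff fun p hp => if_neg fun h => hp ?_).1 ?_
    · exact ⟨p.1, by rw [← h]⟩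
    · simpa [Function.comp_def, hsym _ v] using hs
  rw [h1, lp.inner_eq_tsum, ← add_halves (∑' v', (w v v' : ℂ) * (ψ v - ψ v')),
    ← (hfst.add hsnd).tsum_eq]
  refine tsum_congr fun p => ?_
  have hw : (√(w p.1 p.2 / 2) : ℂ) * (√(w p.1 p.2 / 2) : ℂ) = (w p.1 p.2 : ℂ) / 2 := by
    rw [← Complex.ofReal_mul, Real.mul_self_sqrt (div_nonneg (hnn _ _) two_pos.le)]
    simp
  rw [hT, hT, RCLike.inner_apply, map_mul, Complex.conj_ofReal, mul_mul_mul_comm, hw]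
  by_cases ha : p.1 = v <;> by_cases hb : p.2 = v <;>
    simp [lp.single_apply, ha, hb] <;> ring

end WeightedGraph

open Finset Filter Topology

/-- The cube `[0, N)^d` in `ℤ^d`. -/
noncomputable def latticeCube (d N : ℕ) : Finset (Fin d → ℤ) :=
  Fintype.piFinset fun _ => Finset.Ico 0 (N : ℤ)

theorem card_latticeCube (d N : ℕ) : #(latticeCube d N) = N ^ d := by
  simp [latticeCube]

theorem prod_le_card_latticeCube_filter_add_mem (d N : ℕ) (k : Fin d → ℤ) :
    ∏ i, (N - (k i).natAbs) ≤ #{n ∈ latticeCube d N | n + k ∈ latticeCube d N} := by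
  calc ∏ i, (N - (k i).natAbs)
      ≤ ∏ i, #(Finset.Ico (max 0 (-k i)) (min (N : ℤ) (N - k i))) := by
        refine Finset.prod_le_prod' fun i _ => ?_
        rw [Int.card_Ico]
        omega
    _ = #(Fintype.piFinset fun i => Finset.Ico (max 0 (-k i)) (min (N : ℤ) (N - k i))) :=
        (Fintype.card_piFinset _).symm
    _ ≤ _ := by
        refine Finset.card_le_card fun n hn => ?_
        simp only [Fintype.mem_piFinset, Finset.mem_Ico] at hn
        simp only [latticeCube, Finset.mem_filter, Fintype.mem_piFinset, Finset.mem_Ico,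
          Pi.add_apply]
        refine ⟨fun i => ?_, fun i => ?_⟩ <;> have := hn i <;> omega

/-- The cubes form a Følner sequence. -/
theorem tendsto_card_latticeCube_filter_add_notMem (d : ℕ) (k : Fin d → ℤ) :
    Tendsto (fun N : ℕ => (#{n ∈ latticeCube d N | n + k ∉ latticeCube d N} : ℝ) / N ^ d)
      atTop (𝓝 0) := by
  have hlim : Tendsto (fun N : ℕ => 1 - ∏ i, (1 - ((k i).natAbs : ℝ) / N)) atTop (𝓝 0) := by
    have : Tendsto (fun N : ℕ => ∏ i, (1 - ((k i).natAbs : ℝ) / N)) atTop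
        (𝓝 (∏ _i : Fin d, (1 - 0))) :=
      tendsto_finsetProd _ fun i _ =>
        tendsto_const_nhds.sub (tendsto_const_div_atTop_nhds_zero_nat _)
    simpa using tendsto_const_nhds (x := (1 : ℝ)).sub this
  refine tendsto_of_tendsto_of_tendsto_of_le_of_le' tendsto_const_nhds hlim
    (Eventually.of_forall fun N => by positivity) ?_
  filter_upwards [eventually_gt_atTop 0, eventually_ge_atTop (∑ i, (k i).natAbs)] with N hN hk
  have hN' : (0 : ℝ) < N := Nat.cast_pos.2 hN
  have hsplit := Finset.card_filter_add_card_filter_not (s := latticeCube d N)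
    (fun n => n + k ∈ latticeCube d N)
  rw [card_latticeCube] at hsplit
  have hprod : ∏ i, (1 - ((k i).natAbs : ℝ) / N) =
      ((∏ i, (N - (k i).natAbs) : ℕ) : ℝ) / N ^ d := by
    rw [eq_div_iff (by positivity), Nat.cast_prod]
    calc _ = (∏ i, (1 - ((k i).natAbs : ℝ) / N)) * ∏ _i : Fin d, (N : ℝ) := by simp
      _ = _ := by
        rw [← Finset.prod_mul_distrib]
        refine Finset.prod_congr rfl fun i _ => ?_
        rw [Nat.cast_sub ((Finset.single_le_sum (f := fun i => (k i).natAbs)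
          (fun _ _ => Nat.zero_le _) (Finset.mem_univ i)).trans hk)]
        field_simp
  rw [hprod, div_le_iff₀ (by positivity), sub_mul, div_mul_cancel₀ _ (by positivity), one_mul]
  have := prod_le_card_latticeCube_filter_add_mem d N k
  rw [le_sub_iff_add_le]
  exact_mod_cast (by omega)

section Periodic

variable {d ν : ℕ} {w : (Fin ν × (Fin d → ℤ)) → (Fin ν × (Fin d → ℤ)) → ℝ}

/-- Translation by `n` in the second component. -/
def latticeShift (ν : ℕ) {d : ℕ} (n : Fin d → ℤ) :
    Fin ν × (Fin d → ℤ) ≃ Fin ν × (Fin d → ℤ) :=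
  (Equiv.refl _).prodCongr (Equiv.addLeft n)

theorem weight_latticeShift
    (hper : ∀ (i j : Fin ν) (n m k : Fin d → ℤ), w (i, n + k) (j, m + k) = w (i, n) (j, m))
    (i : Fin ν) (n : Fin d → ℤ) (b : Fin ν × (Fin d → ℤ)) :
    w (i, n) (latticeShift ν n b) = w (i, 0) b := by
  have h := hper i b.1 0 b.2 n
  rwa [zero_add, add_comm] at h

theorem tsum_weight_latticeShift
    (hper : ∀ (i j : Fin ν) (n m k : Fin d → ℤ), w (i, n + k) (j, m + k) = w (i, n) (j, m))
    (i : Fin ν) (n : Fin d → ℤ) (f : Fin ν × (Fin d → ℤ) → ℝ) :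
    ∑' b, w (i, n) b * f b = ∑' b, w (i, 0) b * f (latticeShift ν n b) := by
  rw [← (latticeShift ν n).tsum_eq]
  simp only [weight_latticeShift hper]

/-- The total weight leaving a cube is of smaller order than its volume. -/
theorem tendsto_weight_boundary_latticeCube (hnn : ∀ u v, 0 ≤ w u v)
    (hper : ∀ (i j : Fin ν) (n m k : Fin d → ℤ), w (i, n + k) (j, m + k) = w (i, n) (j, m))
    (hsum : ∀ v, Summable (w v)) :
    Tendsto (fun N : ℕ => (∑ a ∈ Finset.univ ×ˢ latticeCube d N,
      ∑' b, w a b * if b.2 ∈ latticeCube d N then 0 else 1) / (N : ℝ) ^ d) atTop (𝓝 0) := by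
  have heq : ∀ N : ℕ, (∑ a ∈ Finset.univ ×ˢ latticeCube d N,
      ∑' b, w a b * if b.2 ∈ latticeCube d N then 0 else 1) / (N : ℝ) ^ d =
      ∑ i, ∑' b : Fin ν × (Fin d → ℤ), w (i, 0) b *
        ((#{n ∈ latticeCube d N | n + b.2 ∉ latticeCube d N} : ℝ) / N ^ d) := fun N => by
    rw [Finset.sum_product, Finset.sum_div]
    refine Finset.sum_congr rfl fun i _ => ?_
    rw [Finset.sum_congr rfl fun n _ => tsum_weight_latticeShift hper i n _,
      ← Summable.tsum_finsetSum, ← tsum_div_const]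
    · refine tsum_congr fun b => ?_
      rw [← Finset.mul_sum, mul_div_assoc, Finset.card_filter, Nat.cast_sum]
      congr 2
      refine Finset.sum_congr rfl fun n _ => ?_
      simp only [ite_not, Nat.cast_ite, Nat.cast_zero, Nat.cast_one]
      rfl
    · intro n _
      refine (hsum (i, 0)).of_nonneg_of_le
        (fun b => mul_nonneg (hnn _ _) (by split_ifs <;> norm_num))
        (fun b => mul_le_of_le_one_right (hnn _ _) (by split_ifs <;> norm_num))
  simp_rw [heq]
  rw [← Finset.sum_const_zero (M := ℝ) (ι := Fin ν) (s := Finset.univ)]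
  refine tendsto_finsetSum _ fun i _ => ?_
  rw [← tsum_zero (α := ℝ) (β := Fin ν × (Fin d → ℤ))]
  refine tendsto_tsum_of_dominated_convergence (hsum (i, 0)) (fun b => ?_)
    (Eventually.of_forall fun N b => ?_)
  · simpa using (tendsto_card_latticeCube_filter_add_notMem d b.2).const_mul (w (i, 0) b)
  · rw [Real.norm_of_nonneg (mul_nonneg (hnn _ _) (by positivity))]
    refine mul_le_of_le_one_right (hnn _ _) (div_le_one_of_le₀ ?_ (by positivity))
    exact_mod_cast (Finset.card_filter_le _ _).trans_eq (card_latticeCube d N)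

end Periodic

theorem exists_norm_sq_le_of_isUnit_adjoint_comp {E F : Type*}
    [NormedAddCommGroup E] [InnerProductSpace ℂ E] [CompleteSpace E]
    [NormedAddCommGroup F] [InnerProductSpace ℂ F] [CompleteSpace F] (T : E →L[ℂ] F)
    (h : IsUnit (ContinuousLinearMap.adjoint T ∘L T)) :
    ∃ K : ℝ, ∀ x, ‖x‖ ^ 2 ≤
      K * (inner ℂ ((ContinuousLinearMap.adjoint T ∘L T) x) x).re := by
  obtain ⟨S, hS⟩ := h.exists_left_inv
  refine ⟨(‖S‖ * ‖ContinuousLinearMap.adjoint T‖) ^ 2, fun x => ?_⟩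
  have hx : S (ContinuousLinearMap.adjoint T (T x)) = x := DFunLike.congr_fun hS x
  have hre : (inner ℂ ((ContinuousLinearMap.adjoint T ∘L T) x) x).re = ‖T x‖ ^ 2 :=
    (ContinuousLinearMap.apply_norm_sq_eq_inner_adjoint_left T x).symm
  rw [hre, ← mul_pow]
  refine pow_le_pow_left₀ (norm_nonneg _) ?_ 2
  calc ‖x‖ = ‖S (ContinuousLinearMap.adjoint T (T x))‖ := by rw [hx]
    _ ≤ ‖S‖ * (‖ContinuousLinearMap.adjoint T‖ * ‖T x‖) :=
      S.le_opNorm_of_le (ContinuousLinearMap.le_opNorm _ _)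
    _ = _ := (mul_assoc _ _ _).symm

/-- The indicator function of a finite set as an element of `ℓ²`. -/
theorem exists_lp_indicator {V : Type*} [DecidableEq V] (S : Finset V) :
    ∃ χ : lp (fun _ : V => ℂ) 2, (∀ v, χ v = if v ∈ S then 1 else 0) ∧
      ‖χ‖ ^ 2 = #S ∧ ∀ φ : lp (fun _ : V => ℂ) 2, inner ℂ χ φ = ∑ v ∈ S, φ v := by
  have hmem : Memℓp (fun v => if v ∈ S then (1 : ℂ) else 0) 2 :=
    memℓp_gen <| summable_of_ne_finset_zero (s := S) fun v hv => by simp [hv]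
  refine ⟨⟨_, hmem⟩, fun v => rfl, ?_, fun φ => ?_⟩
  · rw [lp.norm_sq_eq_tsum, tsum_eq_sum (s := S) fun v hv => by simp [hv]]
    rw [Finset.sum_congr rfl fun v hv => by simp [hv]; rfl]
    simp
  · rw [lp.inner_eq_tsum, tsum_eq_sum (s := S) fun v hv => by simp [hv]]
    exact Finset.sum_congr rfl fun v hv => by simp [hv]


/-- For a connected periodic edge weight on `V = Fin ν × ℤ^d`, the Laplacian
`(Lψ)(v) = ∑_{v'} w(v,v')(ψ(v) − ψ(v'))` is a well-defined bounded, self-adjoint,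
nonnegative operator on `ℓ²(V)`, and `0` belongs to its spectrum. -/
theorem stmt8 (d ν : ℕ) (hd : 0 < d) (hν : 0 < ν)
    (w : (Fin ν × (Fin d → ℤ)) → (Fin ν × (Fin d → ℤ)) → ℝ)
    (hnn : ∀ u v, 0 ≤ w u v)
    (hsym : ∀ u v, w u v = w v u)
    (hdiag : ∀ v, w v v = 0)
    (hper : ∀ (i j : Fin ν) (n m k : Fin d → ℤ), w (i, n + k) (j, m + k) = w (i, n) (j, m))
    (hsum : ∀ v, Summable (fun v' => w v v'))
    (hconn : ∀ u v, Relation.ReflTransGen (fun a b => 0 < w a b) u v) :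
    ∃ L : lp (fun _ : Fin ν × (Fin d → ℤ) => ℂ) 2 →L[ℂ]
          lp (fun _ : Fin ν × (Fin d → ℤ) => ℂ) 2,
      (∀ (ψ : lp (fun _ : Fin ν × (Fin d → ℤ) => ℂ) 2) (v : Fin ν × (Fin d → ℤ)),
        (L ψ : ∀ _ : Fin ν × (Fin d → ℤ), ℂ) v
          = ∑' v' : Fin ν × (Fin d → ℤ),
              (w v v' : ℂ) * ((ψ : ∀ _ : Fin ν × (Fin d → ℤ), ℂ) v
                - (ψ : ∀ _ : Fin ν × (Fin d → ℤ), ℂ) v')) ∧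
      IsSelfAdjoint L ∧
      (∀ ψ : lp (fun _ : Fin ν × (Fin d → ℤ) => ℂ) 2, 0 ≤ (@inner ℂ _ _ (L ψ) ψ).re) ∧
      (0 : ℂ) ∈ spectrum ℂ L := by
  have hC : ∀ v, ∑' v', w v v' ≤ ∑ i, ∑' b, w (i, 0) b := fun v => by
    have h := tsum_weight_latticeShift hper v.1 v.2 fun _ => 1
    simp only [mul_one] at h
    rw [h]
    exact Finset.single_le_sum (f := fun i => ∑' b, w (i, 0) b)
      (fun i _ => tsum_nonneg (hnn _)) (Finset.mem_univ v.1)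
  obtain ⟨T, hT⟩ := exists_weighted_gradient hnn hsym hsum hC
  have hL := adjoint_comp_weighted_gradient_apply hnn hsym hsum hT
  refine ⟨ContinuousLinearMap.adjoint T ∘L T, hL,
    (ContinuousLinearMap.isPositive_adjoint_comp_self T).isSelfAdjoint,
    (ContinuousLinearMap.isPositive_adjoint_comp_self T).re_inner_nonneg_left, ?_⟩
  rw [spectrum.zero_mem_iff]
  intro hunit
  obtain ⟨K, hK⟩ := exists_norm_sq_le_of_isUnit_adjoint_comp T hunit
  have hbound : ∀ N : ℕ, 0 < N → (ν : ℝ) ≤ K * ((∑ a ∈ Finset.univ ×ˢ latticeCube d N,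
      ∑' b, w a b * if b.2 ∈ latticeCube d N then 0 else 1) / (N : ℝ) ^ d) := fun N hN => by
    obtain ⟨χ, hχ, hnorm, hinner⟩ :=
      exists_lp_indicator ((Finset.univ : Finset (Fin ν)) ×ˢ latticeCube d N)
    have h := hK χ
    rw [← inner_conj_symm, Complex.conj_re, hinner, hnorm, Finset.card_product,
      card_latticeCube, Finset.card_univ, Fintype.card_fin] at h
    have hN' : (0 : ℝ) < (N : ℝ) ^ d := by positivity
    have henergy : (∑ a ∈ Finset.univ ×ˢ latticeCube d N,
        (ContinuousLinearMap.adjoint T ∘L T) χ a).re = ∑ a ∈ Finset.univ ×ˢ latticeCube d N,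
          ∑' b, w a b * if b.2 ∈ latticeCube d N then 0 else 1 := by
      rw [Complex.re_sum]
      refine Finset.sum_congr rfl fun a ha => ?_
      have ha' : χ a = 1 := by rw [hχ, if_pos ha]
      rw [hL, ← Complex.ofReal_re (∑' b, _), Complex.ofReal_tsum]
      congr 1
      refine tsum_congr fun b => ?_
      rw [ha', hχ]
      by_cases hb : b.2 ∈ latticeCube d N <;> simp [hb]
    rw [henergy, Nat.cast_mul, Nat.cast_pow] at h
    rwa [← mul_div_assoc, le_div_iff₀ hN']
  have hlim := (tendsto_weight_boundary_latticeCube hnn hper hsum).const_mul K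
  rw [mul_zero] at hlim
  have hle := ge_of_tendsto hlim ((eventually_gt_atTop 0).mono hbound)
  exact absurd hle (not_le.2 (Nat.cast_pos.2 hν))
end

section
/- Let w be a connected periodic edge weight on V = Fin ν × ℤ^d, and let L be the Laplacian on ℓ²(V, ℂ), (Lψ)(v) = ∑_{v'∈V} w(v,v')·(ψ(v) − ψ(v')). Then 0 is not an eigenvalue of L; that is, the only ψ ∈ ℓ²(V) with Lψ = 0 is ψ = 0. (Combined with the fact that 0 lies in the spectrum, the bottom of the spectrum of L is not an eigenvalue.) -/
/-- A function tending to `0` along the cofinite filter and not identically zero attains the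
maximum of its norm. -/
theorem exists_forall_norm_le_of_tendsto_cofinite {V E : Type*} [NormedAddCommGroup E] {f : V → E}
    (hf : Filter.Tendsto f Filter.cofinite (nhds 0)) {v : V} (hv : f v ≠ 0) :
    ∃ u, f u ≠ 0 ∧ ∀ x, ‖f x‖ ≤ ‖f u‖ := by
  have hfin : {x | ‖f v‖ ≤ ‖f x‖}.Finite := by
    have h := hf.norm.eventually_lt_const (u := ‖f v‖) (by simpa using hv)
    simpa [Filter.eventually_cofinite] using h
  obtain ⟨u, hu, hmax⟩ := hfin.exists_maximalFor (fun x => ‖f x‖) _ ⟨v, le_refl ‖f v‖⟩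
  have hvu : ‖f v‖ ≤ ‖f u‖ := hu
  refine ⟨u, norm_pos_iff.mp ((norm_pos_iff.mpr hv).trans_le hvu), fun x => ?_⟩
  by_contra! hx
  exact absurd (hmax (hvu.trans hx.le : ‖f v‖ ≤ ‖f x‖) hx.le) (not_le.mpr hx)

/-- Maximum principle: on an infinite connected weighted graph with summable weights, a harmonic
function vanishing at infinity is zero. -/
theorem eq_zero_of_harmonic_of_tendsto_cofinite {V : Type*} [Infinite V] {w : V → V → ℝ}
    (hnn : ∀ u v, 0 ≤ w u v) (hsum : ∀ v, Summable (w v))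
    (hconn : ∀ u v, Relation.ReflTransGen (fun a b => 0 < w a b) u v)
    {f : V → ℂ} (hf : Filter.Tendsto f Filter.cofinite (nhds 0))
    (hharm : ∀ v, ∑' v', (w v v' : ℂ) * (f v - f v') = 0) : f = 0 := by
  by_contra hne
  obtain ⟨v, hv⟩ := Function.ne_iff.mp hne
  obtain ⟨u, hu, hmax⟩ := exists_forall_norm_le_of_tendsto_cofinite hf hv
  set c := starRingEnd ℂ (f u)
  have hcnorm : ‖c‖ = ‖f u‖ := by simp [c]
  have hcu : (c * f u).re = ‖f u‖ ^ 2 := by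
    rw [mul_comm, Complex.mul_conj']
    norm_cast
  have hle (x : V) : (c * f x).re ≤ ‖f u‖ ^ 2 := calc
    (c * f x).re ≤ ‖c * f x‖ := Complex.re_le_norm _
    _ = ‖f u‖ * ‖f x‖ := by rw [norm_mul, hcnorm]
    _ ≤ ‖f u‖ ^ 2 := by rw [sq]; gcongr; exact hmax x
  have hstep (x y : V) (hxy : 0 < w x y) (hx : (c * f x).re = ‖f u‖ ^ 2) :
      (c * f y).re = ‖f u‖ ^ 2 := by
    have hs : Summable fun z => (w x z : ℂ) * (f x - f z) := by
      refine Summable.of_norm_bounded ((hsum x).mul_right (2 * ‖f u‖)) fun z => ?_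
      rw [norm_mul, Complex.norm_real, Real.norm_of_nonneg (hnn x z)]
      gcongr
      · exact hnn x z
      · linarith [norm_sub_le (f x) (f z), hmax x, hmax z]
    have hsc : HasSum (fun z => w x z * (‖f u‖ ^ 2 - (c * f z).re)) 0 := by
      have h := Complex.hasSum_re ((hharm x ▸ hs.hasSum).mul_left c)
      rw [mul_zero, Complex.zero_re] at h
      convert h using 2 with z
      rw [mul_left_comm, Complex.re_ofReal_mul, mul_sub c, Complex.sub_re, hx]
    have h0 := congrFun ((hasSum_zero_iff_of_nonneg
      fun z => mul_nonneg (hnn x z) (sub_nonneg.mpr (hle z))).mp hsc) y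
    have := (mul_eq_zero.mp h0).resolve_left hxy.ne'
    linarith
  have hconst (x : V) : (c * f x).re = ‖f u‖ ^ 2 := by
    induction hconn u x with
    | refl => exact hcu
    | tail _ hab ih => exact hstep _ _ hab ih
  have hlim : Filter.Tendsto (fun x => (c * f x).re) Filter.cofinite (nhds 0) := by
    simpa only [mul_zero, Complex.zero_re, Function.comp_def] using
      (Complex.continuous_re.tendsto _).comp (hf.const_mul c)
  simp only [hconst] at hlim
  have := tendsto_nhds_unique hlim tendsto_const_nhds
  exact hu (by simpa using this.symm)

/-- An element of `ℓ²` tends to `0` along the cofinite filter. -/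
theorem tendsto_cofinite_zero_of_lp_two {V : Type*} (ψ : lp (fun _ : V => ℂ) 2) :
    Filter.Tendsto (fun v => ψ v) Filter.cofinite (nhds 0) := by
  have h := ((lp.memℓp ψ).summable (by norm_num)).tendsto_cofinite_zero
  have h2 := h.sqrt
  rw [tendsto_zero_iff_norm_tendsto_zero]
  simpa [Real.sqrt_sq] using h2


/-- For a connected periodic edge weight on `V = Fin ν × ℤ^d`, `0` is not an eigenvalue of
the Laplacian: the only `ψ ∈ ℓ²(V)` with `∑_{v'} w(v,v')(ψ(v) − ψ(v')) = 0` for every `v`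
is `ψ = 0`. -/
theorem stmt9 (d ν : ℕ) (hd : 0 < d) (hν : 0 < ν)
    (w : (Fin ν × (Fin d → ℤ)) → (Fin ν × (Fin d → ℤ)) → ℝ)
    (hnn : ∀ u v, 0 ≤ w u v)
    (hsym : ∀ u v, w u v = w v u)
    (hdiag : ∀ v, w v v = 0)
    (hper : ∀ (i j : Fin ν) (n m k : Fin d → ℤ), w (i, n + k) (j, m + k) = w (i, n) (j, m))
    (hsum : ∀ v, Summable (fun v' => w v v'))
    (hconn : ∀ u v, Relation.ReflTransGen (fun a b => 0 < w a b) u v) :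
    ∀ ψ : lp (fun _ : Fin ν × (Fin d → ℤ) => ℂ) 2,
      (∀ v : Fin ν × (Fin d → ℤ),
        (∑' v' : Fin ν × (Fin d → ℤ),
          (w v v' : ℂ) * ((ψ : ∀ _ : Fin ν × (Fin d → ℤ), ℂ) v
            - (ψ : ∀ _ : Fin ν × (Fin d → ℤ), ℂ) v')) = 0) →
      ψ = 0 := by
  intro ψ hψ
  have : Nonempty (Fin d) := ⟨⟨0, hd⟩⟩
  have : Nonempty (Fin ν) := ⟨⟨0, hν⟩⟩
  have : Infinite (Fin ν × (Fin d → ℤ)) := inferInstance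
  exact lp.ext (eq_zero_of_harmonic_of_tendsto_cofinite hnn hsum hconn
    (tendsto_cofinite_zero_of_lp_two ψ) hψ)
end

section
/- Let w be a connected periodic edge weight on V = Fin ν × ℤ^d, let Q : V → ℝ be a periodic potential (Q((i,n+k)) = Q((i,n)) for all i, n, k), and let H = A + Q be the Schrödinger operator on ℓ²(V, ℂ), where (Aψ)(v) = ∑_{v'∈V} w(v,v') ψ(v') and Q acts by multiplication. Then H is bounded and self-adjoint, and the supremum of its spectrum is not an eigenvalue of H. -/
section Hilbert

variable {E : Type*} [NormedAddCommGroup E] [InnerProductSpace ℂ E] [CompleteSpace E]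

/-- A self-adjoint operator is bounded above by the supremum of its spectrum. -/
lemma le_algebraMap_sSup_spectrum {H : E →L[ℂ] E} (hH : IsSelfAdjoint H) :
    H ≤ algebraMap ℝ (E →L[ℂ] E) (sSup {t : ℝ | (t : ℂ) ∈ spectrum ℂ H}) := by
  refine le_algebraMap_of_spectrum_le (fun x hx => le_csSup ?_ ?_) hH
  · refine ⟨‖H‖ * ‖(1 : E →L[ℂ] E)‖, fun t ht => ?_⟩
    have h := spectrum.norm_le_norm_mul_of_mem ht
    exact (le_abs_self t).trans (by simpa using h)
  · exact (spectrum.algebraMap_mem_iff ℂ).mpr hx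

/-- A positive operator annihilates every vector on which its quadratic form is nonpositive. -/
lemma apply_eq_zero_of_nonneg_of_re_inner_nonpos {T : E →L[ℂ] E} (hT : 0 ≤ T) {x : E}
    (hx : (inner ℂ x (T x)).re ≤ 0) : T x = 0 := by
  obtain ⟨S, rfl⟩ := CStarAlgebra.nonneg_iff_eq_star_mul_self.mp hT
  have h : inner ℂ x ((star S * S) x) = inner ℂ (S x) (S x) := by
    rw [mul_apply_eq_comp, ContinuousLinearMap.star_eq_adjoint,
      ContinuousLinearMap.adjoint_inner_right]
  have h2 : ‖S x‖ ^ 2 ≤ 0 := by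
    rw [h, inner_self_eq_norm_sq_to_K] at hx
    exact_mod_cast hx
  have h3 : S x = 0 := by
    simpa using (pow_eq_zero_iff two_ne_zero).mp (le_antisymm h2 (by positivity))
  simp [h3]

/-- A vector attaining the supremum of the spectrum as its Rayleigh quotient is an eigenvector. -/
lemma apply_eq_sSup_spectrum_smul {H : E →L[ℂ] E} (hH : IsSelfAdjoint H) {x : E}
    (hx : sSup {t : ℝ | (t : ℂ) ∈ spectrum ℂ H} * ‖x‖ ^ 2 ≤ (inner ℂ x (H x)).re) :
    H x = ((sSup {t : ℝ | (t : ℂ) ∈ spectrum ℂ H} : ℝ) : ℂ) • x := by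
  have hle := le_algebraMap_sSup_spectrum hH
  set s := sSup {t : ℝ | (t : ℂ) ∈ spectrum ℂ H}
  have happ : algebraMap ℝ (E →L[ℂ] E) s x = (s : ℂ) • x := by
    simp [Algebra.algebraMap_eq_smul_one]
  have h0 := apply_eq_zero_of_nonneg_of_re_inner_nonpos (sub_nonneg.mpr hle) (x := x) (by
    rw [sub_apply, happ, inner_sub_right, inner_smul_right,
      inner_self_eq_norm_sq_to_K, Complex.sub_re]
    have : ((s : ℂ) * ((‖x‖ : ℂ)) ^ 2).re = s * ‖x‖ ^ 2 := by
      rw [← Complex.ofReal_pow, ← Complex.ofReal_mul, Complex.ofReal_re]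
    simp only [Complex.coe_algebraMap] at this ⊢
    linarith)
  rw [sub_apply, happ, sub_eq_zero] at h0
  exact h0.symm

end Hilbert

section Kernel

variable {α : Type*}

lemma memℓp_two_iff {f : α → ℂ} : Memℓp f 2 ↔ Summable fun v => ‖f v‖ ^ 2 := by
  rw [memℓp_gen_iff (by norm_num)]
  simp

lemma lp_two_norm_sq (f : lp (fun _ : α => ℂ) 2) : ‖f‖ ^ 2 = ∑' v, ‖f v‖ ^ 2 := by
  simpa using lp.norm_rpow_eq_tsum (p := 2) (by norm_num) f

lemma lp_two_summable (f : lp (fun _ : α => ℂ) 2) : Summable fun v => ‖f v‖ ^ 2 :=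
  memℓp_two_iff.mp (lp.memℓp f)

/-- Jensen's inequality for the square and a summable weight. -/
lemma tsum_mul_sq_le {k a : α → ℝ} (hk : ∀ v, 0 ≤ k v) (hks : Summable k)
    (hka : Summable fun v => k v * a v) (hka2 : Summable fun v => k v * a v ^ 2) :
    (∑' v, k v * a v) ^ 2 ≤ (∑' v, k v) * ∑' v, k v * a v ^ 2 := by
  refine le_of_tendsto' (hka.hasSum.pow 2) fun s => ?_
  have h := Finset.sum_mul_sq_le_sq_mul_sq s (fun v => √(k v)) (fun v => √(k v) * a v)
  simp only [← mul_assoc, Real.mul_self_sqrt (hk _), mul_pow, Real.sq_sqrt (hk _)] at h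
  refine h.trans (mul_le_mul (hks.sum_le_tsum s fun v _ => hk v)
    (hka2.sum_le_tsum s fun v _ => mul_nonneg (hk v) (sq_nonneg _))
    (Finset.sum_nonneg fun v _ => mul_nonneg (hk v) (sq_nonneg _)) (tsum_nonneg hk))

/-- A nonnegative symmetric kernel with uniformly bounded row sums. -/
structure IsSchurKernel (K : α → α → ℝ) (C : ℝ) : Prop where
  nonneg : ∀ u v, 0 ≤ K u v
  symm : ∀ u v, K u v = K v u
  summable : ∀ u, Summable (K u)
  tsum_le : ∀ u, ∑' v, K u v ≤ C

namespace IsSchurKernel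

variable {K : α → α → ℝ} {C : ℝ}

lemma summable_mul (hK : IsSchurKernel K C) (f : lp (fun _ : α => ℂ) 2) (u : α) :
    Summable fun v => (K u v : ℂ) * f v := by
  refine Summable.of_norm_bounded ((hK.summable u).mul_right ‖f‖) fun v => ?_
  rw [norm_mul, Complex.norm_real, Real.norm_of_nonneg (hK.nonneg u v)]
  exact mul_le_mul_of_nonneg_left (lp.norm_apply_le_norm two_ne_zero f v) (hK.nonneg u v)

lemma summable_mul_norm (hK : IsSchurKernel K C) (f : lp (fun _ : α => ℂ) 2) (u : α) :
    Summable fun v => K u v * ‖f v‖ := by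
  refine (hK.summable_mul f u).norm.congr fun v => ?_
  rw [norm_mul, Complex.norm_real, Real.norm_of_nonneg (hK.nonneg u v)]

lemma summable_prod_left (hK : IsSchurKernel K C) {a : α → ℝ} (ha : ∀ v, 0 ≤ a v)
    (has : Summable a) : Summable fun p : α × α => K p.1 p.2 * a p.1 := by
  rw [summable_prod_of_nonneg fun p => mul_nonneg (hK.nonneg _ _) (ha _)]
  refine ⟨fun u => (hK.summable u).mul_right (a u), ?_⟩
  simp only [tsum_mul_right]
  exact Summable.of_nonneg_of_le (fun u => mul_nonneg (tsum_nonneg (hK.nonneg u)) (ha u))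
    (fun u => mul_le_mul_of_nonneg_right (hK.tsum_le u) (ha u)) (has.mul_left C)

lemma summable_prod_right (hK : IsSchurKernel K C) {a : α → ℝ} (ha : ∀ v, 0 ≤ a v)
    (has : Summable a) : Summable fun p : α × α => K p.1 p.2 * a p.2 := by
  have h : Summable fun p : α × α => K p.2 p.1 * a p.2 :=
    (hK.summable_prod_left ha has).prod_symm
  exact h.congr fun p => by rw [hK.symm p.2]

lemma tsum_tsum_le (hK : IsSchurKernel K C) {a : α → ℝ} (ha : ∀ v, 0 ≤ a v)
    (has : Summable a) : ∑' u, ∑' v, K u v * a v ≤ C * ∑' v, a v := by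
  rw [Summable.tsum_comm (f := fun v u => K u v * a v)
    ((hK.summable_prod_left ha has).congr fun p => by simp [Function.uncurry, hK.symm p.1])]
  rw [← tsum_mul_left]
  refine Summable.tsum_le_tsum (fun v => ?_) ?_ (has.mul_left C)
  · rw [tsum_mul_right]
    simp only [hK.symm _ v]
    exact mul_le_mul_of_nonneg_right (hK.tsum_le v) (ha v)
  · exact ((hK.summable_prod_left ha has).prod).congr fun p => by simp [hK.symm p]

lemma norm_sq_tsum_le (hK : IsSchurKernel K C) (f : lp (fun _ : α => ℂ) 2) (u : α) :
    ‖∑' v, (K u v : ℂ) * f v‖ ^ 2 ≤ C * ∑' v, K u v * ‖f v‖ ^ 2 := by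
  have h1 : ‖∑' v, (K u v : ℂ) * f v‖ ≤ ∑' v, K u v * ‖f v‖ :=
    tsum_of_norm_bounded (hK.summable_mul_norm f u).hasSum fun v => by
      simp [abs_of_nonneg (hK.nonneg u v)]
  have h2 : Summable fun v => K u v * ‖f v‖ ^ 2 :=
    (hK.summable_prod_right (fun _ => sq_nonneg _) (lp_two_summable f)).prod_factor u
  calc _ ≤ (∑' v, K u v * ‖f v‖) ^ 2 := pow_le_pow_left₀ (norm_nonneg _) h1 2
    _ ≤ _ := tsum_mul_sq_le (hK.nonneg u) (hK.summable u) (hK.summable_mul_norm f u) h2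
    _ ≤ _ := mul_le_mul_of_nonneg_right (hK.tsum_le u)
      (tsum_nonneg fun v => mul_nonneg (hK.nonneg u v) (sq_nonneg _))

lemma summable_tsum (hK : IsSchurKernel K C) (f : lp (fun _ : α => ℂ) 2) :
    Summable fun u => C * ∑' v, K u v * ‖f v‖ ^ 2 :=
  ((hK.summable_prod_right (fun _ => sq_nonneg _) (lp_two_summable f)).prod).mul_left C

lemma memℓp_tsum (hK : IsSchurKernel K C) (f : lp (fun _ : α => ℂ) 2) :
    Memℓp (fun u => ∑' v, (K u v : ℂ) * f v) 2 :=
  memℓp_two_iff.mpr <| Summable.of_nonneg_of_le (fun _ => sq_nonneg _) (hK.norm_sq_tsum_le f)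
    (hK.summable_tsum f)

/-- The bounded operator on `ℓ²` with kernel `K` (Schur test). -/
noncomputable def op [Nonempty α] (hK : IsSchurKernel K C) :
    lp (fun _ : α => ℂ) 2 →L[ℂ] lp (fun _ : α => ℂ) 2 :=
  LinearMap.mkContinuous
    { toFun := fun f => ⟨fun u => ∑' v, (K u v : ℂ) * f v, hK.memℓp_tsum f⟩
      map_add' := fun f g => by
        ext u
        simp only [lp.coeFn_add, Pi.add_apply, mul_add]
        exact (hK.summable_mul f u).tsum_add (hK.summable_mul g u)
      map_smul' := fun c f => by
        ext u
        simp only [lp.coeFn_smul, Pi.smul_apply, smul_eq_mul, RingHom.id_apply, mul_left_comm _ c]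
        exact tsum_mul_left } C fun f => by
    have hC : 0 ≤ C := (tsum_nonneg (hK.nonneg (Classical.arbitrary α))).trans (hK.tsum_le _)
    refine (pow_le_pow_iff_left₀ (norm_nonneg _) (by positivity) two_ne_zero).mp ?_
    rw [lp_two_norm_sq, mul_pow, lp_two_norm_sq, pow_two, mul_assoc]
    refine (Summable.tsum_le_tsum (hK.norm_sq_tsum_le f)
      (memℓp_two_iff.mp (hK.memℓp_tsum f)) (hK.summable_tsum f)).trans ?_
    rw [tsum_mul_left]
    exact mul_le_mul_of_nonneg_left
      (hK.tsum_tsum_le (fun _ => sq_nonneg _) (lp_two_summable f)) hC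

variable [Nonempty α]

lemma op_apply (hK : IsSchurKernel K C) (f : lp (fun _ : α => ℂ) 2) (u : α) :
    hK.op f u = ∑' v, (K u v : ℂ) * f v := rfl

lemma isSelfAdjoint_op (hK : IsSchurKernel K C) : IsSelfAdjoint hK.op := by
  rw [ContinuousLinearMap.isSelfAdjoint_iff_isSymmetric]
  intro f g
  simp only [ContinuousLinearMap.coe_coe, lp.inner_eq_tsum, op_apply, RCLike.inner_apply]
  have hs : Summable fun p : α × α => g p.1 * ((K p.1 p.2 : ℂ) * (starRingEnd ℂ) (f p.2)) := by
    refine Summable.of_norm_bounded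
      ((hK.summable_prod_left (fun _ => sq_nonneg _) (lp_two_summable g)).add
        (hK.summable_prod_right (fun _ => sq_nonneg _) (lp_two_summable f))) fun p => ?_
    simp only [norm_mul, Complex.norm_real, Real.norm_of_nonneg (hK.nonneg _ _), RCLike.norm_conj]
    nlinarith [mul_nonneg (hK.nonneg p.1 p.2) (sq_nonneg (‖g p.1‖ - ‖f p.2‖)),
      mul_nonneg (hK.nonneg p.1 p.2) (add_nonneg (sq_nonneg ‖g p.1‖) (sq_nonneg ‖f p.2‖))]
  have h1 : ∀ u, g u * (starRingEnd ℂ) (∑' v, (K u v : ℂ) * f v)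
      = ∑' v, g u * ((K u v : ℂ) * (starRingEnd ℂ) (f v)) := fun u => by
    rw [Complex.conj_tsum, ← tsum_mul_left]
    simp
  have h2 : ∀ v, (∑' u, (K v u : ℂ) * g u) * (starRingEnd ℂ) (f v)
      = ∑' u, g u * ((K u v : ℂ) * (starRingEnd ℂ) (f v)) := fun v => by
    rw [← tsum_mul_right]
    refine tsum_congr fun u => ?_
    rw [hK.symm v u]
    ring
  simp only [h1, h2]
  exact Summable.tsum_comm (f := fun v u => g u * ((K u v : ℂ) * (starRingEnd ℂ) (f v)))
    hs.prod_symm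

end IsSchurKernel

end Kernel

section PerronFrobenius

variable {α : Type*}

/-- The pointwise modulus of an `ℓ²` function. -/
noncomputable def lpAbs (f : lp (fun _ : α => ℂ) 2) : lp (fun _ : α => ℂ) 2 :=
  ⟨fun v => (‖f v‖ : ℂ), memℓp_two_iff.mpr (by simpa using lp_two_summable f)⟩

lemma lpAbs_apply (f : lp (fun _ : α => ℂ) 2) (v : α) : lpAbs f v = (‖f v‖ : ℂ) := rfl

lemma norm_lpAbs_sq (f : lp (fun _ : α => ℂ) 2) : ‖lpAbs f‖ ^ 2 = ‖f‖ ^ 2 := by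
  simp [lp_two_norm_sq, lpAbs_apply]

/-- Composition of an `ℓ²` function with a permutation of the index set. -/
def lpComp (σ : Equiv.Perm α) (f : lp (fun _ : α => ℂ) 2) : lp (fun _ : α => ℂ) 2 :=
  ⟨fun v => f (σ v), memℓp_two_iff.mpr (σ.summable_iff.mpr (lp_two_summable f))⟩

lemma lpComp_apply (σ : Equiv.Perm α) (f : lp (fun _ : α => ℂ) 2) (v : α) :
    lpComp σ f v = f (σ v) := rfl

namespace IsSchurKernel

variable {K : α → α → ℝ} {C : ℝ} [Nonempty α]

lemma re_inner_op_le (hK : IsSchurKernel K C) (f : lp (fun _ : α => ℂ) 2) :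
    (inner ℂ f (hK.op f)).re ≤ (inner ℂ (lpAbs f) (hK.op (lpAbs f))).re := by
  refine hasSum_le (fun u => ?_) (Complex.hasSum_re (lp.hasSum_inner f (hK.op f)))
    (Complex.hasSum_re (lp.hasSum_inner (lpAbs f) (hK.op (lpAbs f))))
  have h2 : hK.op (lpAbs f) u = ((∑' v, K u v * ‖f v‖ : ℝ) : ℂ) := by
    simp [op_apply, lpAbs_apply, Complex.ofReal_tsum]
  have h1 : ‖hK.op f u‖ ≤ ∑' v, K u v * ‖f v‖ :=
    tsum_of_norm_bounded (hK.summable_mul_norm f u).hasSum fun v => by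
      simp [abs_of_nonneg (hK.nonneg u v)]
  have h3 : (inner ℂ (lpAbs f u) (hK.op (lpAbs f) u)).re
      = (∑' v, K u v * ‖f v‖) * ‖f u‖ := by
    rw [h2, lpAbs_apply, RCLike.inner_apply]
    simp
  rw [h3]
  calc _ ≤ ‖inner ℂ (f u) (hK.op f u)‖ := Complex.re_le_norm _
    _ = ‖hK.op f u‖ * ‖f u‖ := by rw [RCLike.inner_apply]; simp
    _ ≤ _ := mul_le_mul_of_nonneg_right h1 (norm_nonneg _)

lemma op_lpComp (hK : IsSchurKernel K C) (σ : Equiv.Perm α)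
    (hσ : ∀ u v, K (σ u) (σ v) = K u v) (f : lp (fun _ : α => ℂ) 2) :
    hK.op (lpComp σ f) = lpComp σ (hK.op f) := by
  ext u
  rw [lpComp_apply, op_apply, op_apply, ← σ.tsum_eq (fun v => (K (σ u) v : ℂ) * f v)]
  exact tsum_congr fun v => by rw [hσ, lpComp_apply]

/-- A nonnegative eigenfunction of a connected kernel vanishes identically or nowhere. -/
lemma eq_zero_or_pos (hK : IsSchurKernel K C)
    (hconn : ∀ u v, Relation.ReflTransGen (fun a b => 0 < K a b) u v)
    {c : ℝ} {f : lp (fun _ : α => ℂ) 2} (hf : hK.op f = (c : ℂ) • f)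
    {g : α → ℝ} (hg : ∀ v, 0 ≤ g v) (hfg : ∀ v, f v = g v) :
    (∀ v, g v = 0) ∨ ∀ v, 0 < g v := by
  by_contra! h
  obtain ⟨⟨v₁, hv₁⟩, v₀, hv₀⟩ := h
  have hstep : ∀ u v, 0 < K u v → g u = 0 → g v = 0 := by
    intro u v huv hu
    have hs : Summable fun v => K u v * g v := by
      simpa [hfg, abs_of_nonneg (hg _)] using hK.summable_mul_norm f u
    have h1 : ((∑' v, K u v * g v : ℝ) : ℂ) = 0 := by
      have : hK.op f u = 0 := by
        rw [hf, lp.coeFn_smul, Pi.smul_apply, hfg, hu]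
        simp
      simpa [op_apply, hfg, Complex.ofReal_tsum] using this
    have h2 := (hasSum_zero_iff_of_nonneg fun v => mul_nonneg (hK.nonneg u v) (hg v)).mp
      (by simpa [Complex.ofReal_eq_zero.mp h1] using hs.hasSum)
    simpa [huv.ne'] using congrFun h2 v
  refine hv₁ ?_
  have := hconn v₀ v₁
  induction this with
  | refl => exact le_antisymm hv₀ (hg _)
  | tail _ hab ih => exact hstep _ _ hab (by by_contra hne; exact hne (ih hne))

/-- If a permutation preserves a connected kernel and has an orbit escaping every finite set, then
the top of the spectrum is not an eigenvalue. -/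
theorem eq_zero_of_op_eq (hK : IsSchurKernel K C)
    (hconn : ∀ u v, Relation.ReflTransGen (fun a b => 0 < K a b) u v)
    (σ : Equiv.Perm α) (hσ : ∀ u v, K (σ u) (σ v) = K u v)
    (v₀ : α) (hinj : Function.Injective fun m : ℤ => (σ ^ m) v₀) {c : ℝ}
    (hmax : ∀ f : lp (fun _ : α => ℂ) 2, c * ‖f‖ ^ 2 ≤ (inner ℂ f (hK.op f)).re →
      hK.op f = (c : ℂ) • f)
    {f : lp (fun _ : α => ℂ) 2} (hf : hK.op f = (c : ℂ) • f) : f = 0 := by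
  have habs : ∀ f : lp (fun _ : α => ℂ) 2, hK.op f = (c : ℂ) • f →
      hK.op (lpAbs f) = (c : ℂ) • lpAbs f := by
    intro f hf
    refine hmax _ (le_trans ?_ (hK.re_inner_op_le f))
    rw [norm_lpAbs_sq, hf, inner_smul_right, inner_self_eq_norm_sq_to_K]
    refine le_of_eq ?_
    simp only [Complex.coe_algebraMap]
    rw [← Complex.ofReal_pow, ← Complex.ofReal_mul, Complex.ofReal_re]
  rcases hK.eq_zero_or_pos hconn (habs f hf) (g := fun v => ‖f v‖) (fun _ => norm_nonneg _)
    (lpAbs_apply f) with h | hpos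
  · ext v
    simpa using h v
  exfalso
  set h := lpAbs f - lpComp σ (lpAbs f) with h_def
  have hh : hK.op h = (c : ℂ) • h := by
    rw [h_def, map_sub, hK.op_lpComp σ hσ, habs f hf, smul_sub]
    rfl
  have hval : ∀ v, h v = ((‖f v‖ - ‖f (σ v)‖ : ℝ) : ℂ) := fun v => by
    simp [h_def, lpAbs_apply, lpComp_apply]
  have hlim : ∀ τ : ℕ → ℤ, Function.Injective τ →
      Filter.Tendsto (fun m => ‖f ((σ ^ τ m) v₀)‖) Filter.atTop (nhds 0) := by
    intro τ hτ
    have h1 := ((lp_two_summable f).comp_injective (hinj.comp hτ)).tendsto_atTop_zero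
    have h2 := h1.sqrt
    simpa [Function.comp_def] using h2
  have hkey := hK.eq_zero_or_pos hconn (f := lpAbs h - h) (c := c)
    (by rw [map_sub, habs h hh, hh, smul_sub (c : ℂ) (lpAbs h) h])
    (g := fun v => |‖f v‖ - ‖f (σ v)‖| - (‖f v‖ - ‖f (σ v)‖))
    (fun v => sub_nonneg.mpr (le_abs_self _)) (fun v => by
      rw [lp.coeFn_sub, Pi.sub_apply, lpAbs_apply, hval, Complex.norm_real, Real.norm_eq_abs,
        ← Complex.ofReal_sub])
  rcases hkey with h0 | h1
  · have hle : ∀ v, ‖f (σ v)‖ ≤ ‖f v‖ := fun v => by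
      linarith [h0 v, abs_nonneg (‖f v‖ - ‖f (σ v)‖)]
    have hmono : Monotone fun m : ℕ => ‖f ((σ ^ (-(m : ℤ))) v₀)‖ := by
      refine monotone_nat_of_le_succ fun m => ?_
      have := hle ((σ ^ (-((m + 1 : ℕ) : ℤ))) v₀)
      rwa [← Equiv.Perm.mul_apply, ← zpow_one_add,
        show 1 + -((m + 1 : ℕ) : ℤ) = -(m : ℤ) by push_cast; ring] at this
    have := hmono.ge_of_tendsto (hlim (fun m => -(m : ℤ)) fun a b hab => by simpa using hab) 0
    exact absurd (hpos _) (not_lt.mpr this)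
  · have hle : ∀ v, ‖f v‖ ≤ ‖f (σ v)‖ := fun v => by
      by_contra! hlt
      have := h1 v
      rw [abs_of_pos (sub_pos.mpr hlt)] at this
      linarith
    have hmono : Monotone fun m : ℕ => ‖f ((σ ^ (m : ℤ)) v₀)‖ := by
      refine monotone_nat_of_le_succ fun m => ?_
      have := hle ((σ ^ (m : ℤ)) v₀)
      rwa [← Equiv.Perm.mul_apply, ← zpow_one_add,
        show 1 + (m : ℤ) = ((m + 1 : ℕ) : ℤ) by push_cast; ring] at this
    have := hmono.ge_of_tendsto (hlim (fun m => (m : ℤ)) fun a b hab => by simpa using hab) 0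
    exact absurd (hpos _) (not_lt.mpr this)

end IsSchurKernel

end PerronFrobenius


/-- For a connected periodic edge weight `w` on `V = Fin ν × ℤ^d` and a periodic potential
`Q`, the Schrödinger operator `H = A + Q`, `(Hψ)(v) = ∑_{v'} w(v,v')ψ(v') + Q(v)ψ(v)`, is a
well-defined bounded self-adjoint operator on `ℓ²(V)`, and the supremum of its spectrum is
not an eigenvalue. -/
theorem stmt10 (d ν : ℕ) (hd : 0 < d) (hν : 0 < ν)
    (w : (Fin ν × (Fin d → ℤ)) → (Fin ν × (Fin d → ℤ)) → ℝ)
    (hnn : ∀ u v, 0 ≤ w u v)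
    (hsym : ∀ u v, w u v = w v u)
    (hdiag : ∀ v, w v v = 0)
    (hper : ∀ (i j : Fin ν) (n m k : Fin d → ℤ), w (i, n + k) (j, m + k) = w (i, n) (j, m))
    (hsum : ∀ v, Summable (fun v' => w v v'))
    (hconn : ∀ u v, Relation.ReflTransGen (fun a b => 0 < w a b) u v)
    (Q : (Fin ν × (Fin d → ℤ)) → ℝ)
    (hQper : ∀ (i : Fin ν) (n k : Fin d → ℤ), Q (i, n + k) = Q (i, n)) :
    ∃ H : lp (fun _ : Fin ν × (Fin d → ℤ) => ℂ) 2 →L[ℂ]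
          lp (fun _ : Fin ν × (Fin d → ℤ) => ℂ) 2,
      (∀ (ψ : lp (fun _ : Fin ν × (Fin d → ℤ) => ℂ) 2) (v : Fin ν × (Fin d → ℤ)),
        (H ψ : ∀ _ : Fin ν × (Fin d → ℤ), ℂ) v
          = (∑' v' : Fin ν × (Fin d → ℤ),
              (w v v' : ℂ) * (ψ : ∀ _ : Fin ν × (Fin d → ℤ), ℂ) v')
            + (Q v : ℂ) * (ψ : ∀ _ : Fin ν × (Fin d → ℤ), ℂ) v) ∧
      IsSelfAdjoint H ∧
      (∀ ψ : lp (fun _ : Fin ν × (Fin d → ℤ) => ℂ) 2,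
        H ψ = ((sSup {t : ℝ | (t : ℂ) ∈ spectrum ℂ H} : ℝ) : ℂ) • ψ → ψ = 0) := by
  classical
  obtain ⟨q, hq⟩ : ∃ q : ℝ, ∀ v, 0 ≤ Q v + q := by
    refine ⟨∑ i, |Q (i, 0)|, fun v => ?_⟩
    have h1 : Q v = Q (v.1, 0) := by simpa using hQper v.1 0 v.2
    have h2 := Finset.single_le_sum (f := fun i => |Q (i, 0)|) (fun i _ => abs_nonneg _)
      (Finset.mem_univ v.1)
    rw [h1]
    linarith [neg_abs_le (Q (v.1, 0))]
  have hd1 : ∀ (g : Fin ν × (Fin d → ℤ) → ℂ) u,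
      HasSum (fun v => (if u = v then ((Q u + q : ℝ) : ℂ) else 0) * g v)
        (((Q u + q : ℝ) : ℂ) * g u) := fun g u => by
    simpa using hasSum_single (f := fun v => (if u = v then ((Q u + q : ℝ) : ℂ) else 0) * g v) u
      fun v hv => by simp [hv.symm]
  have hd2 : ∀ u, HasSum (fun v => if u = v then Q u + q else 0) (Q u + q) := fun u => by
    simpa using hasSum_single (f := fun v => if u = v then Q u + q else 0) u
      fun v hv => by simp [hv.symm]
  let K : (Fin ν × (Fin d → ℤ)) → (Fin ν × (Fin d → ℤ)) → ℝ :=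
    fun u v => w u v + if u = v then Q u + q else 0
  have hKw : ∀ u v, w u v ≤ K u v := fun u v => by
    have := hq u
    simp only [K]
    split_ifs <;> linarith
  have hKper : ∀ (i j : Fin ν) (n m k : Fin d → ℤ),
      K (i, n + k) (j, m + k) = K (i, n) (j, m) := fun i j n m k => by
    simp [K, hper, hQper]
  have hKrow : ∀ u, Summable (K u) := fun u => (hsum u).add (hd2 u).summable
  have hK0 : ∀ u v, 0 ≤ K u v := fun u v => (hnn u v).trans (hKw u v)
  have hK : IsSchurKernel K (∑ i, ∑' v, K (i, 0) v) :=
    { nonneg := hK0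
      symm := fun u v => by
        by_cases h : u = v
        · rw [h]
        · simp [K, h, Ne.symm h, hsym u v]
      summable := hKrow
      tsum_le := fun u => by
        have h1 : ∑' v, K u v = ∑' v, K (u.1, 0) v := by
          rw [← ((Equiv.refl (Fin ν)).prodCongr (Equiv.addRight u.2)).tsum_eq]
          refine tsum_congr fun v => ?_
          simpa [Prod.map] using hKper u.1 v.1 0 v.2 u.2
        rw [h1]
        exact Finset.single_le_sum (f := fun i => ∑' v, K (i, 0) v)
          (fun i _ => tsum_nonneg (hK0 _)) (Finset.mem_univ u.1) }
  have : Nonempty (Fin ν × (Fin d → ℤ)) := ⟨(⟨0, hν⟩, 0)⟩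
  have hsa : IsSelfAdjoint (hK.op - (q : ℂ) • 1) := by
    refine hK.isSelfAdjoint_op.sub (IsSelfAdjoint.smul ?_ (IsSelfAdjoint.one _))
    exact Complex.conj_ofReal q
  have happ : ∀ ψ : lp (fun _ : Fin ν × (Fin d → ℤ) => ℂ) 2,
      (hK.op - (q : ℂ) • 1) ψ = hK.op ψ - (q : ℂ) • ψ := fun ψ => rfl
  refine ⟨hK.op - (q : ℂ) • 1, fun ψ v => ?_, hsa, fun ψ hψ => ?_⟩
  · have hw : Summable fun v' => (w v v' : ℂ) * ψ v' := by
      refine Summable.of_norm_bounded (hK.summable_mul_norm ψ v) fun v' => ?_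
      rw [norm_mul, Complex.norm_real, Real.norm_of_nonneg (hnn v v')]
      exact mul_le_mul_of_nonneg_right (hKw v v') (norm_nonneg _)
    have h1 : hK.op ψ v = (∑' v', (w v v' : ℂ) * ψ v') + ((Q v + q : ℝ) : ℂ) * ψ v := by
      rw [hK.op_apply, ← (hd1 ψ v).tsum_eq, ← hw.tsum_add (hd1 ψ v).summable]
      refine tsum_congr fun v' => ?_
      simp only [K, Complex.ofReal_add, add_mul]
      split_ifs <;> simp
    rw [happ, lp.coeFn_sub, Pi.sub_apply, h1, lp.coeFn_smul, Pi.smul_apply, smul_eq_mul,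
      Complex.ofReal_add]
    ring
  · set s := sSup {t : ℝ | (t : ℂ) ∈ spectrum ℂ (hK.op - (q : ℂ) • 1)}
    have hiff : ∀ f, (hK.op - (q : ℂ) • 1) f = (s : ℂ) • f → hK.op f = ((s + q : ℝ) : ℂ) • f := by
      intro f hf
      rw [happ, sub_eq_iff_eq_add] at hf
      rw [hf, Complex.ofReal_add, add_smul]
    let σ : Equiv.Perm (Fin ν × (Fin d → ℤ)) := (Equiv.refl _).prodCongr (Equiv.addRight 1)
    have hpow : ∀ m : ℤ, (σ ^ m) (⟨0, hν⟩, 0) = (⟨0, hν⟩, fun _ => m) := by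
      intro m
      induction m with
      | zero => rfl
      | succ m ih =>
        rw [add_comm, zpow_one_add, Equiv.Perm.mul_apply, ih]
        simp only [σ, Equiv.prodCongr_apply, Prod.map]
        ext <;> simp [add_comm]
      | pred m ih =>
        rw [sub_eq_neg_add, zpow_add, zpow_neg_one, Equiv.Perm.mul_apply, ih,
          Equiv.Perm.inv_eq_iff_eq]
        simp only [σ, Equiv.prodCongr_apply, Prod.map]
        ext <;> simp
    refine hK.eq_zero_of_op_eq (fun u v => Relation.ReflTransGen.mono
      (fun a b (hab : 0 < w a b) => hab.trans_le (hKw a b)) u v (hconn u v)) σ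
      (fun u v => hKper u.1 v.1 u.2 v.2 1) (⟨0, hν⟩, 0) (fun a b hab => ?_) (c := s + q)
      (fun f hf => hiff f (apply_eq_sSup_spectrum_smul hsa ?_)) (hiff ψ hψ)
    · simp only [hpow, Prod.mk.injEq, true_and] at hab
      exact congrFun hab ⟨0, hd⟩
    · rw [happ, inner_sub_right, inner_smul_right, inner_self_eq_norm_sq_to_K, Complex.sub_re]
      have : ((q : ℂ) * ((‖f‖ : ℂ)) ^ 2).re = q * ‖f‖ ^ 2 := by
        rw [← Complex.ofReal_pow, ← Complex.ofReal_mul, Complex.ofReal_re]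
      simp only [Complex.coe_algebraMap] at this ⊢
      linarith
end

section
/- Let w : ℤ → ℝ satisfy w(k) ≥ 0, w(−k) = w(k) for all k, and ∑_{k∈ℤ} w(k) < ∞, let Q ∈ ℝ, and let H be the bounded operator on ℓ²(ℤ, ℂ) given by (Hψ)(n) = ∑_{k∈ℤ} w(k) ψ(n+k) + Q·ψ(n). Let P be the orthogonal projection onto functions supported on {n ∈ ℤ : n ≥ 0} (multiplication by the indicator of ℕ). Then the commutator T = H∘P − P∘H is a compact operator; and if moreover ∑_{k≥1} sup_{n≥k} w(n) < ∞ (in particular if w(k) is nonincreasing in |k|), then T is Hilbert–Schmidt, i.e. ∑_{n∈ℤ} ∑_{m∈ℤ} |(T δ_m)(n)|² < ∞, where δ_m ∈ ℓ²(ℤ) is the standard basis vector supported at m. -/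
open Finset in
/-- The commutator of the shift by `k` with the half-line projection on `ℓ²(ℤ)`, written as a
finite sum of rank-one operators. -/
noncomputable def shiftCommutator (k : ℤ) : lp (fun _ : ℤ => ℂ) 2 →L[ℂ] lp (fun _ : ℤ => ℂ) 2 :=
  ∑ n ∈ Icc (-|k|) |k|,
    ((if 0 ≤ n + k then (1 : ℂ) else 0) - if 0 ≤ n then 1 else 0) •
      (lp.singleContinuousLinearMap ℂ (fun _ : ℤ => ℂ) 2 n).comp
        (lp.evalCLM ℂ (fun _ : ℤ => ℂ) 2 (n + k))

theorem indicator_shift_sub_eq_zero {k n : ℤ} (hn : n ∉ Finset.Icc (-|k|) |k|) :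
    ((if 0 ≤ n + k then (1 : ℂ) else 0) - if 0 ≤ n then 1 else 0) = 0 := by
  have h : 0 ≤ n + k ↔ 0 ≤ n := by
    rw [Finset.mem_Icc] at hn
    grind
  simp [h]

theorem norm_indicator_sub_le_one (a b : ℤ) :
    ‖(if 0 ≤ a then (1 : ℂ) else 0) - if 0 ≤ b then 1 else 0‖ ≤ 1 := by
  split_ifs <;> simp

theorem shiftCommutator_eq_sum (k : ℤ) (f : lp (fun _ : ℤ => ℂ) 2) :
    shiftCommutator k f = ∑ n ∈ Finset.Icc (-|k|) |k|, lp.single 2 n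
      (((if 0 ≤ n + k then (1 : ℂ) else 0) - if 0 ≤ n then 1 else 0) * f (n + k)) := by
  simp only [shiftCommutator, sum_apply, smul_apply,
    ContinuousLinearMap.comp_apply, lp.singleContinuousLinearMap_apply, ← smul_eq_mul,
    lp.single_smul]
  rfl

theorem shiftCommutator_apply (k : ℤ) (f : lp (fun _ : ℤ => ℂ) 2) (n : ℤ) :
    shiftCommutator k f n =
      ((if 0 ≤ n + k then (1 : ℂ) else 0) - if 0 ≤ n then 1 else 0) * f (n + k) := by
  rw [shiftCommutator_eq_sum, lp.coeFn_sum, Finset.sum_apply]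
  simp only [lp.coeFn_single, Finset.sum_pi_single]
  by_cases hn : n ∈ Finset.Icc (-|k|) |k|
  · rw [if_pos hn]
  · rw [if_neg hn, indicator_shift_sub_eq_zero hn, zero_mul]

theorem norm_shiftCommutator_le (k : ℤ) : ‖shiftCommutator k‖ ≤ 1 := by
  have hp : 0 < (2 : ENNReal).toReal := by norm_num
  refine ContinuousLinearMap.opNorm_le_bound _ zero_le_one fun f => ?_
  rw [one_mul]
  refine lp.norm_le_of_forall_sum_le hp (norm_nonneg f) fun s => ?_
  calc ∑ n ∈ s, ‖shiftCommutator k f n‖ ^ (2 : ENNReal).toReal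
      ≤ ∑ n ∈ s, ‖f (n + k)‖ ^ (2 : ENNReal).toReal := by
        gcongr with n
        rw [shiftCommutator_apply, norm_mul]
        exact mul_le_of_le_one_left (norm_nonneg _) (norm_indicator_sub_le_one _ _)
    _ = ∑ n ∈ s.map (addRightEmbedding k), ‖f n‖ ^ (2 : ENNReal).toReal := by
        simp
    _ ≤ ‖f‖ ^ (2 : ENNReal).toReal := lp.sum_rpow_le_norm_rpow hp f _

theorem shiftCommutator_mem_compactOperator (k : ℤ) :
    shiftCommutator k ∈
      compactOperator (RingHom.id ℂ) (lp (fun _ : ℤ => ℂ) 2) (lp (fun _ : ℤ => ℂ) 2) := by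
  refine Submodule.sum_mem _ fun n _ => Submodule.smul_mem _ _ ?_
  exact IsCompactOperator.comp_clm (isCompactOperator_of_locallyCompactSpace_rng
    (lp.singleContinuousLinearMap ℂ (fun _ : ℤ => ℂ) 2 n)) _

theorem hasSum_shiftCommutator {w : ℤ → ℝ} (hnn : ∀ k, 0 ≤ w k) (hsum : Summable w)
    {T : lp (fun _ : ℤ => ℂ) 2 →L[ℂ] lp (fun _ : ℤ => ℂ) 2}
    (hT : ∀ f n, HasSum (fun k => (w k : ℂ) * shiftCommutator k f n) (T f n)) :
    HasSum (fun k => (w k : ℂ) • shiftCommutator k) T := by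
  have hs : Summable fun k => (w k : ℂ) • shiftCommutator k := by
    refine Summable.of_norm_bounded hsum fun k => ?_
    rw [norm_smul, Complex.norm_of_nonneg (hnn k)]
    exact mul_le_of_le_one_right (hnn k) (norm_shiftCommutator_le k)
  convert hs.hasSum
  ext f n
  refine (hT f n).unique ?_
  exact (hs.hasSum.mapL (ContinuousLinearMap.apply ℂ _ f)).mapL
    (lp.evalCLM ℂ (fun _ : ℤ => ℂ) 2 n)

theorem le_iSup_tail {w : ℤ → ℝ} (hnn : ∀ k, 0 ≤ w k) (hsum : Summable w) {k n : ℕ}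
    (hkn : k + 1 ≤ n) : w n ≤ ⨆ n : ℕ, ⨆ _ : k + 1 ≤ n, w (n : ℤ) := by
  have hb : BddAbove (Set.range fun n : ℕ => ⨆ _ : k + 1 ≤ n, w (n : ℤ)) := by
    refine ⟨∑' j, w j, ?_⟩
    rintro _ ⟨n, rfl⟩
    exact Real.iSup_le (fun _ => hsum.le_tsum _ fun j _ => hnn j) (tsum_nonneg hnn)
  refine le_ciSup_of_le hb n ?_
  simp [hkn]


/-- For a periodic operator `(Hψ)(n) = ∑_k w(k)ψ(n+k) + Qψ(n)` on `ℓ²(ℤ)` with nonnegative,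
symmetric, summable weights and `P` the half-line projection, the commutator
`T = H∘P − P∘H` is compact; and under the extra sup-summability assumption `T` is
Hilbert–Schmidt. -/
theorem stmt12 (w : ℤ → ℝ) (hnn : ∀ k, 0 ≤ w k) (hsym : ∀ k, w (-k) = w k)
    (hsum : Summable w) (Q : ℝ)
    (H P : lp (fun _ : ℤ => ℂ) 2 →L[ℂ] lp (fun _ : ℤ => ℂ) 2)
    (hH : ∀ (ψ : lp (fun _ : ℤ => ℂ) 2) (n : ℤ),
      (H ψ : ∀ _ : ℤ, ℂ) n
        = (∑' k : ℤ, (w k : ℂ) * (ψ : ∀ _ : ℤ, ℂ) (n + k)) + (Q : ℂ) * (ψ : ∀ _ : ℤ, ℂ) n)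
    (hP : ∀ (ψ : lp (fun _ : ℤ => ℂ) 2) (n : ℤ),
      (P ψ : ∀ _ : ℤ, ℂ) n = if 0 ≤ n then (ψ : ∀ _ : ℤ, ℂ) n else 0) :
    IsCompactOperator (⇑(H.comp P - P.comp H)) ∧
    ((Summable fun k : ℕ => ⨆ n : ℕ, ⨆ _ : k + 1 ≤ n, w (n : ℤ)) →
      Summable (fun p : ℤ × ℤ =>
        ‖((H.comp P - P.comp H) (lp.single 2 p.2 (1 : ℂ)) : ∀ _ : ℤ, ℂ) p.1‖ ^ 2)) := by
  have hs (f : lp (fun _ : ℤ => ℂ) 2) (n : ℤ) : Summable fun k => (w k : ℂ) * f (n + k) := by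
    refine Summable.of_norm_bounded (hsum.mul_right ‖f‖) fun k => ?_
    rw [norm_mul, Complex.norm_of_nonneg (hnn k)]
    exact mul_le_mul_of_nonneg_left (lp.norm_apply_le_norm two_ne_zero f _) (hnn k)
  have hT (f : lp (fun _ : ℤ => ℂ) 2) (n : ℤ) :
      HasSum (fun k => (w k : ℂ) * shiftCommutator k f n) ((H.comp P - P.comp H) f n) := by
    have h := (hs (P f) n).hasSum.sub ((hs f n).hasSum.mul_left (if 0 ≤ n then (1 : ℂ) else 0))
    have hval : (H.comp P - P.comp H) f n = (∑' k, (w k : ℂ) * P f (n + k)) -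
        (if 0 ≤ n then (1 : ℂ) else 0) * ∑' k, (w k : ℂ) * f (n + k) := by
      change H (P f) n - P (H f) n = _
      rw [hH, hP, hP, hH]
      split_ifs <;> ring
    rw [hval]
    refine h.congr_fun fun k => ?_
    rw [shiftCommutator_apply, hP]
    split_ifs <;> ring
  refine ⟨?_, fun hsup => ?_⟩
  · have hmem : H.comp P - P.comp H ∈ {A : lp (fun _ : ℤ => ℂ) 2 →L[ℂ] lp (fun _ : ℤ => ℂ) 2 |
        IsCompactOperator A} :=
      isClosed_setOfPred_isCompactOperator.mem_of_tendsto (hasSum_shiftCommutator hnn hsum hT)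
        (.of_forall fun s => Submodule.sum_mem (compactOperator _ _ _) fun k _ =>
          Submodule.smul_mem _ _ (shiftCommutator_mem_compactOperator k))
    exact hmem
  · have hentry (n m : ℤ) : (H.comp P - P.comp H) (lp.single 2 m (1 : ℂ)) n =
        (w (m - n) : ℂ) * ((if 0 ≤ m then (1 : ℂ) else 0) - if 0 ≤ n then 1 else 0) := by
      refine (hT _ n).unique ?_
      convert hasSum_single (m - n) fun k hk => ?_ using 1
      · simp [shiftCommutator_apply]
      · rw [shiftCommutator_apply, lp.single_apply_ne _ _ _ (by lia)]
        simp
    set s : ℕ → ℝ := fun k => ⨆ n : ℕ, ⨆ _ : k + 1 ≤ n, w (n : ℤ)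
    have hle {k : ℕ} {j : ℤ} (hkj : (k : ℤ) + 1 ≤ j) : w j ≤ s k := by
      lift j to ℕ using by lia
      exact le_iSup_tail hnn hsum (by lia)
    have hs0 (k : ℕ) : 0 ≤ s k := (hnn _).trans (hle le_rfl)
    let S : ℤ → ℝ := fun n => Int.rec s s n
    have hS : Summable S := hsup.int_rec hsup
    have hS0 (n : ℤ) : 0 ≤ S n := by
      cases n <;> exact hs0 _
    have hprod : Summable fun p : ℤ × ℤ => S p.1 * w (p.2 - p.1) := by
      refine ((Equiv.prodShear (Equiv.refl ℤ) Equiv.addLeft).summable_iff).1 ?_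
      simpa [Function.comp_def] using hS.mul_of_nonneg hsum hS0 hnn
    refine Summable.of_nonneg_of_le (fun _ => by positivity) (fun ⟨n, m⟩ => ?_) hprod
    rw [hentry, norm_mul, Complex.norm_of_nonneg (hnn _), mul_pow]
    by_cases hnm : 0 ≤ m ↔ 0 ≤ n
    · simpa [hnm] using mul_nonneg (hS0 n) (hnn (m - n))
    · have hw : w (m - n) ≤ S n := by
        cases n with
        | ofNat n =>
          rw [← hsym]
          exact hle (by simp at hnm ⊢; lia)
        | negSucc n => exact hle (by lia)
      calc w (m - n) ^ 2 * ‖(if 0 ≤ m then (1 : ℂ) else 0) - if 0 ≤ n then 1 else 0‖ ^ 2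
          ≤ w (m - n) ^ 2 :=
            mul_le_of_le_one_right (sq_nonneg _)
              (pow_le_one₀ (norm_nonneg _) (norm_indicator_sub_le_one m n))
        _ ≤ S n * w (m - n) := by
            rw [sq]
            exact mul_le_mul_of_nonneg_right hw (hnn _)
end

section
/- For every t > 0 and every n ∈ ℤ, one has |∫₀¹ e^{i t (θ − 1/2)²} e^{−2πinθ} dθ| ≤ 8 t^{−1/2}. Moreover this rate is sharp: there exist constants C > 0 and t₀ > 0 such that |∫₀¹ e^{i t (θ − 1/2)²} dθ| ≥ C t^{−1/2} for all t ≥ t₀. (These integrals are the matrix elements (e^{itH}δ_0)(n) of the Schrödinger group of the periodic graph with Floquet function a(θ) = (θ − 1/2)², so this graph disperses at rate t^{−1/2}, faster than the rate t^{−1/3} of the adjacency operator on ℤ.) -/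
/-- The complex Fresnel integral `∫₀ˣ e^{is²} ds`. -/
noncomputable def fresnel (x : ℝ) : ℂ :=
  ∫ s in (0:ℝ)..x, Complex.exp (((s ^ 2 : ℝ) : ℂ) * Complex.I)

theorem continuous_exp_sq_mul_I :
    Continuous fun s : ℝ => Complex.exp (((s ^ 2 : ℝ) : ℂ) * Complex.I) := by
  fun_prop

theorem integral_exp_sq_mul_I (a b : ℝ) :
    ∫ s in a..b, Complex.exp (((s ^ 2 : ℝ) : ℂ) * Complex.I) = fresnel b - fresnel a := by
  unfold fresnel
  rw [intervalIntegral.integral_interval_sub_left] <;>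
    exact continuous_exp_sq_mul_I.intervalIntegrable _ _

theorem fresnel_neg (x : ℝ) : fresnel (-x) = -fresnel x := by
  have h := intervalIntegral.integral_comp_neg (a := 0) (b := x)
    (fun s : ℝ => Complex.exp (((s ^ 2 : ℝ) : ℂ) * Complex.I))
  simp only [neg_sq, neg_zero] at h
  unfold fresnel
  rw [h, ← intervalIntegral.integral_symm]

theorem norm_fresnel_le_abs (x : ℝ) : ‖fresnel x‖ ≤ |x| := by
  have h := intervalIntegral.norm_integral_le_of_norm_le_const (a := 0) (b := x) (C := 1)
    (f := fun s : ℝ => Complex.exp (((s ^ 2 : ℝ) : ℂ) * Complex.I))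
    fun s _ => (Complex.norm_exp_ofReal_mul_I _).le
  simpa [fresnel] using h

theorem hasDerivAt_exp_sq_mul_I_div {s : ℝ} (hs : s ≠ 0) :
    HasDerivAt (fun s : ℝ => Complex.exp (((s ^ 2 : ℝ) : ℂ) * Complex.I) / (2 * Complex.I * s))
      (Complex.exp (((s ^ 2 : ℝ) : ℂ) * Complex.I) -
        Complex.exp (((s ^ 2 : ℝ) : ℂ) * Complex.I) / (2 * Complex.I * s ^ 2)) s := by
  have hs' : (s : ℂ) ≠ 0 := by exact_mod_cast hs
  have h1 : HasDerivAt (fun s : ℝ => ((s ^ 2 : ℝ) : ℂ)) ((2 * s : ℝ) : ℂ) s := by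
    simpa using (hasDerivAt_pow 2 s).ofReal_comp
  have h2 : HasDerivAt (fun s : ℝ => 2 * Complex.I * (s : ℂ)) (2 * Complex.I) s := by
    simpa using (hasDerivAt_id s).ofReal_comp.const_mul (2 * Complex.I)
  have hne : 2 * Complex.I * (s : ℂ) ≠ 0 := by simp [hs]
  refine ((h1.mul_const Complex.I).cexp.div h2 hne).congr_deriv ?_
  have hI := Complex.I_ne_zero
  push_cast
  field_simp

theorem integral_inv_two_mul_sq {x y : ℝ} (hx : 0 < x) (hxy : x ≤ y) :
    IntervalIntegrable (fun s : ℝ => 1 / (2 * s ^ 2)) MeasureTheory.volume x y ∧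
      ∫ s in x..y, 1 / (2 * s ^ 2) = 1 / (2 * x) - 1 / (2 * y) := by
  have hpos : ∀ s ∈ Set.uIcc x y, s ≠ 0 := fun s hs => by
    rw [Set.uIcc_of_le hxy] at hs
    exact (hx.trans_le hs.1).ne'
  have hint : IntervalIntegrable (fun s : ℝ => 1 / (2 * s ^ 2)) MeasureTheory.volume x y := by
    refine ContinuousOn.intervalIntegrable fun s hs => ContinuousAt.continuousWithinAt ?_
    have := hpos s hs
    have : 2 * s ^ 2 ≠ 0 := by positivity
    fun_prop (disch := assumption)
  refine ⟨hint, ?_⟩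
  rw [intervalIntegral.integral_eq_sub_of_hasDerivAt (f := fun s : ℝ => -(1 / (2 * s))) _ hint]
  · ring
  · intro s hs
    have := hpos s hs
    have h := ((hasDerivAt_inv this).const_mul (1 / 2)).neg
    refine (h.congr_deriv (by field_simp)).congr_of_eventuallyEq (.of_forall fun u => ?_)
    simp [mul_comm]

theorem norm_fresnel_sub_le {x y : ℝ} (hx : 0 < x) (hxy : x ≤ y) :
    ‖fresnel y - fresnel x‖ ≤ 1 / x := by
  have hpos : ∀ s ∈ Set.uIcc x y, s ≠ 0 := fun s hs => by
    rw [Set.uIcc_of_le hxy] at hs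
    exact (hx.trans_le hs.1).ne'
  obtain ⟨hint, hval⟩ := integral_inv_two_mul_sq hx hxy
  have hint₁ := continuous_exp_sq_mul_I.intervalIntegrable (μ := MeasureTheory.volume) x y
  have hint₂ : IntervalIntegrable (fun s : ℝ => Complex.exp (((s ^ 2 : ℝ) : ℂ) * Complex.I) /
      (2 * Complex.I * s ^ 2)) MeasureTheory.volume x y := by
    refine ContinuousOn.intervalIntegrable fun s hs => ContinuousAt.continuousWithinAt ?_
    have := hpos s hs
    have : 2 * Complex.I * (s : ℂ) ^ 2 ≠ 0 := by simp [this]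
    fun_prop (disch := assumption)
  have key := intervalIntegral.integral_eq_sub_of_hasDerivAt
    (fun s hs => hasDerivAt_exp_sq_mul_I_div (hpos s hs)) (hint₁.sub hint₂)
  rw [intervalIntegral.integral_sub hint₁ hint₂, integral_exp_sq_mul_I, sub_eq_iff_eq_add] at key
  have hrem : ‖∫ s in x..y, Complex.exp (((s ^ 2 : ℝ) : ℂ) * Complex.I) /
      (2 * Complex.I * s ^ 2)‖ ≤ 1 / (2 * x) - 1 / (2 * y) := by
    rw [← hval]
    refine intervalIntegral.norm_integral_le_of_norm_le hxy (.of_forall fun s _ => ?_) hint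
    rw [norm_div, Complex.norm_exp_ofReal_mul_I]
    simp
  have hbdry : ∀ s : ℝ, 0 < s →
      ‖Complex.exp (((s ^ 2 : ℝ) : ℂ) * Complex.I) / (2 * Complex.I * s)‖ = 1 / (2 * s) := by
    intro s hs
    rw [norm_div, Complex.norm_exp_ofReal_mul_I]
    simp [abs_of_pos hs]
  have h1 := norm_add_le
    (Complex.exp (((y ^ 2 : ℝ) : ℂ) * Complex.I) / (2 * Complex.I * y) -
      Complex.exp (((x ^ 2 : ℝ) : ℂ) * Complex.I) / (2 * Complex.I * x))
    (∫ s in x..y, Complex.exp (((s ^ 2 : ℝ) : ℂ) * Complex.I) / (2 * Complex.I * s ^ 2))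
  have h2 := norm_sub_le (Complex.exp (((y ^ 2 : ℝ) : ℂ) * Complex.I) / (2 * Complex.I * y))
    (Complex.exp (((x ^ 2 : ℝ) : ℂ) * Complex.I) / (2 * Complex.I * x))
  rw [hbdry x hx, hbdry y (hx.trans_le hxy)] at h2
  rw [key]
  have : 1 / x = 1 / (2 * x) + 1 / (2 * x) := by field_simp; norm_num
  linarith

theorem norm_fresnel_le (x : ℝ) : ‖fresnel x‖ ≤ 2 := by
  wlog hx : 0 ≤ x generalizing x
  · simpa [fresnel_neg] using this (-x) (by linarith)
  rcases le_total x 1 with h | h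
  · have := norm_fresnel_le_abs x
    rw [abs_of_nonneg hx] at this
    linarith
  · have h1 := norm_fresnel_sub_le one_pos h
    have h2 := norm_fresnel_le_abs 1
    have h3 := norm_add_le (fresnel x - fresnel 1) (fresnel 1)
    rw [sub_add_cancel] at h3
    norm_num at h1 h2
    linarith

theorem fresnel_im (x : ℝ) : (fresnel x).im = ∫ s in (0:ℝ)..x, Real.sin (s ^ 2) := by
  have h := Complex.imCLM.intervalIntegral_comp_comm
    (continuous_exp_sq_mul_I.intervalIntegrable (μ := MeasureTheory.volume) 0 x)
  simp only [Complex.imCLM_apply, Complex.exp_ofReal_mul_I_im] at h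
  exact h.symm

theorem monotoneOn_fresnel_im_sub :
    MonotoneOn (fun x : ℝ => (fresnel x).im - (1 - Real.cos (x ^ 2)) / (2 * x)) (Set.Ici 1) := by
  have hd : ∀ x : ℝ, 1 ≤ x →
      HasDerivAt (fun x : ℝ => (fresnel x).im - (1 - Real.cos (x ^ 2)) / (2 * x))
        ((1 - Real.cos (x ^ 2)) / (2 * x ^ 2)) x := by
    intro x hx
    have hx0 : x ≠ 0 := by positivity
    have h1 : HasDerivAt (fun x => (fresnel x).im) (Real.sin (x ^ 2)) x := by
      simp only [fresnel_im]
      have hc : Continuous fun s : ℝ => Real.sin (s ^ 2) := by fun_prop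
      exact intervalIntegral.integral_hasDerivAt_right (hc.intervalIntegrable _ _)
        (hc.stronglyMeasurableAtFilter _ _) hc.continuousAt
    have h2 := ((hasDerivAt_pow 2 x).cos.const_sub 1).div ((hasDerivAt_id x).const_mul 2)
      (by simpa using hx0)
    refine (h1.sub h2).congr_deriv ?_
    simp only [id]
    field_simp
    push_cast
    ring
  refine monotoneOn_of_deriv_nonneg (convex_Ici 1)
    (fun x hx => (hd x hx).continuousAt.continuousWithinAt)
    (fun x hx => (hd x (interior_subset hx)).differentiableAt.differentiableWithinAt) fun x hx => ?_
  rw [(hd x (interior_subset hx)).deriv]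
  have := Real.cos_le_one (x ^ 2)
  have : 0 ≤ 1 - Real.cos (x ^ 2) := by linarith
  positivity

theorem fresnel_im_one_ge : 1 / 3 - 1 / 42 ≤ (fresnel 1).im := by
  have h : ∫ s in (0:ℝ)..1, (s ^ 2 - s ^ 6 / 6) = 1 / 3 - 1 / 42 := by
    rw [intervalIntegral.integral_sub (by apply Continuous.intervalIntegrable; fun_prop)
      (by apply Continuous.intervalIntegrable; fun_prop)]
    norm_num
  rw [fresnel_im, ← h]
  refine intervalIntegral.integral_mono_on zero_le_one
    (by apply Continuous.intervalIntegrable; fun_prop)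
    (by apply Continuous.intervalIntegrable; fun_prop) fun s hs => ?_
  rcases hs.1.eq_or_lt with rfl | hs0
  · simp
  · have := Real.sin_gt_sub_cube (x := s ^ 2) (by positivity)
    ring_nf at this ⊢
    exact this.le

theorem norm_fresnel_ge {x : ℝ} (hx : 1 ≤ x) : 1 / 21 ≤ ‖fresnel x‖ := by
  have hm := monotoneOn_fresnel_im_sub (Set.mem_Ici.2 le_rfl) (Set.mem_Ici.2 hx) hx
  have h1 := fresnel_im_one_ge
  have h2 := Real.one_sub_sq_div_two_le_cos (x := 1)
  have h3 : 0 ≤ (1 - Real.cos (x ^ 2)) / (2 * x) :=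
    div_nonneg (by linarith [Real.cos_le_one (x ^ 2)]) (by linarith)
  have h4 := (le_abs_self _).trans (Complex.abs_im_le_norm (fresnel x))
  norm_num at hm h1 h2
  linarith

theorem integral_exp_mul_sub_sq {c : ℝ} (hc : c ≠ 0) (d : ℝ) :
    ∫ θ in (0:ℝ)..1, Complex.exp ((((c * θ - d) ^ 2 : ℝ) : ℂ) * Complex.I) =
      (c⁻¹ : ℝ) • (fresnel (c - d) - fresnel (-d)) := by
  rw [← integral_exp_sq_mul_I]
  simpa [-Complex.ofReal_pow, -Complex.ofReal_sub, -Complex.ofReal_mul] using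
    intervalIntegral.integral_comp_mul_sub (a := 0) (b := 1)
    (fun s : ℝ => Complex.exp (((s ^ 2 : ℝ) : ℂ) * Complex.I)) hc d

/-- The periodic graph with Floquet function `a(θ) = (θ − 1/2)²` disperses at the rate
`t^{−1/2}`: the matrix elements of the Schrödinger group satisfy
`|∫₀¹ e^{it(θ−1/2)²} e^{−2πinθ} dθ| ≤ 8 t^{−1/2}`, and this rate is sharp. -/
theorem stmt13 :
    (∀ t : ℝ, 0 < t → ∀ n : ℤ,
      ‖∫ θ in (0:ℝ)..1,
          Complex.exp (Complex.I * t * ((θ : ℂ) - 1/2)^2) *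
            Complex.exp (-2 * Real.pi * Complex.I * n * θ)‖
        ≤ 8 / Real.sqrt t) ∧
    (∃ C > (0:ℝ), ∃ t₀ > (0:ℝ), ∀ t : ℝ, t₀ ≤ t →
      C / Real.sqrt t ≤
        ‖∫ θ in (0:ℝ)..1, Complex.exp (Complex.I * t * ((θ : ℂ) - 1/2)^2)‖) := by
  constructor
  · intro t ht n
    have hc : 0 < Real.sqrt t := Real.sqrt_pos.2 ht
    have hcc : (Real.sqrt t : ℂ) ^ 2 = t := by exact_mod_cast Real.sq_sqrt ht.le
    have hc' : (Real.sqrt t : ℂ) ≠ 0 := by exact_mod_cast hc.ne'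
    set c := Real.sqrt t with hcdef
    set d : ℝ := c / 2 + Real.pi * n / c with hd
    have heq : ∀ θ : ℝ, Complex.exp (Complex.I * t * ((θ : ℂ) - 1/2)^2) *
        Complex.exp (-2 * Real.pi * Complex.I * n * θ) =
        Complex.exp (((t / 4 - d ^ 2 : ℝ) : ℂ) * Complex.I) *
          Complex.exp ((((c * θ - d) ^ 2 : ℝ) : ℂ) * Complex.I) := by
      intro θ
      rw [← Complex.exp_add, ← Complex.exp_add, hd]
      congr 1
      push_cast
      rw [← hcc]
      field_simp
      ring
    simp only [heq]
    rw [intervalIntegral.integral_const_mul, integral_exp_mul_sub_sq hc.ne', norm_mul,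
      Complex.norm_exp_ofReal_mul_I, one_mul, norm_smul, Real.norm_of_nonneg (by positivity),
      div_eq_inv_mul]
    gcongr
    have h1 := norm_sub_le (fresnel (c - d)) (fresnel (-d))
    linarith [norm_fresnel_le (c - d), norm_fresnel_le (-d)]
  · refine ⟨2 / 21, by norm_num, 4, by norm_num, fun t ht => ?_⟩
    have ht0 : 0 < t := by linarith
    have hc : 0 < Real.sqrt t := Real.sqrt_pos.2 ht0
    have hc2 : 2 ≤ Real.sqrt t := Real.le_sqrt_of_sq_le (by linarith)
    have hcc : (Real.sqrt t : ℂ) ^ 2 = t := by exact_mod_cast Real.sq_sqrt ht0.le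
    set c := Real.sqrt t with hcdef
    have heq : ∀ θ : ℝ, Complex.exp (Complex.I * t * ((θ : ℂ) - 1/2)^2) =
        Complex.exp ((((c * θ - c / 2) ^ 2 : ℝ) : ℂ) * Complex.I) := by
      intro θ
      congr 1
      push_cast
      rw [← hcc]
      ring
    simp only [heq]
    rw [integral_exp_mul_sub_sq hc.ne', fresnel_neg, sub_half, sub_neg_eq_add, ← two_mul,
      norm_smul, Real.norm_of_nonneg (by positivity), norm_mul, Complex.norm_ofNat, div_eq_inv_mul]
    gcongr
    linarith [norm_fresnel_ge (x := c / 2) (by linarith)]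
end

section
/- For every t ∈ ℝ there exists m ∈ ℤ such that |∫₀¹ e^{−2πimθ} e^{−i t |θ − 1/2|} dθ| ≥ 1/π. (These integrals are the matrix elements (e^{−itH}δ_0)(m) of the Schrödinger group of the periodic graph with Floquet function b(θ) = |θ − 1/2|; hence ‖e^{−itH}δ_0‖_∞ ≥ 1/π for all times and this graph violates every dispersive estimate, even though its spectrum is purely absolutely continuous and transport is ballistic.) -/
/-- The integral of a cosine whose phase is affine, in division-free form. -/
lemma mul_integral_cos_affine (c d x y : ℝ) :
    c * ∫ θ in x..y, Real.cos (c * θ + d) = Real.sin (c * y + d) - Real.sin (c * x + d) := by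
  rw [intervalIntegral.mul_integral_comp_mul_add, integral_cos]

lemma one_div_pi_le_integral_cos {a : ℝ} (ha : 0 ≤ a) (ha' : a ≤ 2 * Real.pi) :
    1 / Real.pi ≤ ∫ θ in (0:ℝ)..(1 / 2), Real.cos (a * θ + -(a / 4)) := by
  have hpi := Real.pi_gt_three
  rcases ha.eq_or_lt with rfl | hpos
  · simp only [zero_mul, zero_div, neg_zero, add_zero, Real.cos_zero,
      intervalIntegral.integral_const, smul_eq_mul, mul_one, sub_zero]
    exact one_div_le_one_div_of_le (by norm_num) (by linarith)
  · have h := mul_integral_cos_affine a (-(a / 4)) 0 (1 / 2)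
    rw [show a * (1 / 2) + -(a / 4) = a / 4 by ring, mul_zero, zero_add, Real.sin_neg] at h
    have hs := Real.mul_le_sin (x := a / 4) (by linarith) (by linarith)
    refine le_of_mul_le_mul_left ?_ hpos
    calc a * (1 / Real.pi) = 2 * (2 / Real.pi * (a / 4)) := by ring
      _ ≤ _ := by linarith

lemma integral_cos_nonneg {a : ℝ} (n : ℤ) (hn : 0 ≤ n) (ha : 0 ≤ a) (ha' : a ≤ 2 * Real.pi) :
    0 ≤ ∫ θ in (1 / 2 : ℝ)..1,
      Real.cos ((a + 4 * Real.pi * n) * θ + -(3 * a / 4 + 2 * Real.pi * n)) := by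
  have hpi := Real.pi_pos
  have hn' : (0 : ℝ) ≤ n := by exact_mod_cast hn
  have hpn : 0 ≤ Real.pi * n := by positivity
  rcases (show 0 ≤ a + 4 * Real.pi * n by linarith).eq_or_lt with h0 | hpos
  · have ha0 : a = 0 := by linarith
    have hn0 : Real.pi * n = 0 := by linarith
    have hd : 3 * a / 4 + 2 * Real.pi * n = 0 := by linarith
    simp only [← h0, hd, zero_mul, neg_zero, add_zero, Real.cos_zero,
      intervalIntegral.integral_const]
    norm_num
  · have h := mul_integral_cos_affine (a + 4 * Real.pi * n)
      (-(3 * a / 4 + 2 * Real.pi * n)) (1 / 2) 1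
    rw [show (a + 4 * Real.pi * n) * 1 + -(3 * a / 4 + 2 * Real.pi * n)
        = a / 4 + n * (2 * Real.pi) by ring, Real.sin_add_int_mul_two_pi,
      show (a + 4 * Real.pi * n) * (1 / 2) + -(3 * a / 4 + 2 * Real.pi * n) = -(a / 4) by ring,
      Real.sin_neg] at h
    have hs := Real.sin_nonneg_of_nonneg_of_le_pi (x := a / 4) (by linarith) (by linarith)
    refine (mul_nonneg_iff_of_pos_left hpos).mp ?_
    linarith

lemma exists_one_div_pi_le_norm_of_nonneg {t : ℝ} (ht : 0 ≤ t) : ∃ m : ℤ,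
    (1 : ℝ) / Real.pi ≤
      ‖∫ θ in (0:ℝ)..1,
          Complex.exp (-2 * Real.pi * Complex.I * m * θ) *
            Complex.exp (-Complex.I * t * (|θ - 1/2| : ℝ))‖ := by
  have hpi := Real.pi_pos
  set m : ℤ := ⌊t / (2 * Real.pi)⌋
  set a : ℝ := t - 2 * Real.pi * m with ha_def
  have hm : 0 ≤ m := Int.floor_nonneg.mpr (by positivity)
  have ha : 0 ≤ a := by
    have h := (le_div_iff₀ (by positivity)).mp (Int.floor_le (t / (2 * Real.pi)))
    linarith
  have ha' : a ≤ 2 * Real.pi := by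
    have h := (div_lt_iff₀ (by positivity)).mp (Int.lt_floor_add_one (t / (2 * Real.pi)))
    linarith
  refine ⟨m, ?_⟩
  set φ : ℝ := a / 4 + Real.pi * m with hφ
  set F : ℝ → ℂ := fun θ ↦ Complex.exp (-2 * Real.pi * Complex.I * m * θ) *
            Complex.exp (-Complex.I * t * (|θ - 1/2| : ℝ)) with hF
  have hFc : Continuous F := by fun_prop
  have hre (θ : ℝ) : (Complex.exp (φ * Complex.I) * F θ).re
      = Real.cos (φ - 2 * Real.pi * m * θ - t * |θ - 1 / 2|) := by
    simp only [hF]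
    rw [← Complex.exp_add, ← Complex.exp_add, ← Complex.exp_ofReal_mul_I_re]
    congr 2
    push_cast
    ring
  have hnorm : ‖∫ θ in (0:ℝ)..1, F θ‖ = ‖∫ θ in (0:ℝ)..1, Complex.exp (φ * Complex.I) * F θ‖ := by
    rw [intervalIntegral.integral_const_mul, norm_mul, Complex.norm_exp_ofReal_mul_I, one_mul]
  rw [hnorm]
  refine le_trans ?_ (Complex.re_le_norm _)
  have hint : (∫ θ in (0:ℝ)..1, Complex.exp (φ * Complex.I) * F θ).re
      = ∫ θ in (0:ℝ)..1, Real.cos (φ - 2 * Real.pi * m * θ - t * |θ - 1 / 2|) := by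
    simp_rw [← hre]
    exact (Complex.reCLM.intervalIntegral_comp_comm
      ((continuous_const.mul hFc).intervalIntegrable 0 1)).symm
  have hc : Continuous fun θ : ℝ ↦ Real.cos (φ - 2 * Real.pi * m * θ - t * |θ - 1 / 2|) := by
    fun_prop
  rw [hint, ← intervalIntegral.integral_add_adjacent_intervals
    (hc.intervalIntegrable 0 (1 / 2)) (hc.intervalIntegrable (1 / 2) 1)]
  have hleft : ∫ θ in (0:ℝ)..(1 / 2), Real.cos (φ - 2 * Real.pi * m * θ - t * |θ - 1 / 2|)
      = ∫ θ in (0:ℝ)..(1 / 2), Real.cos (a * θ + -(a / 4)) := by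
    refine intervalIntegral.integral_congr fun θ hθ ↦ ?_
    rw [Set.uIcc_of_le (by norm_num)] at hθ
    rw [abs_of_nonpos (by linarith [hθ.2])]
    congr 1
    rw [hφ, ha_def]
    ring
  have hright : ∫ θ in (1 / 2 : ℝ)..1, Real.cos (φ - 2 * Real.pi * m * θ - t * |θ - 1 / 2|)
      = ∫ θ in (1 / 2 : ℝ)..1,
        Real.cos ((a + 4 * Real.pi * m) * θ + -(3 * a / 4 + 2 * Real.pi * m)) := by
    refine intervalIntegral.integral_congr fun θ hθ ↦ ?_
    rw [Set.uIcc_of_le (by norm_num)] at hθ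
    rw [abs_of_nonneg (by linarith [hθ.1]), ← Real.cos_neg]
    congr 1
    rw [hφ, ha_def]
    ring
  rw [hleft, hright]
  linarith [one_div_pi_le_integral_cos ha ha', integral_cos_nonneg m hm ha ha']

/-- The periodic graph with Floquet function `b(θ) = |θ − 1/2|` violates every dispersive
estimate: for every time `t` some matrix element of the Schrödinger group has modulus at
least `1/π`. -/
theorem stmt14 : ∀ t : ℝ, ∃ m : ℤ,
    (1 : ℝ) / Real.pi ≤
      ‖∫ θ in (0:ℝ)..1,
          Complex.exp (-2 * Real.pi * Complex.I * m * θ) *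
            Complex.exp (-Complex.I * t * (|θ - 1/2| : ℝ))‖ := by
  intro t
  rcases le_total 0 t with ht | ht
  · exact exists_one_div_pi_le_norm_of_nonneg ht
  · obtain ⟨m, hm⟩ := exists_one_div_pi_le_norm_of_nonneg (neg_nonneg.mpr ht)
    refine ⟨-m, hm.trans_eq ?_⟩
    rw [← Complex.norm_conj, ← intervalIntegral.intervalIntegral_conj]
    congr 2
    funext θ
    simp only [map_mul, ← Complex.exp_conj, map_neg, Complex.conj_I, Complex.conj_ofReal,
      map_intCast, map_ofNat]
    push_cast
    congr 2 <;> ring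
end

section
/- Let t ∈ ℝ and m ∈ ℤ with t ≠ 2πm and t ≠ −2πm. Then ∫₀¹ e^{−2πimθ} e^{−i t |θ − 1/2|} dθ = ((−1)^m − e^{−it/2}) · (−2it)/(t² − 4π²m²). Consequently, for t > 0 with t ≠ 2π|m|, |∫₀¹ e^{−2πimθ} e^{−i t |θ − 1/2|} dθ| = t·|sin((t − 2πm)/4)| / (|t/2 − πm|·|t/2 + πm|). -/
lemma exp_pi_mul_int_mul_I (m : ℤ) : Complex.exp (m * (Real.pi * Complex.I)) = (-1 : ℂ) ^ m := by
  rw [Complex.exp_int_mul, Complex.exp_pi_mul_I]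

lemma exp_half_sub_mul_I (t : ℝ) (m : ℤ) :
    Complex.exp (-Complex.I * t / 2) * Complex.exp (Complex.I * ((t - 2 * Real.pi * m) / 2 : ℝ))
      = (-1 : ℂ) ^ m := by
  have hneg : (-1 : ℂ) ^ m = (-1 : ℂ) ^ (-m) := by rw [zpow_neg, ← inv_zpow]; norm_num
  rw [hneg, ← Complex.exp_add, ← exp_pi_mul_int_mul_I]
  congr 1
  push_cast
  ring

lemma norm_neg_one_zpow_sub_exp (t : ℝ) (m : ℤ) :
    ‖(-1 : ℂ) ^ m - Complex.exp (-Complex.I * t / 2)‖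
      = 2 * |Real.sin ((t - 2 * Real.pi * m) / 4)| := by
  have hE : ‖Complex.exp (-Complex.I * t / 2)‖ = 1 := by
    rw [Complex.norm_exp]; simp
  rw [← exp_half_sub_mul_I t m, ← mul_sub_one, norm_mul, hE, one_mul,
    Complex.norm_exp_I_mul_ofReal_sub_one, norm_mul, Real.norm_eq_abs, Real.norm_eq_abs, abs_two]
  congr 3
  ring

lemma integral_exp_abs_left (t : ℝ) (m : ℤ) (h : (t : ℂ) - 2 * Real.pi * m ≠ 0) :
    ∫ θ in (0:ℝ)..1/2, Complex.exp (-2 * Real.pi * Complex.I * m * θ) *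
        Complex.exp (-Complex.I * t * (|θ - 1/2| : ℝ))
      = ((-1 : ℂ) ^ m - Complex.exp (-Complex.I * t / 2))
        / (Complex.I * (t - 2 * Real.pi * m)) := by
  have hc : Complex.I * ((t : ℂ) - 2 * Real.pi * m) ≠ 0 := mul_ne_zero Complex.I_ne_zero h
  calc
    _ = ∫ θ in (0:ℝ)..1/2, Complex.exp (-Complex.I * t / 2) *
          Complex.exp (Complex.I * (t - 2 * Real.pi * m) * θ) := by
      refine intervalIntegral.integral_congr fun θ hθ => ?_
      rw [Set.uIcc_of_le (by norm_num)] at hθ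
      rw [abs_of_nonpos (by linarith [hθ.2]), ← Complex.exp_add, ← Complex.exp_add]
      congr 1
      push_cast
      ring
    _ = _ := by
      rw [intervalIntegral.integral_const_mul, integral_exp_mul_complex hc,
        ← exp_half_sub_mul_I t m, mul_div_assoc', mul_sub]
      congr 2
      · congr 2
        push_cast
        ring
      · simp

lemma integral_exp_abs_right (t : ℝ) (m : ℤ) (h : (t : ℂ) + 2 * Real.pi * m ≠ 0) :
    ∫ θ in (1/2:ℝ)..1, Complex.exp (-2 * Real.pi * Complex.I * m * θ) *
        Complex.exp (-Complex.I * t * (|θ - 1/2| : ℝ))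
      = ((-1 : ℂ) ^ m - Complex.exp (-Complex.I * t / 2))
        / (Complex.I * (t + 2 * Real.pi * m)) := by
  have hcongr : ∀ θ : ℝ, Complex.exp (-2 * Real.pi * Complex.I * m * (1 - θ : ℝ)) *
        Complex.exp (-Complex.I * t * (|(1 - θ) - 1/2| : ℝ))
      = Complex.exp (-2 * Real.pi * Complex.I * (-m : ℤ) * θ) *
        Complex.exp (-Complex.I * t * (|θ - 1/2| : ℝ)) := fun θ => by
    have habs : |(1 - θ) - 1/2| = |θ - 1/2| := by rw [← abs_neg]; ring_nf
    have hper : Complex.exp (-2 * Real.pi * Complex.I * m) = 1 := by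
      rw [← Complex.exp_int_mul_two_pi_mul_I (-m)]
      congr 1
      push_cast
      ring
    rw [habs]
    congr 1
    rw [← one_mul (Complex.exp (-2 * Real.pi * Complex.I * (-m : ℤ) * θ)), ← hper,
      ← Complex.exp_add]
    congr 1
    push_cast
    ring
  have hreflect := intervalIntegral.integral_comp_sub_left (a := 0) (b := 1/2)
    (fun θ : ℝ => Complex.exp (-2 * Real.pi * Complex.I * m * θ) *
      Complex.exp (-Complex.I * t * (|θ - 1/2| : ℝ))) 1
  simp only [hcongr] at hreflect
  rw [integral_exp_abs_left t (-m) (by push_cast; convert h using 1; ring)] at hreflect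
  have hneg : (-1 : ℂ) ^ (-m) = (-1 : ℂ) ^ m := by rw [zpow_neg, ← inv_zpow]; norm_num
  rw [show (1 : ℝ) - 1/2 = 1/2 by norm_num, sub_zero, hneg] at hreflect
  rw [← hreflect]
  congr 2
  push_cast
  ring


/-- Explicit formula for the matrix elements of the Schrödinger group of the periodic graph
with Floquet function `b(θ) = |θ − 1/2|`, and the resulting modulus formula. -/
theorem stmt15 (t : ℝ) (m : ℤ) (h1 : t ≠ 2 * Real.pi * m) (h2 : t ≠ -(2 * Real.pi * m)) :
    ((∫ θ in (0:ℝ)..1,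
        Complex.exp (-2 * Real.pi * Complex.I * m * θ) *
          Complex.exp (-Complex.I * t * (|θ - 1/2| : ℝ)))
      = ((-1:ℂ)^m - Complex.exp (-Complex.I * t / 2)) * (-2 * Complex.I * t)
        / ((t:ℂ)^2 - 4 * Real.pi^2 * (m:ℂ)^2)) ∧
    (0 < t → t ≠ 2 * Real.pi * (|m| : ℤ) →
      ‖∫ θ in (0:ℝ)..1,
          Complex.exp (-2 * Real.pi * Complex.I * m * θ) *
            Complex.exp (-Complex.I * t * (|θ - 1/2| : ℝ))‖
        = t * |Real.sin ((t - 2 * Real.pi * m) / 4)|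
          / (|t/2 - Real.pi * m| * |t/2 + Real.pi * m|)) := by

  have hsub : t - 2 * Real.pi * m ≠ 0 := sub_ne_zero.mpr h1
  have hadd : t + 2 * Real.pi * m ≠ 0 := fun h => h2 (eq_neg_of_add_eq_zero_left h)
  have hsub' : (t : ℂ) - 2 * Real.pi * m ≠ 0 := by exact_mod_cast hsub
  have hadd' : (t : ℂ) + 2 * Real.pi * m ≠ 0 := by exact_mod_cast hadd
  have hint : ∀ a b : ℝ, IntervalIntegrable (fun θ : ℝ =>
      Complex.exp (-2 * Real.pi * Complex.I * m * θ) *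
        Complex.exp (-Complex.I * t * (|θ - 1/2| : ℝ))) MeasureTheory.volume a b :=
    fun a b => Continuous.intervalIntegrable (by fun_prop) a b
  have hden : (t : ℂ)^2 - 4 * Real.pi^2 * (m : ℂ)^2
      = (t - 2 * Real.pi * m) * (t + 2 * Real.pi * m) := by ring
  have key : (∫ θ in (0:ℝ)..1,
        Complex.exp (-2 * Real.pi * Complex.I * m * θ) *
          Complex.exp (-Complex.I * t * (|θ - 1/2| : ℝ)))
      = ((-1:ℂ)^m - Complex.exp (-Complex.I * t / 2)) * (-2 * Complex.I * t)
        / ((t:ℂ)^2 - 4 * Real.pi^2 * (m:ℂ)^2) := by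
    rw [← intervalIntegral.integral_add_adjacent_intervals (hint 0 (1/2)) (hint (1/2) 1),
      integral_exp_abs_left t m hsub', integral_exp_abs_right t m hadd', hden]
    generalize (-1:ℂ)^m - Complex.exp (-Complex.I * t / 2) = A
    rw [div_add_div _ _ (mul_ne_zero Complex.I_ne_zero hsub')
      (mul_ne_zero Complex.I_ne_zero hadd'), div_eq_div_iff
      (mul_ne_zero (mul_ne_zero Complex.I_ne_zero hsub') (mul_ne_zero Complex.I_ne_zero hadd'))
      (mul_ne_zero hsub' hadd')]
    linear_combination 2 * A * Complex.I * t * (t - 2 * Real.pi * m) * (t + 2 * Real.pi * m)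
      * Complex.I_sq
  refine ⟨key, fun ht _ => ?_⟩
  have hden_norm : ‖((t : ℂ) - 2 * Real.pi * m) * (t + 2 * Real.pi * m)‖
      = 4 * (|t/2 - Real.pi * m| * |t/2 + Real.pi * m|) := by
    have hreal : ((t : ℂ) - 2 * Real.pi * m) * (t + 2 * Real.pi * m)
        = ((4 * ((t/2 - Real.pi * m) * (t/2 + Real.pi * m)) : ℝ) : ℂ) := by push_cast; ring
    rw [hreal, Complex.norm_real, Real.norm_eq_abs, abs_mul, abs_mul, abs_of_pos four_pos]
  have hnum : ‖-2 * Complex.I * (t : ℂ)‖ = 2 * t := by simp [abs_of_pos ht]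
  rw [key, norm_div, norm_mul, norm_neg_one_zpow_sub_exp, hnum, hden, hden_norm,
    ← mul_div_mul_left (t * _) _ (four_ne_zero (α := ℝ))]
  congr 1
  ring
end

section
/- Let 0 < α ≤ 1/4 and t ∈ ℝ with t ≠ 0, and set φ_t(θ) = e^{i t (4 sin²(πθ))^α} for θ ∈ [0,1]. Then ∑_{n∈ℤ} n² · |∫₀¹ e^{−2πinθ} φ_t(θ) dθ|² = ∞, i.e. φ_t does not belong to the Sobolev space H¹ of the circle. (Since ∫₀¹ e^{−2πinθ} φ_t(θ) dθ = (e^{it(−Δ)^α}δ_0)(n) for the one-dimensional fractional Laplacian, this says the mean squared displacement ‖x e^{it(−Δ)^α}δ_0‖² is infinite for every t ≠ 0: motion is super-ballistic, blowing up in finite time.) -/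
/-- The weighted square sum of the increments of the characters, in closed form. -/
lemma hasSum_norm_exp_sub_one_sq_div_sq {h : ℝ} (hh : h ∈ Set.Icc (0 : ℝ) 1) :
    HasSum (fun n : ℤ =>
      ‖Complex.exp (2 * Real.pi * Complex.I * n * h) - 1‖ ^ 2 / (n : ℝ) ^ 2)
      (4 * Real.pi ^ 2 * (h - h ^ 2)) := by
  have key (n : ℤ) : ‖Complex.exp (2 * Real.pi * Complex.I * n * h) - 1‖ ^ 2 =
      2 - 2 * Real.cos (2 * Real.pi * n * h) := by
    have e : (2 * Real.pi * Complex.I * n * h : ℂ) =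
        Complex.I * ((2 * Real.pi * n * h : ℝ) : ℂ) := by push_cast; ring
    rw [e, Complex.norm_exp_I_mul_ofReal_sub_one, Real.norm_eq_abs, sq_abs, mul_pow,
      Real.sin_sq_eq_half_sub]
    ring_nf
  have cosSum {x : ℝ} (hx : x ∈ Set.Icc (0 : ℝ) 1) :
      HasSum (fun n : ℕ => ((n : ℝ) ^ 2)⁻¹ * Real.cos (2 * Real.pi * n * x))
        ((2 * Real.pi) ^ 2 / 2 / 2 * (6⁻¹ + -x + x ^ 2)) := by
    have := hasSum_one_div_nat_pow_mul_cos (k := 1) (by norm_num) hx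
    simpa [Polynomial.map, Polynomial.eval₂_add, Polynomial.bernoulli_def,
      Finset.sum_range_succ] using this
  have nat : HasSum (fun n : ℕ => (2 - 2 * Real.cos (2 * Real.pi * n * h)) / (n : ℝ) ^ 2)
      (2 * Real.pi ^ 2 * (h - h ^ 2)) := by
    have := ((cosSum (x := 0) (by simp)).sub (cosSum hh)).mul_left 2
    rw [show 2 * Real.pi ^ 2 * (h - h ^ 2) = 2 * ((2 * Real.pi) ^ 2 / 2 / 2 * (6⁻¹ + -0 + 0 ^ 2) -
      (2 * Real.pi) ^ 2 / 2 / 2 * (6⁻¹ + -h + h ^ 2)) by ring]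
    have e : (fun n : ℕ => (2 - 2 * Real.cos (2 * Real.pi * n * h)) / (n : ℝ) ^ 2) =
        fun n : ℕ => 2 * (((n : ℝ) ^ 2)⁻¹ * Real.cos (2 * Real.pi * n * 0) -
          ((n : ℝ) ^ 2)⁻¹ * Real.cos (2 * Real.pi * n * h)) := by
      ext n
      rw [mul_zero, Real.cos_zero]
      ring
    rw [e]
    exact this
  simp_rw [key]
  have := HasSum.of_nat_of_neg (f := fun n : ℤ =>
    (2 - 2 * Real.cos (2 * Real.pi * n * h)) / (n : ℝ) ^ 2)
    (by simpa using nat) (by simpa using nat)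
  simp only [Int.cast_zero, ne_eq, OfNat.ofNat_ne_zero, not_false_eq_true, zero_pow, div_zero,
    sub_zero] at this
  rw [show 4 * Real.pi ^ 2 * (h - h ^ 2) =
    2 * Real.pi ^ 2 * (h - h ^ 2) + 2 * Real.pi ^ 2 * (h - h ^ 2) by ring]
  exact this

lemma mul_le_weighted_sq_add_sq_div_sq {A E p : ℝ} {n : ℤ} (hp : 0 < p) (hE : n = 0 → E = 0) :
    A * E ≤ p / 2 * ((n : ℝ) ^ 2 * A ^ 2) + 1 / (2 * p) * (E ^ 2 / (n : ℝ) ^ 2) := by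
  by_cases hn : n = 0
  · simp [hn, hE hn]
  · have hn' : (n : ℝ) ≠ 0 := by exact_mod_cast hn
    have h : p / 2 * ((n : ℝ) ^ 2 * A ^ 2) + 1 / (2 * p) * (E ^ 2 / (n : ℝ) ^ 2) - A * E =
        1 / (2 * p) * (p * (n * A) - E / n) ^ 2 := by
      field_simp
      ring
    have : 0 ≤ 1 / (2 * p) * (p * (n * A) - E / n) ^ 2 := by positivity
    linarith

/-- A continuous function whose Fourier coefficients have finite `H¹` weight has summable
Fourier coefficients. -/
lemma summable_fourierCoeff_of_summable_sq {f : C(AddCircle (1 : ℝ), ℂ)}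
    (hf : Summable fun n : ℤ => (n : ℝ) ^ 2 * ‖fourierCoeff f n‖ ^ 2) :
    Summable (fourierCoeff f) := by
  have h1 : Summable fun n : ℤ => 1 / (n : ℝ) ^ 2 :=
    Real.summable_one_div_int_pow.mpr (by norm_num)
  refine Summable.of_norm_bounded_eventually (hf.add h1) ?_
  filter_upwards [(Set.finite_singleton (0 : ℤ)).compl_mem_cofinite] with n hn
  have hn' : (n : ℝ) ≠ 0 := by exact_mod_cast hn
  have h2 := mul_le_weighted_sq_add_sq_div_sq (A := ‖fourierCoeff f n‖) (E := 1) (n := n)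
    one_pos (fun h => absurd h hn)
  have h3 : 0 ≤ (n : ℝ) ^ 2 * ‖fourierCoeff f n‖ ^ 2 := by positivity
  have h4 : 0 ≤ 1 / (n : ℝ) ^ 2 := by positivity
  rw [mul_one, one_pow, mul_one] at h2
  linarith

/-- A continuous function on the circle in `H¹` has increments `o(√h)` at the origin. -/
lemma norm_sub_le_of_summable_sq {f : C(AddCircle (1 : ℝ), ℂ)}
    (hf : Summable fun n : ℤ => (n : ℝ) ^ 2 * ‖fourierCoeff f n‖ ^ 2) {ε : ℝ} (hε : 0 < ε) :
    ∃ C : ℝ, ∀ h : ℝ, 0 < h → h ≤ 1 →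
      ‖f (h : AddCircle (1 : ℝ)) - f (0 : ℝ)‖ ≤ C * h + ε * √h := by
  set δ : ℝ := ε / (1 + 2 * Real.pi ^ 2) with hδ
  have hδ0 : 0 < δ := by positivity
  obtain ⟨F, hF⟩ := summable_iff_vanishing_norm.mp hf (δ ^ 2) (by positivity)
  refine ⟨∑ n ∈ F, ‖fourierCoeff f n‖ * |2 * Real.pi * n|, fun h h0 h1 => ?_⟩
  have hs := summable_fourierCoeff_of_summable_sq hf
  have hsum := (has_pointwise_sum_fourier_series_of_summable hs (h : AddCircle (1 : ℝ))).sub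
    (has_pointwise_sum_fourier_series_of_summable hs ((0 : ℝ) : AddCircle (1 : ℝ)))
  have hterm (n : ℤ) : ‖fourierCoeff f n • fourier n (h : AddCircle (1 : ℝ)) -
      fourierCoeff f n • fourier n ((0 : ℝ) : AddCircle (1 : ℝ))‖ =
      ‖fourierCoeff f n‖ * ‖Complex.exp (2 * Real.pi * Complex.I * n * h) - 1‖ := by
    rw [← smul_sub, norm_smul, fourier_coe_apply, fourier_coe_apply]
    simp
  have hlip (n : ℤ) : ‖Complex.exp (2 * Real.pi * Complex.I * n * h) - 1‖ ≤
      |2 * Real.pi * n| * h := by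
    have e : (2 * Real.pi * Complex.I * n * h : ℂ) =
        Complex.I * ((2 * Real.pi * n * h : ℝ) : ℂ) := by push_cast; ring
    rw [e]
    refine (Real.norm_exp_I_mul_ofReal_sub_one_le (x := 2 * Real.pi * n * h)).trans_eq ?_
    rw [Real.norm_eq_abs, abs_mul _ h, abs_of_pos h0]
  have hr : 0 < √h := Real.sqrt_pos.mpr h0
  have hrr : √h * √h = h := Real.mul_self_sqrt h0.le
  refine le_of_tendsto hsum.norm ?_
  filter_upwards [Filter.eventually_ge_atTop F] with T hT
  refine (norm_sum_le _ _).trans ?_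
  simp_rw [hterm]
  rw [← Finset.sum_sdiff hT, add_comm]
  refine add_le_add ?_ ?_
  · rw [Finset.sum_mul]
    refine Finset.sum_le_sum fun n _ => ?_
    exact (mul_le_mul_of_nonneg_left (hlip n) (norm_nonneg (fourierCoeff f n))).trans_eq
      (mul_assoc _ _ _).symm
  · have hp : 0 < √h / δ := by positivity
    have hc := (le_abs_self _).trans (hF (T \ F) Finset.sdiff_disjoint).le
    have hB : ∑ n ∈ T \ F,
        ‖Complex.exp (2 * Real.pi * Complex.I * n * h) - 1‖ ^ 2 / (n : ℝ) ^ 2 ≤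
        4 * Real.pi ^ 2 * h := by
      refine (sum_le_hasSum _ (fun n _ => by positivity)
        (hasSum_norm_exp_sub_one_sq_div_sq ⟨h0.le, h1⟩)).trans ?_
      gcongr
      nlinarith [sq_nonneg h]
    calc _ ≤ ∑ n ∈ T \ F, (√h / δ / 2 * ((n : ℝ) ^ 2 * ‖fourierCoeff f n‖ ^ 2) +
          1 / (2 * (√h / δ)) *
            (‖Complex.exp (2 * Real.pi * Complex.I * n * h) - 1‖ ^ 2 / (n : ℝ) ^ 2)) :=
          Finset.sum_le_sum fun n _ => mul_le_weighted_sq_add_sq_div_sq hp (by rintro rfl; simp)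
      _ ≤ √h / δ / 2 * δ ^ 2 + 1 / (2 * (√h / δ)) * (4 * Real.pi ^ 2 * h) := by
          rw [Finset.sum_add_distrib, ← Finset.mul_sum, ← Finset.mul_sum]
          gcongr
      _ = δ * √h * (1 / 2 + 2 * Real.pi ^ 2) := by
          nth_rw 3 [← hrr]
          field_simp
          ring
      _ ≤ δ * √h * (1 + 2 * Real.pi ^ 2) := by gcongr; norm_num
      _ = ε * √h := by
          rw [hδ]
          field_simp

/-- Super-ballistic motion for the one-dimensional fractional Laplacian with `0 < α ≤ 1/4`:
for `t ≠ 0` the function `φ_t(θ) = e^{it(4sin²(πθ))^α}` is not in `H¹` of the circle, i.e.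
`∑_n n²|φ̂_t(n)|² = ∞`. -/
theorem stmt17 (α t : ℝ) (hα0 : 0 < α) (hα : α ≤ 1/4) (ht : t ≠ 0) :
    ¬ Summable (fun n : ℤ =>
      (n : ℝ)^2 *
        ‖∫ θ in (0:ℝ)..1,
            Complex.exp (-2 * Real.pi * Complex.I * n * θ) *
              Complex.exp (Complex.I * t * (((4 * Real.sin (Real.pi * θ)^2) ^ α : ℝ) : ℂ))‖^2) := by
  intro hsum
  set s : ℝ → ℝ := fun θ => (4 * Real.sin (Real.pi * θ) ^ 2) ^ α with hs
  have hscont : Continuous s :=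
    Continuous.rpow_const (by fun_prop) (fun _ => Or.inr hα0.le)
  have hs0 : s 0 = 0 := by simp [hs, hα0.ne']
  have hsper : Function.Periodic s 1 := fun x => by simp [hs, mul_add, Real.sin_add_pi]
  set g : ℝ → ℂ := fun θ => Complex.exp (Complex.I * t * (s θ : ℂ)) with hg
  have hgcont : Continuous g := by fun_prop
  have hgper : Function.Periodic g 1 := fun x => by simp [hg, hsper x]
  let f : C(AddCircle (1 : ℝ), ℂ) := ⟨hgper.lift, continuous_coinduced_dom.mpr hgcont⟩
  have hfg (x : ℝ) : f (x : AddCircle (1 : ℝ)) = g x := rfl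
  have hf : Summable fun n : ℤ => (n : ℝ) ^ 2 * ‖fourierCoeff f n‖ ^ 2 := by
    refine hsum.congr fun n => ?_
    rw [fourierCoeff_eq_intervalIntegral _ n 0]
    congr 3
    simp only [div_one, one_smul, zero_add]
    refine intervalIntegral.integral_congr fun x _ => ?_
    simp only [fourier_coe_apply, hfg, smul_eq_mul]
    congr 2
    push_cast
    ring
  have ht0 : 0 < |t| := abs_pos.mpr ht
  obtain ⟨C, hC⟩ := norm_sub_le_of_summable_sq hf
    (ε := 2 / Real.pi * |t|) (by positivity)
  have hlim1 : ∀ᶠ h in nhdsWithin (0 : ℝ) (Set.Ioi 0), |t| * s h < Real.pi := by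
    have : Filter.Tendsto (fun h => |t| * s h) (nhds 0) (nhds (|t| * s 0)) :=
      (by fun_prop : Continuous fun h => |t| * s h).tendsto 0
    rw [hs0, mul_zero] at this
    exact (this.eventually_lt_const Real.pi_pos).filter_mono nhdsWithin_le_nhds
  have hlim2 : ∀ᶠ h in nhdsWithin (0 : ℝ) (Set.Ioi 0), C * √h < 2 / Real.pi * |t| := by
    have : Filter.Tendsto (fun h => C * √h) (nhds 0) (nhds (C * √0)) :=
      (by fun_prop : Continuous fun h => C * √h).tendsto 0
    rw [Real.sqrt_zero, mul_zero] at this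
    exact (this.eventually_lt_const (by positivity)).filter_mono nhdsWithin_le_nhds
  have hlim3 : ∀ᶠ h in nhdsWithin (0 : ℝ) (Set.Ioi 0), h < 1 / 4 :=
    (eventually_lt_nhds (by norm_num)).filter_mono nhdsWithin_le_nhds
  obtain ⟨h, h1, h2, h3, h0⟩ :=
    (hlim1.and (hlim2.and (hlim3.and self_mem_nhdsWithin))).exists
  replace h0 : 0 < h := h0
  have hr : 0 < √h := Real.sqrt_pos.mpr h0
  have hrr : √h * √h = h := Real.mul_self_sqrt h0.le
  have hlow : 2 * √h ≤ s h := by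
    have hsin : 2 * h ≤ Real.sin (Real.pi * h) := by
      have := Real.mul_le_sin (x := Real.pi * h) (by positivity)
        (by nlinarith [Real.pi_pos])
      rwa [← mul_assoc, div_mul_cancel₀ _ Real.pi_ne_zero] at this
    calc 2 * √h = ((2 * √h) ^ (4 : ℕ)) ^ (1 / 4 : ℝ) := by
          rw [← Real.rpow_natCast, ← Real.rpow_mul (by positivity)]
          norm_num
      _ = (16 * h ^ 2) ^ (1 / 4 : ℝ) := by
          rw [show (2 * √h) ^ 4 = 16 * (√h * √h) ^ 2 by ring, hrr]
      _ ≤ (16 * h ^ 2) ^ α :=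
          Real.rpow_le_rpow_of_exponent_ge (by positivity) (by nlinarith) hα
      _ ≤ s h := by
          refine Real.rpow_le_rpow (by positivity) ?_ hα0.le
          nlinarith
  have hs_pos : 0 < s h := by linarith
  have hnorm : 2 / Real.pi * (|t| * s h) ≤ ‖g h - g 0‖ := by
    have e : Complex.I * t * (s h : ℂ) = Complex.I * ((t * s h : ℝ) : ℂ) := by
      push_cast; ring
    have habs : |t * s h / 2| = |t| * s h / 2 := by
      rw [abs_div, abs_mul, abs_of_pos hs_pos, abs_two]
    have := Real.mul_abs_le_abs_sin (x := t * s h / 2) (by rw [habs]; linarith)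
    rw [habs] at this
    simp only [hg, hs0, Complex.ofReal_zero, mul_zero, Complex.exp_zero]
    rw [e, Complex.norm_exp_I_mul_ofReal_sub_one, Real.norm_eq_abs, abs_mul, abs_two]
    linarith
  have hup := hC h h0 (by linarith)
  rw [hfg, hfg] at hup
  have hlow' : 2 / Real.pi * |t| * (2 * √h) ≤ 2 / Real.pi * (|t| * s h) := by
    calc _ = 2 / Real.pi * (|t| * (2 * √h)) := by ring
      _ ≤ _ := by gcongr
  have hCh : C * h < 2 / Real.pi * |t| * √h := by
    calc C * h = C * √h * √h := by rw [mul_assoc, hrr]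
      _ < _ := mul_lt_mul_of_pos_right h2 hr
  linarith
end

section
/- Let z ∈ ℂ with z ∉ [0, 1/2], and for n ∈ ℤ set G_n(z) = ∫₀¹ e^{−2πinθ} / (|θ − 1/2| − z) dθ (the Green's function G^z(0,n) of the periodic graph with Floquet function b(θ) = |θ − 1/2|). Then lim_{n→∞} ( 2π² n² G_n(z) − ((−1)^n / z² − 1/((1/2 − z)²)) ) = 0. In particular G_n(z) = O(n^{−2}) and the resolvent kernel decays only polynomially, not exponentially, away from the diagonal. -/
open MeasureTheory intervalIntegral Filter Topology

/-- Two integrations by parts for an exponential against the reciprocal of an affine function. -/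
lemma integral_exp_div_affine {c p s : ℂ} (hc : c ≠ 0) {a b : ℝ}
    (hq : ∀ θ ∈ Set.uIcc a b, p + s * (θ : ℂ) ≠ 0) :
    ∫ θ in a..b, Complex.exp (c * θ) / (p + s * θ) =
      Complex.exp (c * b) * (1 / (c * (p + s * b)) + s / (c ^ 2 * (p + s * b) ^ 2))
      - Complex.exp (c * a) * (1 / (c * (p + s * a)) + s / (c ^ 2 * (p + s * a) ^ 2))
      + 2 * s ^ 2 / c ^ 2 * ∫ θ in a..b, Complex.exp (c * θ) / (p + s * θ) ^ 3 := by
  have hcont (k : ℕ) : IntervalIntegrable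
      (fun θ : ℝ => Complex.exp (c * θ) / (p + s * θ) ^ k) volume a b :=
    (ContinuousOn.div (by fun_prop) (by fun_prop)
      fun θ hθ => pow_ne_zero _ (hq θ hθ)).intervalIntegrable
  have h1 : IntervalIntegrable
      (fun θ : ℝ => Complex.exp (c * θ) / (p + s * θ)) volume a b := by
    simpa using hcont 1
  have h3 := (hcont 3).const_mul (2 * s ^ 2 / c ^ 2)
  have key := integral_eq_sub_of_hasDerivAt
    (f := fun θ : ℝ => Complex.exp (c * θ) *
      (1 / (c * (p + s * θ)) + s / (c ^ 2 * (p + s * θ) ^ 2)))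
    (f' := fun θ : ℝ => Complex.exp (c * θ) / (p + s * θ)
      - 2 * s ^ 2 / c ^ 2 * (Complex.exp (c * θ) / (p + s * θ) ^ 3)) (a := a) (b := b)
    (fun θ hθ => by
      have hne := hq θ hθ
      have hid : HasDerivAt (fun x : ℝ => (x : ℂ)) 1 θ := Complex.ofRealCLM.hasDerivAt
      have hE := (hid.const_mul c).cexp
      have hA := (hid.const_mul s).const_add p
      have h₁ := (hasDerivAt_const θ (1 : ℂ)).fun_div (hA.const_mul c) (mul_ne_zero hc hne)
      have h₂ := (hasDerivAt_const θ s).fun_div ((hA.fun_pow 2).const_mul (c ^ 2))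
        (mul_ne_zero (pow_ne_zero 2 hc) (pow_ne_zero 2 hne))
      refine (hE.mul (h₁.add h₂)).congr_deriv ?_
      simp only [Pi.add_apply]
      generalize p + s * (θ : ℂ) = q at hne ⊢
      push_cast
      field_simp
      ring)
    (h1.sub h3)
  rw [integral_sub h1 h3, intervalIntegral.integral_const_mul] at key
  rw [← key]
  ring

/-- The Riemann–Lebesgue lemma for Fourier coefficients of a function on `[0, 1]`. -/
lemma tendsto_integral_exp_mul_zero_one (g : ℝ → ℂ) :
    Tendsto (fun n : ℕ => ∫ θ in (0 : ℝ)..1,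
      Complex.exp (-2 * Real.pi * Complex.I * n * θ) * g θ) atTop (𝓝 0) := by
  have hn : Tendsto (fun n : ℕ => (n : ℝ)) atTop (cocompact ℝ) :=
    tendsto_natCast_atTop_atTop.mono_right atTop_le_cocompact
  refine ((Real.tendsto_integral_exp_smul_cocompact
    ((Set.Ioc (0 : ℝ) 1).indicator g)).comp hn).congr fun n => ?_
  rw [integral_of_le zero_le_one, ← MeasureTheory.integral_indicator measurableSet_Ioc]
  refine integral_congr_ae (Eventually.of_forall fun θ => ?_)
  by_cases h : θ ∈ Set.Ioc (0 : ℝ) 1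
  · simp only [Set.indicator_of_mem h, Circle.smul_def, Real.fourierChar_apply, smul_eq_mul]
    congr 2
    push_cast
    ring
  · simp [Set.indicator_of_notMem h]

/-- The Green's function as its leading boundary terms plus an oscillatory remainder. -/
lemma two_pi_sq_mul_green_eq {z : ℂ} (hz : z ∉ (fun r : ℝ => (r : ℂ)) '' Set.Icc 0 (1 / 2))
    {n : ℕ} (hn : n ≠ 0) :
    2 * (Real.pi : ℂ) ^ 2 * (n : ℂ) ^ 2 *
        (∫ θ in (0 : ℝ)..1,
          Complex.exp (-2 * Real.pi * Complex.I * n * θ) / (((|θ - 1 / 2| : ℝ) : ℂ) - z))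
      - ((-1 : ℂ) ^ n / z ^ 2 - 1 / ((1 / 2 - z) ^ 2)) =
    -∫ θ in (0 : ℝ)..1, Complex.exp (-2 * Real.pi * Complex.I * n * θ) *
      (1 / (((|θ - 1 / 2| : ℝ) : ℂ) - z) ^ 3) := by
  have hne (r : ℝ) (h0 : 0 ≤ r) (h1 : r ≤ 1 / 2) : (r : ℂ) - z ≠ 0 := fun h =>
    hz ⟨r, ⟨h0, h1⟩, sub_eq_zero.mp h⟩
  have hz0 : z ≠ 0 := by simpa using hne 0 le_rfl (by norm_num)
  have hz1 : 1 / 2 - z ≠ 0 := by simpa using hne (1 / 2) (by norm_num) le_rfl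
  have hπ : (Real.pi : ℂ) ≠ 0 := by exact_mod_cast Real.pi_ne_zero
  have hnC : (n : ℂ) ≠ 0 := by exact_mod_cast hn
  set c : ℂ := -2 * Real.pi * Complex.I * n with hc
  have hc0 : c ≠ 0 := by simp [hc, hπ, hnC]
  have hc2 : c ^ 2 = -(4 * (Real.pi : ℂ) ^ 2 * (n : ℂ) ^ 2) := by
    rw [hc]; ring_nf; rw [Complex.I_sq]; ring
  have hE1 : Complex.exp c = 1 :=
    Complex.exp_eq_one_iff.mpr ⟨-n, by rw [hc]; push_cast; ring⟩
  have hEh : Complex.exp (c * (1 / 2)) = (-1) ^ n := by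
    rw [show c * (1 / 2) = n * (-(Real.pi * Complex.I)) by rw [hc]; ring, Complex.exp_nat_mul,
      Complex.exp_neg, Complex.exp_pi_mul_I]
    norm_num
  have hl : ∀ θ ∈ Set.uIcc (0 : ℝ) (1 / 2),
      ((|θ - 1 / 2| : ℝ) : ℂ) - z = 1 / 2 - z + -1 * (θ : ℂ) := fun θ hθ => by
    rw [Set.uIcc_of_le (by norm_num)] at hθ
    rw [abs_of_nonpos (by linarith [hθ.2])]
    push_cast
    ring
  have hr : ∀ θ ∈ Set.uIcc (1 / 2 : ℝ) 1,
      ((|θ - 1 / 2| : ℝ) : ℂ) - z = -1 / 2 - z + 1 * (θ : ℂ) := fun θ hθ => by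
    rw [Set.uIcc_of_le (by norm_num)] at hθ
    rw [abs_of_nonneg (by linarith [hθ.1])]
    push_cast
    ring
  have hne' : ∀ θ ∈ Set.Icc (0 : ℝ) 1, ((|θ - 1 / 2| : ℝ) : ℂ) - z ≠ 0 := fun θ hθ =>
    hne _ (abs_nonneg _) (abs_le.mpr ⟨by linarith [hθ.1], by linarith [hθ.2]⟩)
  have hql : ∀ θ ∈ Set.uIcc (0 : ℝ) (1 / 2), 1 / 2 - z + -1 * (θ : ℂ) ≠ 0 := fun θ hθ => by
    rw [← hl θ hθ]
    rw [Set.uIcc_of_le (by norm_num)] at hθ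
    exact hne' θ ⟨hθ.1, by linarith [hθ.2]⟩
  have hqr : ∀ θ ∈ Set.uIcc (1 / 2 : ℝ) 1, -1 / 2 - z + 1 * (θ : ℂ) ≠ 0 := fun θ hθ => by
    rw [← hr θ hθ]
    rw [Set.uIcc_of_le (by norm_num)] at hθ
    exact hne' θ ⟨by linarith [hθ.1], hθ.2⟩
  have hsplit (k : ℕ) :
      ∫ θ in (0 : ℝ)..1, Complex.exp (c * θ) / (((|θ - 1 / 2| : ℝ) : ℂ) - z) ^ k =
        (∫ θ in (0 : ℝ)..(1 / 2 : ℝ), Complex.exp (c * θ) / (1 / 2 - z + -1 * (θ : ℂ)) ^ k)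
        + ∫ θ in (1 / 2 : ℝ)..1, Complex.exp (c * θ) / (-1 / 2 - z + 1 * (θ : ℂ)) ^ k := by
    have hcont : ContinuousOn
        (fun θ : ℝ => Complex.exp (c * θ) / (((|θ - 1 / 2| : ℝ) : ℂ) - z) ^ k)
        (Set.Icc 0 1) :=
      ContinuousOn.div (by fun_prop) (by fun_prop) fun θ hθ => pow_ne_zero _ (hne' θ hθ)
    rw [← integral_add_adjacent_intervals (b := (1 / 2 : ℝ))
      (hcont.mono fun θ hθ => ?_).intervalIntegrable
      (hcont.mono fun θ hθ => ?_).intervalIntegrable]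
    · congr 1
      · exact integral_congr fun θ hθ => by simp only [hl θ hθ]
      · exact integral_congr fun θ hθ => by simp only [hr θ hθ]
    · rw [Set.uIcc_of_le (by norm_num)] at hθ
      exact ⟨hθ.1, by linarith [hθ.2]⟩
    · rw [Set.uIcc_of_le (by norm_num)] at hθ
      exact ⟨by linarith [hθ.1], hθ.2⟩
  have hsplit₁ := hsplit 1
  simp only [pow_one] at hsplit₁
  simp only [mul_one_div]
  rw [hsplit₁, hsplit 3, integral_exp_div_affine hc0 hql, integral_exp_div_affine hc0 hqr]
  generalize (∫ θ in (0 : ℝ)..(1 / 2 : ℝ),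
    Complex.exp (c * θ) / (1 / 2 - z + -1 * (θ : ℂ)) ^ 3) = A
  generalize (∫ θ in (1 / 2 : ℝ)..1,
    Complex.exp (c * θ) / (-1 / 2 - z + 1 * (θ : ℂ)) ^ 3) = B
  push_cast
  rw [mul_one c, mul_zero c, Complex.exp_zero, hE1, hEh,
    show (1 / 2 - z + -1 * (1 / 2) : ℂ) = -z by ring,
    show (-1 / 2 - z + 1 * (1 / 2) : ℂ) = -z by ring,
    show (1 / 2 - z + -1 * 0 : ℂ) = 1 / 2 - z by ring,
    show (-1 / 2 - z + 1 * 1 : ℂ) = 1 / 2 - z by ring]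
  generalize (1 / 2 - z : ℂ) = w at hz1 ⊢
  rw [hc2]
  field_simp
  ring


/-- For the periodic graph with Floquet function `b(θ) = |θ − 1/2|`, the Green's function
`G_n(z) = ∫₀¹ e^{−2πinθ}/(|θ−1/2| − z) dθ` satisfies
`2π²n²G_n(z) → (−1)^n/z² − 1/(1/2 − z)²` (difference tending to `0`); in particular
`G_n(z) = O(n^{−2})`, i.e. the resolvent kernel decays only polynomially. -/
theorem stmt19 (z : ℂ) (hz : z ∉ (fun r : ℝ => (r : ℂ)) '' Set.Icc 0 (1/2)) :
    Filter.Tendsto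
      (fun n : ℕ =>
        2 * (Real.pi : ℂ)^2 * (n : ℂ)^2 *
            (∫ θ in (0:ℝ)..1,
              Complex.exp (-2 * Real.pi * Complex.I * n * θ) / (((|θ - 1/2| : ℝ) : ℂ) - z))
          - ((-1 : ℂ)^n / z^2 - 1 / ((1/2 - z)^2)))
      Filter.atTop (nhds 0) ∧
    ∃ C : ℝ, ∀ n : ℕ, 1 ≤ n →
      ‖∫ θ in (0:ℝ)..1,
          Complex.exp (-2 * Real.pi * Complex.I * n * θ) / (((|θ - 1/2| : ℝ) : ℂ) - z)‖
        ≤ C / (n : ℝ)^2 := by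
  have h_lim : Filter.Tendsto
      (fun n : ℕ =>
        2 * (Real.pi : ℂ)^2 * (n : ℂ)^2 *
            (∫ θ in (0:ℝ)..1,
              Complex.exp (-2 * Real.pi * Complex.I * n * θ) / (((|θ - 1/2| : ℝ) : ℂ) - z))
          - ((-1 : ℂ)^n / z^2 - 1 / ((1/2 - z)^2)))
      Filter.atTop (nhds 0) := by
    have h := (tendsto_integral_exp_mul_zero_one
      fun θ => 1 / (((|θ - 1 / 2| : ℝ) : ℂ) - z) ^ 3).neg
    rw [neg_zero] at h
    refine h.congr' ?_
    filter_upwards [eventually_ne_atTop 0] with n hn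
    exact (two_pi_sq_mul_green_eq hz hn).symm
  refine ⟨h_lim, ?_⟩
  obtain ⟨M, hM⟩ := (Metric.isBounded_range_of_tendsto _ h_lim).exists_norm_le
  refine ⟨M + (1 / ‖z‖ ^ 2 + 1 / ‖1 / 2 - z‖ ^ 2), fun n hn => ?_⟩
  have hMn := hM _ (Set.mem_range_self n)
  have hn0 : (0 : ℝ) < n := by exact_mod_cast hn
  set G := ∫ θ in (0:ℝ)..1,
    Complex.exp (-2 * Real.pi * Complex.I * n * θ) / (((|θ - 1/2| : ℝ) : ℂ) - z)
  have hmain : ‖(-1 : ℂ) ^ n / z ^ 2 - 1 / (1 / 2 - z) ^ 2‖ ≤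
      1 / ‖z‖ ^ 2 + 1 / ‖1 / 2 - z‖ ^ 2 :=
    (norm_sub_le _ _).trans_eq (by simp only [norm_div, norm_pow, norm_neg, norm_one, one_pow])
  have hscaled : ‖2 * (Real.pi : ℂ) ^ 2 * (n : ℂ) ^ 2 * G‖ = 2 * Real.pi ^ 2 * (n ^ 2 * ‖G‖) := by
    simp only [norm_mul, norm_pow, Complex.norm_real, Complex.norm_natCast, Complex.norm_two,
      Real.norm_eq_abs, sq_abs]
    ring
  have hle := (norm_le_norm_sub_add _ _).trans (add_le_add hMn hmain)
  rw [hscaled] at hle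
  rw [le_div_iff₀ (by positivity), mul_comm]
  refine le_trans (le_mul_of_one_le_left (by positivity) ?_) hle
  nlinarith [Real.pi_gt_three]
end
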